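/- (Extension Theorem) Let Q ≥ 36 be an integer and k a positive integer. Let G be a multigraph that may admit self-loops, and let S, R ⊆ V(G) with S ∩ R = ∅ and |S| ≥ 2. Suppose there exists a vertex v ∈ S incident to no self-loops with d(v) = Qk, together with a balanced edge subpartition P_k(v) of E(v) into k parts. If S is Qk-edge-connected in G and every vertex in R is incident to at least (Q−2)k edges, then there are k pairwise edge-disjoint S-subgraphs of G that balance S ∪ R and extend P_k(v). -/

import Mathlib

/-!
Multigraphs are modelled by a vertex type `V`, an edge type `E`, and an
incidence map `ends : E → Sym2 V` giving the (unordered) pair of endpoints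
of each edge.  Subgraphs are identified with their edge sets (`Set E`).
-/

namespace SteinerPacking

variable {V E : Type}

/-- The set of edges incident to a vertex `u` (denoted `E(u)` in the paper). -/
def incEdges (ends : E → Sym2 V) (u : V) : Set E := {e | u ∈ ends e}

/-- The degree `d(u) = |E(u)|` of a vertex. -/
noncomputable def deg (ends : E → Sym2 V) (u : V) : ℕ := (incEdges ends u).ncard

/-- One step along an edge of the edge set `F`. -/
def Step (ends : E → Sym2 V) (F : Set E) (a b : V) : Prop := ∃ e ∈ F, ends e = s(a, b)

/-- `a` and `b` are joined by a walk using only edges in `F`. -/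
def Reaches (ends : E → Sym2 V) (F : Set E) (a b : V) : Prop :=
  Relation.ReflTransGen (Step ends F) a b

/-- The vertex set `S` is connected in the subgraph with edge set `F`. -/
def ConnectsSet (ends : E → Sym2 V) (F : Set E) (S : Set V) : Prop :=
  ∀ a ∈ S, ∀ b ∈ S, Reaches ends F a b

/-- A walk from `u` to `w` given by a list of edges. -/
inductive IsWalk (ends : E → Sym2 V) : V → V → List E → Prop
  | nil (v : V) : IsWalk ends v v []
  | cons {u v w : V} {e : E} {l : List E} :
      ends e = s(u, v) → IsWalk ends v w l → IsWalk ends u w (e :: l)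

/-- A path from `u` to `v` using edges of `F` (a walk with no repeated edges). -/
def IsPathIn (ends : E → Sym2 V) (F : Set E) (u v : V) (l : List E) : Prop :=
  IsWalk ends u v l ∧ l.Nodup ∧ ∀ e ∈ l, e ∈ F

/-- There are `n` pairwise edge-disjoint paths from `u` to `v` inside `F`. -/
def EdgeDisjointPathsIn (ends : E → Sym2 V) (F : Set E) (n : ℕ) (u v : V) : Prop :=
  ∃ P : Fin n → List E, (∀ i, IsPathIn ends F u v (P i)) ∧
    ∀ i j, i ≠ j → ∀ e ∈ P i, e ∉ P j

/-- `S` is `n`-edge-connected in the (sub)graph with edge set `F`: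
any two distinct vertices of `S` are joined by `n` edge-disjoint paths. -/
def EdgeConnectedIn (ends : E → Sym2 V) (F : Set E) (S : Set V) (n : ℕ) : Prop :=
  ∀ a ∈ S, ∀ b ∈ S, a ≠ b → EdgeDisjointPathsIn ends F n a b

/-- A family of subgraphs (edge sets) is pairwise edge-disjoint. -/
def PairwiseEdgeDisjoint {k : ℕ} (H : Fin k → Set E) : Prop :=
  ∀ i j, i ≠ j → Disjoint (H i) (H j)

/-- `v` is a cut vertex of the subgraph with edge set `H`: some two vertices
distinct from `v` are connected in `H` but not after removing `v`. -/
def IsCutVertexOf (ends : E → Sym2 V) (H : Set E) (v : V) : Prop :=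
  ∃ a b : V, a ≠ v ∧ b ≠ v ∧ Reaches ends H a b ∧
    ¬ Reaches ends {e ∈ H | v ∉ ends e} a b

/-- A subpartition of `E(v)` into `k` (possibly empty) parts. -/
def IsSubpartitionAt {k : ℕ} (ends : E → Sym2 V) (v : V) (P : Fin k → Set E) : Prop :=
  (∀ i, P i ⊆ incEdges ends v) ∧ ∀ i j, i ≠ j → Disjoint (P i) (P j)

/-- A balanced partition of `E(v)` into `k` parts: each part has ≥ 2 edges. -/
def IsBalancedPartitionAt {k : ℕ} (ends : E → Sym2 V) (v : V) (P : Fin k → Set E) : Prop :=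
  IsSubpartitionAt ends v P ∧ (⋃ i, P i) = incEdges ends v ∧ ∀ i, 2 ≤ (P i).ncard

/-- A balanced subpartition of `E(v)`: one extendable to a balanced partition. -/
def IsBalancedSubpartitionAt {k : ℕ} (ends : E → Sym2 V) (v : V) (P : Fin k → Set E) : Prop :=
  IsSubpartitionAt ends v P ∧
    ∃ P' : Fin k → Set E, IsBalancedPartitionAt ends v P' ∧ ∀ i, P i ⊆ P' i

/-- The subgraphs `H 1, …, H k` extend the subpartition `P` at `v`:
`P i ⊆ H i` and `v` is not a cut vertex of any `H i`. -/
def Extend {k : ℕ} (ends : E → Sym2 V) (v : V) (P H : Fin k → Set E) : Prop :=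
  ∀ i, P i ⊆ H i ∧ ¬ IsCutVertexOf ends (H i) v

/-- The subgraphs `H 1, …, H k` balance the vertex `u`. -/
def BalanceVertex {k : ℕ} (ends : E → Sym2 V) (H : Fin k → Set E) (u : V) : Prop :=
  IsBalancedSubpartitionAt ends u (fun i => incEdges ends u ∩ H i)

/-- The subgraphs `H 1, …, H k` balance every vertex of `T`. -/
def BalanceSet {k : ℕ} (ends : E → Sym2 V) (H : Fin k → Set E) (T : Set V) : Prop :=
  ∀ u ∈ T, BalanceVertex ends H u

/-- A loopless multigraph. -/
def Loopless (ends : E → Sym2 V) : Prop := ∀ e : E, ¬ (ends e).IsDiag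

/-- The set of neighbors of a vertex. -/
def neighbors (ends : E → Sym2 V) (u : V) : Set V := {w | ∃ e, ends e = s(u, w)}

section Rado
open Submodule Module

theorem exists_spanning_selection {ι M : Type*} [DecidableEq ι] [AddCommGroup M] [Module ℚ M]
    [FiniteDimensional ℚ M] (A : ι → Set M) (J : Finset ι) :
    ∀ C : Submodule ℚ M,
      (∀ K ⊆ J, finrank ℚ M ≤ finrank ℚ ↥(C ⊔ span ℚ (⋃ j ∈ K, A j)) + (J \ K).card) →
      ∃ u : ι → M, (∀ j ∈ J, u j ∈ A j ∨ u j = 0) ∧ C ⊔ span ℚ (u '' (J : Set ι)) = ⊤ := by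
  induction J using Finset.induction_on with
  | empty =>
    intro C h
    refine ⟨fun _ => 0, by simp, ?_⟩
    have h0 := h ∅ (Finset.Subset.refl _)
    have e : (⋃ j ∈ (∅ : Finset ι), A j) = ∅ := by simp
    rw [e, span_empty, sup_bot_eq, Finset.sdiff_self, Finset.card_empty, add_zero] at h0
    simp only [Finset.coe_empty, Set.image_empty, span_empty, sup_bot_eq]
    exact eq_top_of_finrank_eq (le_antisymm (finrank_le C) h0)
  | insert j J hj ih =>
    intro C h
    have hcard : ∀ K ⊆ J, (insert j J \ K).card = (J \ K).card + 1 := by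
      intro K hK
      rw [Finset.insert_sdiff_of_notMem _ (fun hh => hj (hK hh)), Finset.card_insert_of_notMem]
      simp [hj]
    set φ : Finset ι → Submodule ℚ M := fun K => C ⊔ span ℚ (⋃ j ∈ K, A j) with hφ
    have h' : ∀ K ⊆ insert j J, finrank ℚ M ≤ finrank ℚ ↥(φ K) + (insert j J \ K).card := h
    clear h
    have hmono : ∀ K K' : Finset ι, K ⊆ K' → φ K ≤ φ K' := by
      intro K K' hK
      exact sup_le_sup_left (span_mono (Set.biUnion_subset_biUnion_left hK)) _
    by_cases hT : ∃ K ⊆ J, finrank ℚ ↥(φ K) + (insert j J \ K).card = finrank ℚ M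
    · classical
      set 𝒯 : Finset (Finset ι) := J.powerset.filter
        (fun K => finrank ℚ ↥(φ K) + (insert j J \ K).card = finrank ℚ M) with h𝒯
      have hne : 𝒯.Nonempty := by
        obtain ⟨K, hK, hK'⟩ := hT
        exact ⟨K, by simp [h𝒯, hK, hK']⟩
      obtain ⟨Ks, hKs, hmax⟩ := Finset.exists_max_image 𝒯 Finset.card hne
      simp only [h𝒯, Finset.mem_filter, Finset.mem_powerset] at hKs hmax
      obtain ⟨hKsJ, hKst⟩ := hKs
      have hnot : ¬ A j ⊆ φ Ks := by
        intro hsub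
        have h1 := h' (insert j Ks) (Finset.insert_subset_insert _ hKsJ)
        have h2 : φ (insert j Ks) ≤ φ Ks := by
          refine sup_le le_sup_left (span_le.2 ?_)
          simp only [Finset.mem_insert, Set.iUnion_iUnion_eq_or_left, Set.union_subset_iff]
          refine ⟨hsub, fun x hx => ?_⟩
          exact (le_sup_right : span ℚ (⋃ j ∈ Ks, A j) ≤ φ Ks) (subset_span hx)
        have h3 := Submodule.finrank_mono h2
        have h4 : (insert j J \ insert j Ks).card + 1 = (insert j J \ Ks).card := by
          rw [hcard _ hKsJ]
          congr 2
          ext x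
          simp only [Finset.mem_sdiff, Finset.mem_insert, not_or]
          constructor
          · rintro ⟨h1 | h1, h2, h3⟩
            · exact absurd h1 h2
            · exact ⟨h1, h3⟩
          · rintro ⟨h1, h2⟩
            exact ⟨Or.inr h1, fun h => hj (h ▸ h1), h2⟩
        omega
      obtain ⟨u, huA, hu⟩ := Set.not_subset.1 hnot
      obtain ⟨w, hw, hw'⟩ := ih (C ⊔ span ℚ {u}) (by
        intro K hK
        have h1 := h' K (hK.trans (Finset.subset_insert _ _))
        have h2 : φ K ≤ C ⊔ span ℚ {u} ⊔ span ℚ (⋃ j ∈ K, A j) :=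
          sup_le (le_sup_left.trans le_sup_left) le_sup_right
        have h3 := Submodule.finrank_mono h2
        have h5 := hcard K hK
        by_cases ht : finrank ℚ ↥(φ K) + (insert j J \ K).card = finrank ℚ M
        · have hKK : K ⊆ Ks := by
            have hun : K ∪ Ks ⊆ J := Finset.union_subset hK hKsJ
            have hs : φ (K ∪ Ks) ≤ φ K ⊔ φ Ks := by
              refine sup_le (le_sup_left.trans le_sup_left) (span_le.2 ?_)
              intro x hx
              simp only [Finset.mem_union, Set.mem_iUnion] at hx
              obtain ⟨l, hl | hl, hx⟩ := hx
              · exact (le_sup_right.trans le_sup_left : span ℚ (⋃ j ∈ K, A j) ≤ φ K ⊔ φ Ks)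
                  (subset_span (Set.mem_biUnion hl hx))
              · exact (le_sup_right.trans le_sup_right : span ℚ (⋃ j ∈ Ks, A j) ≤ φ K ⊔ φ Ks)
                  (subset_span (Set.mem_biUnion hl hx))
            have hi : φ (K ∩ Ks) ≤ φ K ⊓ φ Ks :=
              le_inf (hmono _ _ Finset.inter_subset_left) (hmono _ _ Finset.inter_subset_right)
            have e1 := Submodule.finrank_sup_add_finrank_inf_eq (φ K) (φ Ks)
            have e2 := Submodule.finrank_mono hs
            have e3 := Submodule.finrank_mono hi
            have e4 := h' (K ∪ Ks) (hun.trans (Finset.subset_insert _ _))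
            have e5 := h' (K ∩ Ks) ((Finset.inter_subset_left.trans hK).trans
              (Finset.subset_insert _ _))
            have c1 := Finset.card_sdiff_add_card_eq_card (hun.trans (Finset.subset_insert j _))
            have c2 := Finset.card_sdiff_add_card_eq_card
              ((Finset.inter_subset_left.trans hK).trans (Finset.subset_insert j _) :
                K ∩ Ks ⊆ insert j J)
            have c3 := Finset.card_sdiff_add_card_eq_card (hK.trans (Finset.subset_insert j _))
            have c4 := Finset.card_sdiff_add_card_eq_card (hKsJ.trans (Finset.subset_insert j _))
            have c5 := Finset.card_union_add_card_inter K Ks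
            have e6 : finrank ℚ ↥(φ (K ∪ Ks)) + (insert j J \ (K ∪ Ks)).card = finrank ℚ M := by
              omega
            have := hmax (K ∪ Ks) ⟨hun, e6⟩
            have := Finset.eq_of_subset_of_card_le (Finset.subset_union_right : Ks ⊆ K ∪ Ks) this
            rw [this]
            exact Finset.subset_union_left
          have hlt : φ K < C ⊔ span ℚ {u} ⊔ span ℚ (⋃ j ∈ K, A j) := by
            refine lt_of_le_of_ne h2 (fun heq => hu (hmono _ _ hKK ?_))
            rw [heq]
            exact (le_sup_right.trans le_sup_left :
              span ℚ {u} ≤ C ⊔ span ℚ {u} ⊔ span ℚ (⋃ j ∈ K, A j)) (mem_span_singleton_self u)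
          have := Submodule.finrank_lt_finrank_of_lt hlt
          omega
        · change finrank ℚ M ≤ finrank ℚ ↥(C ⊔ span ℚ {u} ⊔ span ℚ (⋃ j ∈ K, A j)) + _
          omega)
      refine ⟨Function.update w j u, ?_, ?_⟩
      · intro l hl
        by_cases hlj : l = j
        · subst hlj
          simp [huA]
        · rw [Function.update_of_ne hlj]
          exact hw l (Finset.mem_of_mem_insert_of_ne hl hlj)
      · rw [← hw', Finset.coe_insert, Set.image_insert_eq, Function.update_self, span_insert,
          ← sup_assoc]
        congr 2
        refine Set.image_congr (fun l hl => Function.update_of_ne ?_ _ _)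
        rintro rfl
        exact hj hl
    · push Not at hT
      obtain ⟨w, hw, hw'⟩ := ih C (by
        intro K hK
        have h1 := h' K (hK.trans (Finset.subset_insert _ _))
        have h5 := hcard K hK
        have h6 := hT K hK
        change _ ≤ finrank ℚ ↥(φ K) + _
        omega)
      refine ⟨Function.update w j 0, ?_, ?_⟩
      · intro l hl
        by_cases hlj : l = j
        · subst hlj
          simp
        · rw [Function.update_of_ne hlj]
          exact hw l (Finset.mem_of_mem_insert_of_ne hl hlj)
      · have himg : Function.update w j 0 '' (J : Set ι) = w '' (J : Set ι) := by
          refine Set.image_congr (fun l hl => Function.update_of_ne ?_ _ _)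
          rintro rfl
          exact hj hl
        rw [Finset.coe_insert, Set.image_insert_eq, himg, Function.update_self, span_insert_zero,
          hw']

end Rado

section Packing
open Submodule Module
open scoped Classical in
theorem exists_hypergraph_packing {V ι κ : Type*} [Fintype V] [Fintype κ] [Nonempty κ]
    (X : Finset V) (hX : X.Nonempty) (J : Finset ι) (hs : ι → Finset V)
    (hsX : ∀ j ∈ J, hs j ⊆ X)
    (h : ∀ π : V → V, Fintype.card κ * ((X.image π).card - 1) ≤
      (J.filter (fun j => ∃ a ∈ hs j, ∃ b ∈ hs j, π a ≠ π b)).card) :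
    ∃ col : ι → κ, ∀ i, ∀ Z : Set V, (∃ a ∈ X, a ∈ Z) → (∃ a ∈ X, a ∉ Z) →
      ∃ j ∈ J, col j = i ∧ ∃ a ∈ hs j, ∃ b ∈ hs j, a ∈ Z ∧ b ∉ Z := by
  obtain ⟨t0, ht0⟩ := hX
  let e : κ → V → (κ × V → ℚ) := fun i x => Pi.single (i, x) 1
  let A : ι → Set (κ × V → ℚ) := fun j => {m | ∃ i, ∃ a ∈ hs j, ∃ b ∈ hs j, m = e i a - e i b}
  let C : Submodule ℚ (κ × V → ℚ) := span ℚ {m | ∃ i x, (x ∉ X ∨ x = t0) ∧ m = e i x}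
  have hmain := exists_spanning_selection A J C (by
    intro K hK
    let U : Submodule ℚ (κ × V → ℚ) := C ⊔ span ℚ (⋃ j ∈ K, A j)
    let s : Setoid V := ⟨fun x y => ∀ i, e i x - e i y ∈ U, by
      refine ⟨fun x i => by simp, fun {x y} h i => ?_, fun {x y z} h1 h2 i => ?_⟩
      · have := U.neg_mem (h i)
        rwa [neg_sub] at this
      · have := U.add_mem (h1 i) (h2 i)
        rwa [sub_add_sub_cancel] at this⟩
    let π : V → V := fun x => (Quotient.mk s x).out
    have hπ : ∀ x i, e i (π x) - e i x ∈ U := fun x => Quotient.mk_out (s := s) x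
    have hπe : ∀ x y, (∀ i, e i x - e i y ∈ U) → π x = π y := by
      intro x y hxy
      exact congrArg Quotient.out (Quotient.sound (s := s) hxy)
    have hKU : ∀ j ∈ K, ∀ a ∈ hs j, ∀ b ∈ hs j, π a = π b := by
      intro j hj a ha b hb
      refine hπe _ _ (fun i => ?_)
      exact (le_sup_right : _ ≤ U) (subset_span (Set.mem_biUnion hj ⟨i, a, ha, b, hb, rfl⟩))
    have hcard : (J.filter (fun j => ∃ a ∈ hs j, ∃ b ∈ hs j, π a ≠ π b)).card ≤ (J \ K).card := by
      refine Finset.card_le_card (fun j hj => ?_)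
      obtain ⟨hj, a, ha, b, hb, hab⟩ := Finset.mem_filter.1 hj
      exact Finset.mem_sdiff.2 ⟨hj, fun hjK => hab (hKU j hjK a ha b hb)⟩
    let Y : Finset (κ × V → ℚ) :=
      (Finset.univ ×ˢ ((X.image π).erase (π t0))).image (fun p : κ × V => e p.1 p.2)
    have hY : Y.card ≤ Fintype.card κ * ((X.image π).card - 1) := by
      refine Finset.card_image_le.trans ?_
      rw [Finset.card_product, Finset.card_univ, Finset.card_erase_of_mem
        (Finset.mem_image_of_mem _ ht0)]
    have hCU : ∀ i x, (x ∉ X ∨ x = t0) → e i x ∈ U := fun i x hx =>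
      (le_sup_left : C ≤ U) (subset_span ⟨i, x, hx, rfl⟩)
    have htop : U ⊔ span ℚ (Y : Set (κ × V → ℚ)) = ⊤ := by
      have hall : ∀ i x, e i x ∈ U ⊔ span ℚ (Y : Set (κ × V → ℚ)) := by
        intro i x
        by_cases hx : x ∈ X
        · have h1 : e i (π x) ∈ U ⊔ span ℚ (Y : Set (κ × V → ℚ)) := by
            by_cases hp : π x = π t0
            · rw [hp]
              refine (le_sup_left : U ≤ _) ?_
              have := U.add_mem (hπ t0 i) (hCU i t0 (Or.inr rfl))
              rwa [sub_add_cancel] at this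
            · refine (le_sup_right : span ℚ (Y : Set (κ × V → ℚ)) ≤ _) (subset_span ?_)
              refine Finset.mem_coe.2 (Finset.mem_image.2 ⟨(i, π x), ?_, rfl⟩)
              simp [hp, Finset.mem_image_of_mem π hx]
          have h2 := Submodule.sub_mem _ h1 ((le_sup_left : U ≤ U ⊔ span ℚ (Y : Set _)) (hπ x i))
          rwa [sub_sub_cancel] at h2
        · exact (le_sup_left : U ≤ _) (hCU i x (Or.inl hx))
      rw [eq_top_iff]
      intro m _
      have : m = ∑ p : κ × V, m p • e p.1 p.2 := by
        ext q
        simp [e, Finset.sum_apply, Pi.single_apply]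
      rw [this]
      exact Submodule.sum_mem _ (fun p _ => Submodule.smul_mem _ _ (hall _ _))
    have h1 := Submodule.finrank_add_le_finrank_add_finrank U (span ℚ (Y : Set (κ × V → ℚ)))
    rw [htop, finrank_top] at h1
    have h2 := finrank_span_finset_le_card (R := ℚ) Y
    have h3 := h π
    have h4 : finrank ℚ (κ × V → ℚ) ≤ finrank ℚ ↥U + (J \ K).card := by
      rw [Set.finrank] at h2
      omega
    exact h4)
  obtain ⟨u, hu, htop⟩ := hmain
  have hex : ∀ j, ∃ i : κ, u j ∈ A j → ∃ a ∈ hs j, ∃ b ∈ hs j, u j = e i a - e i b := by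
    intro j
    by_cases hj : u j ∈ A j
    · obtain ⟨i, hi⟩ := id hj
      exact ⟨i, fun _ => hi⟩
    · exact ⟨Classical.arbitrary κ, fun h => absurd h hj⟩
  choose col hcol using hex
  refine ⟨col, ?_⟩
  have key : ∀ i, ∀ Z : Set V, (∃ a ∈ X, a ∈ Z) → t0 ∉ Z →
      ∃ j ∈ J, col j = i ∧ ∃ a ∈ hs j, ∃ b ∈ hs j, a ∈ Z ∧ b ∉ Z := by
    intro i Z ⟨z, hzX, hzZ⟩ ht
    by_contra hcon
    push Not at hcon
    let f : (κ × V → ℚ) →ₗ[ℚ] ℚ := ∑ x ∈ X.filter (· ∈ Z), LinearMap.proj (i, x)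
    have hf : ∀ i' x, f (e i' x) = if i' = i ∧ x ∈ X ∧ x ∈ Z then 1 else 0 := by
      intro i' x
      simp only [f, e, LinearMap.sum_apply, LinearMap.proj_apply, Pi.single_apply, Prod.mk.injEq]
      by_cases hi : i' = i
      · subst hi
        simp [Finset.sum_ite_eq']
      · simp [hi, Ne.symm hi]
    have hker : C ⊔ span ℚ (u '' (J : Set ι)) ≤ LinearMap.ker f := by
      refine sup_le (span_le.2 ?_) (span_le.2 ?_)
      · rintro m ⟨i', x, hx, rfl⟩
        simp only [SetLike.mem_coe, LinearMap.mem_ker, hf]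
        rw [if_neg]
        rintro ⟨-, h1, h2⟩
        rcases hx with hx | rfl
        · exact hx h1
        · exact ht h2
      · rintro m ⟨j, hj, rfl⟩
        simp only [SetLike.mem_coe, LinearMap.mem_ker]
        rcases hu j hj with hA | h0
        · obtain ⟨a, ha, b, hb, hab⟩ := hcol j hA
          rw [hab, map_sub, hf, hf]
          by_cases hc : col j = i
          · have h1 := hcon j hj hc a ha b hb
            have h2 := hcon j hj hc b hb a ha
            have h3 := hsX j hj ha
            have h4 := hsX j hj hb
            have : a ∈ Z ↔ b ∈ Z := ⟨h1, h2⟩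
            simp [h3, h4, this]
          · simp [hc]
        · rw [h0, map_zero]
    rw [htop] at hker
    have h1 : e i z ∈ LinearMap.ker f := hker trivial
    rw [LinearMap.mem_ker, hf] at h1
    simp [hzX, hzZ] at h1
  intro i Z hZ1 ⟨y, hyX, hyZ⟩
  by_cases ht : t0 ∈ Z
  · obtain ⟨j, hj, hc, a, ha, b, hb, haZ, hbZ⟩ := key i Zᶜ ⟨y, hyX, hyZ⟩ (by simpa using ht)
    exact ⟨j, hj, hc, b, hb, a, ha, by simpa using hbZ, haZ⟩
  · exact key i Z hZ1 ht

end Packing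

section Hyper
open scoped Classical

variable {V ι : Type*}

/-- The set `X` separates the set `s`. -/
def Separates (X s : Finset V) : Prop := (∃ a ∈ s, a ∈ X) ∧ ∃ a ∈ s, a ∉ X

/-- A hypergraph on `insert v T` with hyperedges of size two and three and large cuts. -/
structure IsCubicInstance (J : Finset ι) (hs : ι → Finset V) (T S : Finset V) (v : V)
    (k L D : ℕ) (π : ι → Fin k) : Prop where
  sub : ∀ j ∈ J, hs j ⊆ insert v T
  card : ∀ j ∈ J, (hs j).card = 2 ∨ (hs j).card = 3
  notMem : v ∉ T
  nonempty : T.Nonempty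
  subset : S ⊆ T
  pos : 0 < k
  large : 32 * k ≤ L
  upper : D ≤ L + 4 * k
  degree : (J.filter (v ∈ hs ·)).card = D
  cut : ∀ X ⊆ T, X.Nonempty → X ≠ T → L ≤ (J.filter (Separates X <| hs ·)).card
  cutS : ∀ X ⊆ T, (X ∩ S).Nonempty → D ≤ (J.filter (Separates X <| hs ·)).card
  empty : S = ∅ → D ≤ L
  two : S.Nonempty → ∀ i, 2 ≤ (J.filter (fun j => v ∈ hs j ∧ π j = i)).card

namespace IsCubicInstance

variable {J : Finset ι} {hs : ι → Finset V} {T S : Finset V} {v : V} {k L D : ℕ} {π : ι → Fin k}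

theorem max_le_cut (h : IsCubicInstance J hs T S v k L D π) {X : Finset V} (hX : X ⊆ T)
    (hne : X.Nonempty) (hXT : X ≠ T) (hS : S = ∅ ∨ (X ∩ S).Nonempty) :
    D ≤ (J.filter (Separates X <| hs ·)).card := by
  rcases hS with hS | hS
  · exact (h.empty hS).trans (h.cut X hX hne hXT)
  · exact h.cutS X hX hS

/-- Counting hyperedges leaving the classes of a labelling. -/
theorem labels_le (h : IsCubicInstance J hs T S v k L D π) {β : Type*} [DecidableEq β] (l : V → β)
    (hp : 2 ≤ (T.image l).card) :
    ((T.image l).card - 1) * L ≤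
      3 * (J.filter (fun j => v ∉ hs j ∧ ∃ a ∈ hs j, ∃ b ∈ hs j, l a ≠ l b)).card + D := by
  set cl : β → Finset V := fun q => T.filter (l · = q) with hcl
  have hne : ∀ q ∈ T.image l, (cl q).Nonempty ∧ cl q ≠ T := by
    intro q hq
    obtain ⟨x, hx, rfl⟩ := Finset.mem_image.1 hq
    refine ⟨⟨x, by simp [hcl, hx]⟩, fun heq => ?_⟩
    obtain ⟨q', hq', hne⟩ := Finset.exists_mem_ne (show 1 < (T.image l).card by omega) (l x)
    obtain ⟨y, hy, rfl⟩ := Finset.mem_image.1 hq'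
    rw [← heq] at hy
    exact hne (Finset.mem_filter.1 hy).2
  have hex : ∃ q ∈ T.image l, D ≤ (J.filter (Separates (cl q) <| hs ·)).card := by
    rcases S.eq_empty_or_nonempty with hS | ⟨s, hs'⟩
    · obtain ⟨x, hx⟩ := h.nonempty
      have hq := Finset.mem_image_of_mem l hx
      exact ⟨l x, hq, h.max_le_cut (Finset.filter_subset _ _) (hne _ hq).1 (hne _ hq).2 (Or.inl hS)⟩
    · have hq := Finset.mem_image_of_mem l (h.subset hs')
      exact ⟨l s, hq, h.max_le_cut (Finset.filter_subset _ _) (hne _ hq).1 (hne _ hq).2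
        (Or.inr ⟨s, by simp [hcl, h.subset hs', hs']⟩)⟩
  obtain ⟨q0, hq0, hD⟩ := hex
  have hlow : ((T.image l).card - 1) * L + D ≤
      ∑ q ∈ T.image l, (J.filter (Separates (cl q) <| hs ·)).card := by
    rw [← Finset.sum_erase_add _ _ hq0]
    refine add_le_add ?_ hD
    rw [← Finset.card_erase_of_mem hq0, ← smul_eq_mul]
    refine Finset.card_nsmul_le_sum _ _ _ (fun q hq => ?_)
    have hq := Finset.mem_of_mem_erase hq
    exact h.cut _ (Finset.filter_subset _ _) (hne _ hq).1 (hne _ hq).2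
  have hswap : ∑ q ∈ T.image l, (J.filter (Separates (cl q) <| hs ·)).card =
      ∑ j ∈ J, ((T.image l).filter (fun q => Separates (cl q) (hs j))).card :=
    Finset.sum_card_bipartiteAbove_eq_sum_card_bipartiteBelow _
  have hup : ∀ j ∈ J, ((T.image l).filter (fun q => Separates (cl q) (hs j))).card ≤
      3 * (if v ∉ hs j ∧ ∃ a ∈ hs j, ∃ b ∈ hs j, l a ≠ l b then 1 else 0) +
      2 * (if v ∈ hs j then 1 else 0) := by
    intro j hj
    have hsub : (T.image l).filter (fun q => Separates (cl q) (hs j)) ⊆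
        ((hs j).erase v).image l := by
      intro q hq
      obtain ⟨-, ⟨a, ha, haq⟩, -⟩ := Finset.mem_filter.1 hq
      obtain ⟨haT, rfl⟩ := Finset.mem_filter.1 haq
      refine Finset.mem_image_of_mem _ (Finset.mem_erase.2 ⟨?_, ha⟩)
      rintro rfl
      exact h.notMem haT
    have hle := (Finset.card_le_card hsub).trans Finset.card_image_le
    have hc := h.card j hj
    by_cases hv : v ∈ hs j
    · rw [Finset.card_erase_of_mem hv] at hle
      simp only [hv, not_true_eq_false, false_and, if_false, if_true]
      omega
    · rw [Finset.erase_eq_of_notMem hv] at hle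
      by_cases hab : ∃ a ∈ hs j, ∃ b ∈ hs j, l a ≠ l b
      · rw [if_pos ⟨hv, hab⟩]
        omega
      · suffices ((T.image l).filter (fun q => Separates (cl q) (hs j))) = ∅ by
          rw [this, Finset.card_empty]
          exact Nat.zero_le _
        refine Finset.filter_eq_empty_iff.2 ?_
        rintro q - ⟨⟨a, ha, haq⟩, b, hb, hbq⟩
        refine hab ⟨a, ha, b, hb, fun heq => hbq ?_⟩
        have hbT := (Finset.mem_insert.1 (h.sub j hj hb)).resolve_left (by rintro rfl; exact hv hb)
        exact Finset.mem_filter.2 ⟨hbT, heq ▸ (Finset.mem_filter.1 haq).2⟩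
  have hsum := Finset.sum_le_sum hup
  rw [Finset.sum_add_distrib, ← Finset.mul_sum, ← Finset.mul_sum, ← Finset.card_filter,
    ← Finset.card_filter, h.degree] at hsum
  omega

/-- A set separated by few hyperedges avoiding `v` is well connected inside. -/
theorem exists_side_packing [Fintype V] (h : IsCubicInstance J hs T S v k L D π) {X : Finset V} (hX : X ⊆ T)
    (hne : X.Nonempty) (hXT : X ≠ T)
    (hsmall : 3 * (J.filter (fun j => v ∉ hs j ∧ Separates X (hs j))).card < 14 * k) :
    ∃ col : ι → Fin k × Bool, ∀ i, ∀ Z : Set V, (∃ a ∈ X, a ∈ Z) → (∃ a ∈ X, a ∉ Z) →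
      ∃ j ∈ J.filter (fun j => v ∉ hs j ∧ hs j ⊆ X), col j = i ∧
        ∃ a ∈ hs j, ∃ b ∈ hs j, a ∈ Z ∧ b ∉ Z := by
  have : Nonempty (Fin k × Bool) := ⟨(⟨0, h.pos⟩, true)⟩
  refine exists_hypergraph_packing X hne _ hs (fun j hj => (Finset.mem_filter.1 hj).2.2) ?_
  intro σ
  by_cases hp : (X.image σ).card ≤ 1
  · rw [Nat.sub_eq_zero_of_le hp, mul_zero]
    exact Nat.zero_le _
  let l : V → Option V := fun x => if x ∈ X then some (σ x) else none
  have himg : T.image l = insert none ((X.image σ).image some) := by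
    ext q
    simp only [Finset.mem_image, Finset.mem_insert, exists_exists_and_eq_and, l]
    constructor
    · rintro ⟨a, ha, rfl⟩
      by_cases haX : a ∈ X
      · right
        exact ⟨a, haX, by simp [haX]⟩
      · left
        simp [haX]
    · rintro (rfl | ⟨a, ha, rfl⟩)
      · obtain ⟨y, hyT, hyX⟩ := Finset.exists_of_ssubset (hX.ssubset_of_ne hXT)
        exact ⟨y, hyT, by simp [hyX]⟩
      · exact ⟨a, hX ha, by simp [ha]⟩
  have hcard : (T.image l).card = (X.image σ).card + 1 := by
    rw [himg, Finset.card_insert_of_notMem (by simp),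
      Finset.card_image_of_injective _ (Option.some_injective V)]
  have hlab := h.labels_le l (by omega)
  have hle : (J.filter (fun j => v ∉ hs j ∧ ∃ a ∈ hs j, ∃ b ∈ hs j, l a ≠ l b)).card ≤
      (J.filter (fun j => v ∉ hs j ∧ Separates X (hs j))).card +
      ((J.filter (fun j => v ∉ hs j ∧ hs j ⊆ X)).filter
        (fun j => ∃ a ∈ hs j, ∃ b ∈ hs j, σ a ≠ σ b)).card := by
    refine (Finset.card_le_card ?_).trans (Finset.card_union_le _ _)
    intro j hj
    obtain ⟨hjJ, hv, a, ha, b, hb, hab⟩ := Finset.mem_filter.1 hj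
    rw [Finset.mem_union, Finset.mem_filter, Finset.mem_filter, Finset.mem_filter]
    by_cases hsub : hs j ⊆ X
    · right
      refine ⟨⟨hjJ, hv, hsub⟩, a, ha, b, hb, fun heq => hab ?_⟩
      simp [l, hsub ha, hsub hb, heq]
    · left
      refine ⟨hjJ, hv, ?_, Finset.not_subset.1 hsub⟩
      by_contra hcon
      push Not at hcon
      exact hab (by simp [l, hcon a ha, hcon b hb])
  have hL := h.large
  have hU := h.upper
  rw [hcard, Nat.add_sub_cancel] at hlab
  rw [Fintype.card_prod, Fintype.card_fin, Fintype.card_bool]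
  obtain ⟨q, hq⟩ : ∃ q, (X.image σ).card = q + 2 := ⟨(X.image σ).card - 2, by omega⟩
  rw [hq] at hlab ⊢
  have e1 : (q + 2) * L = (q + 1) * L + L := by ring
  have e2 : (q + 1) * (32 * k) ≤ (q + 1) * L := Nat.mul_le_mul_left _ hL
  have e3 : k * 2 * (q + 2 - 1) = 2 * (q * k) + 2 * k := by
    have : q + 2 - 1 = q + 1 := by omega
    rw [this]; ring
  have e4 : (q + 1) * (32 * k) = 32 * (q * k) + 32 * k := by ring
  rw [e3]
  omega

end IsCubicInstance
end Hyper

section Hyper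
open scoped Classical

variable {V ι : Type*}

/-- The vertex `t` has to be connected in colour `i`. -/
def CubicTarget (J : Finset ι) (hs : ι → Finset V) (S : Finset V) (v : V) {k : ℕ}
    (π : ι → Fin k) (c : ι → V → Fin k) (i : Fin k) (t : V) : Prop :=
  t ∈ S ∨ ∃ j ∈ J, v ∈ hs j ∧ π j = i ∧ t ∈ hs j ∧ t ≠ v ∧ c j t = i

/-- A colouring of the flags of a hypergraph that is balanced on `T` and connects all targets. -/
structure IsCubicColoring (J : Finset ι) (hs : ι → Finset V) (T S : Finset V) (v : V) {k : ℕ}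
    (π : ι → Fin k) (c : ι → V → Fin k) : Prop where
  const : ∀ j ∈ J, v ∉ hs j → ∀ s t, c j s = c j t
  extend : ∀ j ∈ J, v ∈ hs j → ∃ t ∈ hs j, t ≠ v ∧ c j t = π j
  balance : (2 ≤ T.card ∨ ∀ i, 2 ≤ (J.filter (fun j => v ∈ hs j ∧ π j = i)).card) →
    ∀ t ∈ T, ∀ i, 2 ≤ (J.filter (fun j => t ∈ hs j ∧ c j t = i)).card
  conn : ∀ i, ∀ Z : Set V, (∃ t ∈ T, CubicTarget J hs S v π c i t ∧ t ∈ Z) →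
    (∃ t ∈ T, CubicTarget J hs S v π c i t ∧ t ∉ Z) →
    ∃ j ∈ J, ∃ a ∈ hs j, ∃ b ∈ hs j, a ≠ v ∧ b ≠ v ∧ a ∈ Z ∧ b ∉ Z ∧ c j a = i ∧ c j b = i

theorem two_le_card_of_bool {κ : Type*} {F : Finset ι} (f : κ × Bool → ι) (i : κ)
    (hf : f (i, true) ≠ f (i, false)) (h : ∀ b, f (i, b) ∈ F) : 2 ≤ F.card := by
  rw [← Finset.card_pair hf]
  refine Finset.card_le_card ?_
  intro x hx
  rcases Finset.mem_insert.1 hx with rfl | hx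
  · exact h _
  · rw [Finset.mem_singleton.1 hx]
    exact h _

namespace IsCubicInstance

variable {J : Finset ι} {hs : ι → Finset V} {T S : Finset V} {v : V} {k L D : ℕ} {π : ι → Fin k}

theorem exists_mem_ne (h : IsCubicInstance J hs T S v k L D π) {j : ι} (hj : j ∈ J) :
    ∃ t ∈ hs j, t ≠ v ∧ t ∈ T := by
  have := h.card j hj
  obtain ⟨t, ht, htv⟩ := Finset.exists_mem_ne (show 1 < (hs j).card by omega) v
  exact ⟨t, ht, htv, (Finset.mem_insert.1 (h.sub j hj ht)).resolve_left htv⟩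

theorem mem_of_notMem (h : IsCubicInstance J hs T S v k L D π) {j : ι} (hj : j ∈ J)
    {t : V} (ht : t ∈ hs j) (htv : t ≠ v) : t ∈ T :=
  (Finset.mem_insert.1 (h.sub j hj ht)).resolve_left htv

theorem exists_coloring_singleton (h : IsCubicInstance J hs T S v k L D π) (hT : T.card = 1) :
    ∃ c, IsCubicColoring J hs T S v π c := by
  obtain ⟨t, rfl⟩ := Finset.card_eq_one.1 hT
  have htv : t ≠ v := fun e => h.notMem (by simp [e])
  have hpair : ∀ j ∈ J, v ∈ hs j ∧ t ∈ hs j := by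
    intro j hj
    have h1 := h.sub j hj
    have h2 := Finset.card_le_two (a := v) (b := t)
    have h3 := h.card j hj
    have h4 := Finset.eq_of_subset_of_card_le h1 (by omega)
    rw [h4]
    simp
  refine ⟨fun j _ => π j, ⟨fun _ _ _ _ _ => rfl, fun j hj _ => ⟨t, (hpair j hj).2, htv, rfl⟩, ?_, ?_⟩⟩
  · rintro hb s hs' i
    rcases hb with hb | hb
    · simp at hb
    rw [Finset.mem_singleton.1 hs']
    refine (hb i).trans (Finset.card_le_card ?_)
    intro j hj
    obtain ⟨hj, -, hc⟩ := Finset.mem_filter.1 hj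
    exact Finset.mem_filter.2 ⟨hj, (hpair j hj).2, hc⟩
  · rintro i Z ⟨a, ha, -, haZ⟩ ⟨b, hb, -, hbZ⟩
    rw [Finset.mem_singleton.1 ha] at haZ
    rw [Finset.mem_singleton.1 hb] at hbZ
    exact absurd haZ hbZ

theorem exists_coloring_of_large [Fintype V] (h : IsCubicInstance J hs T S v k L D π)
    (hT : 2 ≤ T.card)
    (hlarge : ∀ X ⊆ T, X.Nonempty → X ≠ T →
      14 * k ≤ 3 * (J.filter (fun j => v ∉ hs j ∧ Separates X (hs j))).card) :
    ∃ c, IsCubicColoring J hs T S v π c := by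
  have hnT : ∀ j ∈ J, v ∉ hs j → hs j ⊆ T := fun j hj hv t ht =>
    h.mem_of_notMem hj ht (by rintro rfl; exact hv ht)
  have : Nonempty (Fin k × Bool) := ⟨(⟨0, h.pos⟩, true)⟩
  obtain ⟨col, hcol⟩ := exists_hypergraph_packing (κ := Fin k × Bool) T h.nonempty
    (J.filter (fun j => v ∉ hs j)) hs (fun j hj => by
      rw [Finset.mem_filter] at hj
      exact hnT j hj.1 hj.2) (by
    intro l
    rw [Fintype.card_prod, Fintype.card_fin, Fintype.card_bool, Finset.filter_filter]
    by_cases hp : (T.image l).card ≤ 1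
    · rw [Nat.sub_eq_zero_of_le hp, mul_zero]
      exact Nat.zero_le _
    have hlab := h.labels_le l (by omega)
    have hL := h.large
    have hU := h.upper
    by_cases hp2 : (T.image l).card = 2
    · have hpos : (T.image l).Nonempty := Finset.card_pos.1 (by omega)
      obtain ⟨q, hq⟩ := hpos
      obtain ⟨x, hx, rfl⟩ := Finset.mem_image.1 hq
      obtain ⟨q', hq', hne⟩ := Finset.exists_mem_ne (show 1 < (T.image l).card by omega) (l x)
      obtain ⟨y, hy, rfl⟩ := Finset.mem_image.1 hq'
      have h1 := hlarge (T.filter (l · = l x)) (Finset.filter_subset _ _)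
        ⟨x, by simp [hx]⟩ (fun heq => by
          rw [← heq] at hy
          exact hne (Finset.mem_filter.1 hy).2)
      have h2 : (J.filter (fun j => v ∉ hs j ∧ Separates (T.filter (l · = l x)) (hs j))).card ≤
          (J.filter (fun j => v ∉ hs j ∧ ∃ a ∈ hs j, ∃ b ∈ hs j, l a ≠ l b)).card := by
        refine Finset.card_le_card (fun j hj => ?_)
        obtain ⟨hj, hv, ⟨a, ha, haq⟩, b, hb, hbq⟩ := Finset.mem_filter.1 hj
        refine Finset.mem_filter.2 ⟨hj, hv, a, ha, b, hb, fun heq => hbq ?_⟩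
        exact Finset.mem_filter.2 ⟨hnT j hj hv hb, heq ▸ (Finset.mem_filter.1 haq).2⟩
      rw [hp2]
      omega
    · obtain ⟨q, hq⟩ : ∃ q, (T.image l).card = q + 3 := ⟨(T.image l).card - 3, by omega⟩
      have e0 : q + 3 - 1 = q + 2 := rfl
      rw [hq, e0] at hlab ⊢
      have e1 : (q + 2) * L = (q + 1) * L + L := by ring
      have e2 : (q + 1) * (32 * k) ≤ (q + 1) * L := Nat.mul_le_mul_left _ hL
      have e3 : k * 2 * (q + 2) = 2 * (q * k) + 4 * k := by ring
      have e4 : (q + 1) * (32 * k) = 32 * (q * k) + 32 * k := by ring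
      rw [e3]
      omega)
  have hsep : ∀ i : Fin k, ∀ Z : Set V, (∃ a ∈ T, a ∈ Z) → (∃ a ∈ T, a ∉ Z) → ∀ b, ∃ j ∈ J,
      v ∉ hs j ∧ col j = (i, b) ∧ ∃ a ∈ hs j, ∃ b ∈ hs j, a ∈ Z ∧ b ∉ Z := by
    intro i Z h1 h2 b
    obtain ⟨j, hj, hc⟩ := hcol (i, b) Z h1 h2
    rw [Finset.mem_filter] at hj
    exact ⟨j, hj.1, hj.2, hc⟩
  refine ⟨fun j _ => if v ∈ hs j then π j else (col j).1, ⟨fun _ _ _ _ _ => rfl, ?_, ?_, ?_⟩⟩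
  · intro j hj hv
    obtain ⟨t, ht, htv, -⟩ := h.exists_mem_ne hj
    exact ⟨t, ht, htv, by simp [hv]⟩
  · intro _ t ht i
    obtain ⟨s, hs', hst⟩ := Finset.exists_mem_ne (show 1 < T.card by omega) t
    choose f hfJ hfv hfc a ha b hb haZ hbZ using fun x =>
      hsep i {t} ⟨t, ht, rfl⟩ ⟨s, hs', hst⟩ x
    refine two_le_card_of_bool (fun p : Unit × Bool => f p.2) () (fun heq => ?_) (fun x => ?_)
    · have := (hfc true).symm.trans ((congrArg col heq).trans (hfc false))
      simp at this
    · have : a x = t := haZ x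
      have h1 := ha x
      rw [this] at h1
      simp [hfJ, h1, hfv, hfc]
  · rintro i Z ⟨a, ha, -, haZ⟩ ⟨b, hb, -, hbZ⟩
    obtain ⟨j, hj, hv, hc, a, ha, b, hb, haZ, hbZ⟩ := hsep i Z ⟨a, ha, haZ⟩ ⟨b, hb, hbZ⟩ true
    exact ⟨j, hj, a, ha, b, hb, by rintro rfl; exact hv ha, by rintro rfl; exact hv hb, haZ, hbZ,
      by simp [hv, hc], by simp [hv, hc]⟩

end IsCubicInstance
end Hyper

section Hyper
open scoped Classical

variable {V ι : Type*}

namespace IsCubicInstance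

variable {J : Finset ι} {hs : ι → Finset V} {T S : Finset V} {v : V} {k L D : ℕ} {π : ι → Fin k}

theorem cut_eq (h : IsCubicInstance J hs T S v k L D π) {X Y : Finset V} (hX : X ⊆ T) :
    (J.filter (Separates X <| hs ·)).card =
      (J.filter (fun j => v ∉ hs j ∧ Separates X (hs j))).card +
      (J.filter (fun j => v ∈ hs j ∧ (∃ a ∈ hs j, a ∈ X) ∧ ¬ ∃ b ∈ hs j, b ∈ Y)).card +
      (J.filter (fun j => v ∈ hs j ∧ (∃ a ∈ hs j, a ∈ X) ∧ ∃ b ∈ hs j, b ∈ Y)).card := by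
  simp only [Finset.card_filter, ← Finset.sum_add_distrib]
  refine Finset.sum_congr rfl (fun j _ => ?_)
  have hvX : v ∉ X := fun hv => h.notMem (hX hv)
  by_cases hv : v ∈ hs j
  · have : Separates X (hs j) ↔ ∃ a ∈ hs j, a ∈ X := ⟨fun h => h.1, fun h => ⟨h, v, hv, hvX⟩⟩
    by_cases h1 : ∃ a ∈ hs j, a ∈ X <;> by_cases h2 : ∃ b ∈ hs j, b ∈ Y <;>
      simp only [this, hv, h1, h2, not_true_eq_false, not_false_eq_true, and_true,
        and_false, if_true, if_false]
  · simp [hv]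

theorem separates_compl (h : IsCubicInstance J hs T S v k L D π) {X Y : Finset V}
    (hd : Disjoint X Y) (hT : X ∪ Y = T) :
    J.filter (fun j => v ∉ hs j ∧ Separates X (hs j)) =
      J.filter (fun j => v ∉ hs j ∧ Separates Y (hs j)) := by
  refine Finset.filter_congr (fun j hj => and_congr_right (fun hv => ?_))
  have hT' : ∀ t ∈ hs j, (t ∈ X ↔ t ∉ Y) := by
    intro t ht
    have := h.mem_of_notMem hj ht (by rintro rfl; exact hv ht)
    rw [← hT, Finset.mem_union] at this
    exact ⟨fun h => Finset.disjoint_left.1 hd h, fun h => this.resolve_right h⟩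
  constructor
  · rintro ⟨⟨a, ha, haX⟩, b, hb, hbX⟩
    refine ⟨⟨b, hb, ?_⟩, a, ha, (hT' a ha).1 haX⟩
    by_contra hbY
    exact hbX ((hT' b hb).2 hbY)
  · rintro ⟨⟨a, ha, haX⟩, b, hb, hbX⟩
    exact ⟨⟨b, hb, (hT' b hb).2 hbX⟩, a, ha, fun haX' => (hT' a ha).1 haX' haX⟩

theorem degree_eq (h : IsCubicInstance J hs T S v k L D π) {X Y : Finset V} (hT : X ∪ Y = T) :
    D = (J.filter (fun j => v ∈ hs j ∧ (∃ a ∈ hs j, a ∈ X) ∧ ¬ ∃ b ∈ hs j, b ∈ Y)).card +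
      (J.filter (fun j => v ∈ hs j ∧ (∃ a ∈ hs j, a ∈ Y) ∧ ¬ ∃ b ∈ hs j, b ∈ X)).card +
      (J.filter (fun j => v ∈ hs j ∧ (∃ a ∈ hs j, a ∈ X) ∧ ∃ b ∈ hs j, b ∈ Y)).card := by
  rw [← h.degree]
  simp only [Finset.card_filter, ← Finset.sum_add_distrib]
  refine Finset.sum_congr rfl (fun j hj => ?_)
  by_cases hv : v ∈ hs j
  · have : (∃ a ∈ hs j, a ∈ X) ∨ ∃ a ∈ hs j, a ∈ Y := by
      obtain ⟨t, ht, -, htT⟩ := h.exists_mem_ne hj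
      rw [← hT, Finset.mem_union] at htT
      exact htT.imp (fun h => ⟨t, ht, h⟩) (fun h => ⟨t, ht, h⟩)
    by_cases h1 : ∃ a ∈ hs j, a ∈ X <;> by_cases h2 : ∃ b ∈ hs j, b ∈ Y
    all_goals simp only [hv, h1, h2, not_true_eq_false, not_false_eq_true, and_true,
        and_false, if_true, if_false]
    exact absurd (this.resolve_left h1) h2
  · simp [hv]

/-- The colours which need a connection between `X` and `Y` and have no hyperedge at `v` that
could provide it. -/
noncomputable def needy (J : Finset ι) (hs : ι → Finset V) (S : Finset V) (v : V) {k : ℕ}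
    (π : ι → Fin k) (X Y : Finset V) : Finset (Fin k) :=
  Finset.univ.filter (fun i =>
    (¬ ∃ j ∈ J, v ∈ hs j ∧ (∃ a ∈ hs j, a ∈ X) ∧ (∃ b ∈ hs j, b ∈ Y) ∧ π j = i) ∧
    ((S ∩ X).Nonempty ∨ ∃ j ∈ J, v ∈ hs j ∧ (∃ a ∈ hs j, a ∈ X) ∧ π j = i) ∧
    ((S ∩ Y).Nonempty ∨ ∃ j ∈ J, v ∈ hs j ∧ (∃ a ∈ hs j, a ∈ Y) ∧ π j = i))

theorem needy_comm (X Y : Finset V) : needy J hs S v π X Y = needy J hs S v π Y X := by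
  refine Finset.filter_congr (fun i _ => ?_)
  constructor
  · rintro ⟨h1, h2, h3⟩
    exact ⟨fun ⟨j, hj, hv, hx, hy, hc⟩ => h1 ⟨j, hj, hv, hy, hx, hc⟩, h3, h2⟩
  · rintro ⟨h1, h2, h3⟩
    exact ⟨fun ⟨j, hj, hv, hx, hy, hc⟩ => h1 ⟨j, hj, hv, hy, hx, hc⟩, h3, h2⟩

theorem card_needy_le_of_empty (h : IsCubicInstance J hs T S v k L D π) {X Y : Finset V}
    (hd : Disjoint X Y) (hT : X ∪ Y = T) (hX : X.Nonempty) (hY : Y.Nonempty) (hS : S ∩ Y = ∅) :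
    (needy J hs S v π X Y).card ≤
      (J.filter (fun j => v ∉ hs j ∧ Separates X (hs j))).card := by
  have hXT : X ⊆ T := hT ▸ Finset.subset_union_left
  have h1 : D ≤ (J.filter (Separates X <| hs ·)).card := by
    refine h.max_le_cut hXT hX ?_ ?_
    · rintro rfl
      obtain ⟨y, hy⟩ := hY
      exact Finset.disjoint_left.1 hd (hT ▸ Finset.mem_union_right _ hy) hy
    · rcases S.eq_empty_or_nonempty with h0 | ⟨s, hs'⟩
      · exact Or.inl h0
      · refine Or.inr ⟨s, Finset.mem_inter.2 ⟨?_, hs'⟩⟩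
        have := h.subset hs'
        rw [← hT, Finset.mem_union] at this
        refine this.resolve_right (fun hsY => ?_)
        have : s ∈ S ∩ Y := Finset.mem_inter.2 ⟨hs', hsY⟩
        simp [hS] at this
  have h2 := h.cut_eq (Y := Y) hXT
  have h3 := h.degree_eq hT
  have h4 : needy J hs S v π X Y ⊆
      (J.filter (fun j => v ∈ hs j ∧ (∃ a ∈ hs j, a ∈ Y) ∧ ¬ ∃ b ∈ hs j, b ∈ X)).image π := by
    intro i hi
    obtain ⟨-, hno, -, hi⟩ := Finset.mem_filter.1 hi
    rw [hS] at hi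
    obtain ⟨j, hj, hv, hjY, rfl⟩ := hi.resolve_left (by simp)
    exact Finset.mem_image_of_mem _ (Finset.mem_filter.2 ⟨hj, hv, hjY,
      fun hjX => hno ⟨j, hj, hv, hjX, hjY, rfl⟩⟩)
  have h5 := (Finset.card_le_card h4).trans Finset.card_image_le
  omega

theorem card_needy_le (h : IsCubicInstance J hs T S v k L D π) {X Y : Finset V}
    (hd : Disjoint X Y) (hT : X ∪ Y = T) (hX : X.Nonempty) (hY : Y.Nonempty) :
    (needy J hs S v π X Y).card ≤
      (J.filter (fun j => v ∉ hs j ∧ Separates X (hs j))).card := by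
  have hd' := hd.symm
  have hT' : Y ∪ X = T := by rwa [Finset.union_comm]
  rcases (S ∩ Y).eq_empty_or_nonempty with hSY | hSY
  · exact h.card_needy_le_of_empty hd hT hX hY hSY
  rcases (S ∩ X).eq_empty_or_nonempty with hSX | hSX
  · rw [needy_comm, h.separates_compl hd hT]
    exact h.card_needy_le_of_empty hd' hT' hY hX hSX
  have hXT : X ⊆ T := hT ▸ Finset.subset_union_left
  have hYT : Y ⊆ T := hT ▸ Finset.subset_union_right
  have h1 := h.cutS X hXT (by rwa [Finset.inter_comm])
  have h2 := h.cutS Y hYT (by rwa [Finset.inter_comm])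
  rw [h.cut_eq (Y := Y) hXT] at h1
  rw [h.cut_eq (Y := X) hYT, ← h.separates_compl hd hT] at h2
  have h3 := h.degree_eq hT
  have h3' := h.degree_eq hT'
  have h4 : 2 * (needy J hs S v π X Y).card ≤
      ((J.filter (fun j => v ∈ hs j ∧ (∃ a ∈ hs j, a ∈ X) ∧ ¬ ∃ b ∈ hs j, b ∈ Y)) ∪
      (J.filter (fun j => v ∈ hs j ∧ (∃ a ∈ hs j, a ∈ Y) ∧ ¬ ∃ b ∈ hs j, b ∈ X))).card := by
    have hsub : J.filter (fun j => v ∈ hs j ∧ π j ∈ needy J hs S v π X Y) ⊆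
        ((J.filter (fun j => v ∈ hs j ∧ (∃ a ∈ hs j, a ∈ X) ∧ ¬ ∃ b ∈ hs j, b ∈ Y)) ∪
        (J.filter (fun j => v ∈ hs j ∧ (∃ a ∈ hs j, a ∈ Y) ∧ ¬ ∃ b ∈ hs j, b ∈ X))) := by
      intro j hj
      obtain ⟨hj, hv, hq⟩ := Finset.mem_filter.1 hj
      have hno := (Finset.mem_filter.1 hq).2.1
      obtain ⟨t, ht, -, htT⟩ := h.exists_mem_ne hj
      rw [← hT, Finset.mem_union] at htT
      rw [Finset.mem_union, Finset.mem_filter, Finset.mem_filter]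
      rcases htT with htX | htY
      · exact Or.inl ⟨hj, hv, ⟨t, ht, htX⟩, fun hY => hno ⟨j, hj, hv, ⟨t, ht, htX⟩, hY, rfl⟩⟩
      · exact Or.inr ⟨hj, hv, ⟨t, ht, htY⟩, fun hX => hno ⟨j, hj, hv, hX, ⟨t, ht, htY⟩, rfl⟩⟩
    refine le_trans ?_ (Finset.card_le_card hsub)
    refine Finset.mul_card_image_le_card_of_maps_to (f := π)
      (fun j hj => (Finset.mem_filter.1 hj).2.2) 2 (fun i hi => ?_)
    refine (h.two (hSX.mono Finset.inter_subset_left) i).trans (Finset.card_le_card ?_)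
    intro j hj
    obtain ⟨hjJ, hv, hji⟩ := Finset.mem_filter.1 hj
    exact Finset.mem_filter.2 ⟨Finset.mem_filter.2 ⟨hjJ, hv, hji ▸ hi⟩, hji⟩
  have h5 := h4.trans (Finset.card_union_le _ _)
  omega

end IsCubicInstance
end Hyper

section Hyper
open scoped Classical

variable {V ι : Type*}

namespace IsCubicInstance

variable {J : Finset ι} {hs : ι → Finset V} {T S : Finset V} {v : V} {k L D : ℕ} {π : ι → Fin k}

/-- Hyperedges at `v` meeting both `X` and `Y` are numerous when few others separate `X`. -/
theorem le_card_crossing (h : IsCubicInstance J hs T S v k L D π) {X Y : Finset V}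
    (hd : Disjoint X Y) (hT : X ∪ Y = T) (hX : X.Nonempty) (hY : Y.Nonempty)
    (hsmall : 3 * (J.filter (fun j => v ∉ hs j ∧ Separates X (hs j))).card < 14 * k) :
    5 * k ≤ (J.filter (fun j => v ∈ hs j ∧ (∃ a ∈ hs j, a ∈ X) ∧ ∃ b ∈ hs j, b ∈ Y)).card := by
  have hXT : X ⊆ T := hT ▸ Finset.subset_union_left
  have hYT : Y ⊆ T := hT ▸ Finset.subset_union_right
  have hX' : X ≠ T := by
    rintro rfl
    obtain ⟨y, hy⟩ := hY
    exact Finset.disjoint_left.1 hd (hT ▸ Finset.mem_union_right _ hy) hy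
  have hY' : Y ≠ T := by
    rintro rfl
    obtain ⟨y, hy⟩ := hX
    exact Finset.disjoint_left.1 hd hy (hT ▸ Finset.mem_union_left _ hy)
  have h1 := h.cut X hXT hX hX'
  have h2 := h.cut Y hYT hY hY'
  have h0 : D ≤ (J.filter (Separates X <| hs ·)).card ∨
      D ≤ (J.filter (Separates Y <| hs ·)).card := by
    rcases S.eq_empty_or_nonempty with hS | ⟨s, hs'⟩
    · exact Or.inl ((h.empty hS).trans h1)
    · have := h.subset hs'
      rw [← hT, Finset.mem_union] at this
      exact this.imp (fun hs => h.cutS X hXT ⟨s, Finset.mem_inter.2 ⟨hs, hs'⟩⟩)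
        (fun hs => h.cutS Y hYT ⟨s, Finset.mem_inter.2 ⟨hs, hs'⟩⟩)
  have h3 := h.degree_eq hT
  have h3' := h.degree_eq (X := Y) (Y := X) (by rwa [Finset.union_comm])
  have hL := h.large
  rw [h.cut_eq (Y := Y) hXT] at h0 h1
  rw [h.cut_eq (Y := X) hYT, ← h.separates_compl hd hT] at h0 h2
  omega

theorem exists_coloring_of_small [Fintype V] (h : IsCubicInstance J hs T S v k L D π)
    {X Y : Finset V} (hd : Disjoint X Y) (hT : X ∪ Y = T) (hX : X.Nonempty) (hY : Y.Nonempty)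
    (hsmall : 3 * (J.filter (fun j => v ∉ hs j ∧ Separates X (hs j))).card < 14 * k) :
    ∃ c, IsCubicColoring J hs T S v π c := by
  have hXT : X ⊆ T := hT ▸ Finset.subset_union_left
  have hYT : Y ⊆ T := hT ▸ Finset.subset_union_right
  have hvX : v ∉ X := fun hv => h.notMem (hXT hv)
  have hvY : v ∉ Y := fun hv => h.notMem (hYT hv)
  have hXY : ∀ {t}, t ∈ X → t ∉ Y := fun h => Finset.disjoint_left.1 hd h
  have hXY' : ∀ {t}, t ∈ T → t ∈ X ∨ t ∈ Y := fun ht => by rwa [← hT, Finset.mem_union] at ht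
  obtain ⟨colX, hcolX⟩ := h.exists_side_packing hXT hX (by
    rintro rfl
    obtain ⟨y, hy⟩ := hY
    exact hXY (hT ▸ Finset.mem_union_right _ hy) hy) hsmall
  obtain ⟨colY, hcolY⟩ := h.exists_side_packing hYT hY (by
    rintro rfl
    obtain ⟨y, hy⟩ := hX
    exact hXY hy (hT ▸ Finset.mem_union_left _ hy)) (by rwa [← h.separates_compl hd hT])
  have hneedy := h.card_needy_le hd hT hX hY
  set DX := J.filter (fun j => v ∉ hs j ∧ Separates X (hs j)) with hDX
  set CR := J.filter (fun j => v ∈ hs j ∧ (∃ a ∈ hs j, a ∈ X) ∧ ∃ b ∈ hs j, b ∈ Y) with hCR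
  have hcr : 5 * k ≤ CR.card := h.le_card_crossing hd hT hX hY hsmall
  obtain ⟨eQ⟩ : Nonempty (needy J hs S v π X Y ↪ DX) :=
    Function.Embedding.nonempty_of_card_le (by simpa using hneedy)
  have hkeep : ∀ i, ∃ j, i ∈ CR.image π → j ∈ CR ∧ π j = i := by
    intro i
    by_cases hi : i ∈ CR.image π
    · obtain ⟨j, hj⟩ := Finset.mem_image.1 hi
      exact ⟨j, fun _ => hj⟩
    · obtain ⟨j, -⟩ : CR.Nonempty := Finset.card_pos.1 (by have := h.pos; omega)
      exact ⟨j, fun h => absurd h hi⟩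
  choose keep hkeep using hkeep
  set KS : Finset ι := Finset.univ.image keep with hKS
  have hKScard : KS.card ≤ k := Finset.card_image_le.trans (by simp)
  obtain ⟨φ⟩ : Nonempty ((Fin k × Bool) × Bool ↪ ↥(CR \ KS)) := by
    refine Function.Embedding.nonempty_of_card_le ?_
    have := Finset.le_card_sdiff KS CR
    simp only [Fintype.card_prod, Fintype.card_fin, Fintype.card_bool, Fintype.card_coe]
    omega
  let f : Bool → Fin k × Bool → ι := fun b p => φ (p, b)
  have hfinj : ∀ b, Function.Injective (f b) := by
    intro b p q hpq
    have := φ.injective (Subtype.ext hpq)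
    simpa using this
  have hfCR : ∀ b p, f b p ∈ CR ∧ f b p ∉ KS := fun b p => Finset.mem_sdiff.1 (φ (p, b)).2
  have hfne : ∀ p q, f true p ≠ f false q := by
    intro p q hpq
    have := φ.injective (Subtype.ext hpq)
    simp at this
  let eq' : needy J hs S v π X Y → ι := fun q => eQ q
  have heq' : Function.Injective eq' := Subtype.val_injective.comp eQ.injective
  let g0 : ι → Fin k := fun j => if hs j ⊆ X then (colX j).1 else if hs j ⊆ Y then (colY j).1 else
    Function.extend eq' Subtype.val π j
  let c : ι → V → Fin k := fun j t => if v ∉ hs j then g0 j else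
    if t ∈ X then Function.extend (f true) Prod.fst π j else
    if t ∈ Y then Function.extend (f false) Prod.fst π j else π j
  have hcX : ∀ j ∈ J, v ∈ hs j → ∀ t ∈ X, j ∉ Set.range (f true) → c j t = π j := by
    intro j _ hv t ht hn
    simp only [c, hv, not_true_eq_false, if_false, ht, if_true]
    exact Function.extend_apply' _ _ _ hn
  have hcY : ∀ j ∈ J, v ∈ hs j → ∀ t ∈ Y, j ∉ Set.range (f false) → c j t = π j := by
    intro j _ hv t ht hn
    have : t ∉ X := fun h => hXY h ht
    simp only [c, hv, not_true_eq_false, if_false, ht, this, if_true]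
    exact Function.extend_apply' _ _ _ hn
  have hcn : ∀ j ∈ J, v ∈ hs j → j ∉ CR → ∀ t ∈ hs j, t ≠ v → c j t = π j := by
    intro j hj hv hjc t ht htv
    have hn : ∀ b, j ∉ Set.range (f b) := by
      rintro b ⟨p, rfl⟩
      exact hjc (hfCR b p).1
    rcases hXY' (h.mem_of_notMem hj ht htv) with htX | htY
    · exact hcX j hj hv t htX (hn _)
    · exact hcY j hj hv t htY (hn _)
  have hconX : ∀ i b, ∀ Z : Set V, (∃ a ∈ X, a ∈ Z) → (∃ a ∈ X, a ∉ Z) → ∃ j ∈ J, v ∉ hs j ∧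
      colX j = (i, b) ∧ (∀ t, c j t = i) ∧ ∃ a ∈ hs j, ∃ b ∈ hs j, a ∈ Z ∧ b ∉ Z := by
    intro i b Z h1 h2
    obtain ⟨j, hj, hc, hab⟩ := hcolX (i, b) Z h1 h2
    obtain ⟨hj, hv, hjX⟩ := Finset.mem_filter.1 hj
    exact ⟨j, hj, hv, hc, fun t => by simp [c, hv, g0, hjX, hc], hab⟩
  have hconY : ∀ i b, ∀ Z : Set V, (∃ a ∈ Y, a ∈ Z) → (∃ a ∈ Y, a ∉ Z) → ∃ j ∈ J, v ∉ hs j ∧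
      colY j = (i, b) ∧ (∀ t, c j t = i) ∧ ∃ a ∈ hs j, ∃ b ∈ hs j, a ∈ Z ∧ b ∉ Z := by
    intro i b Z h1 h2
    obtain ⟨j, hj, hc, a, ha, b, hb, hab⟩ := hcolY (i, b) Z h1 h2
    obtain ⟨hj, hv, hjY⟩ := Finset.mem_filter.1 hj
    have hjX : ¬ hs j ⊆ X := fun hjX => hXY (hjX ha) (hjY ha)
    exact ⟨j, hj, hv, hc, fun t => by simp [c, hv, g0, hjX, hjY, hc], a, ha, b, hb, hab⟩
  have hcross : ∀ i, (∃ t ∈ X, CubicTarget J hs S v π c i t) →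
      (∃ t ∈ Y, CubicTarget J hs S v π c i t) →
      ∃ j ∈ J, ∃ a ∈ hs j, ∃ b ∈ hs j, a ∈ X ∧ b ∈ Y ∧ c j a = i ∧ c j b = i := by
    rintro i ⟨s, hsX, hs'⟩ ⟨t, htY, ht⟩
    by_cases hi : i ∈ CR.image π
    · obtain ⟨hk, hki⟩ := hkeep i hi
      have hn : ∀ b, keep i ∉ Set.range (f b) := by
        rintro b ⟨p, hp⟩
        exact (hfCR b p).2 (hp ▸ Finset.mem_image_of_mem _ (Finset.mem_univ i))
      obtain ⟨hkJ, hv, ⟨a, ha, haX⟩, b, hb, hbY⟩ := Finset.mem_filter.1 hk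
      exact ⟨keep i, hkJ, a, ha, b, hb, haX, hbY, (hcX _ hkJ hv a haX (hn _)).trans hki,
        (hcY _ hkJ hv b hbY (hn _)).trans hki⟩
    · have hno : ¬ ∃ j ∈ J, v ∈ hs j ∧ (∃ a ∈ hs j, a ∈ X) ∧ (∃ b ∈ hs j, b ∈ Y) ∧ π j = i := by
        rintro ⟨j, hj, hv, hX, hY, hji⟩
        exact hi (Finset.mem_image.2 ⟨j, Finset.mem_filter.2 ⟨hj, hv, hX, hY⟩, hji⟩)
      have hq : i ∈ needy J hs S v π X Y := by
        refine Finset.mem_filter.2 ⟨Finset.mem_univ _, hno, ?_, ?_⟩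
        · refine hs'.imp (fun h => ⟨s, Finset.mem_inter.2 ⟨h, hsX⟩⟩) ?_
          rintro ⟨j, hj, hv, hji, hsj, -⟩
          exact ⟨j, hj, hv, ⟨s, hsj, hsX⟩, hji⟩
        · refine ht.imp (fun h => ⟨t, Finset.mem_inter.2 ⟨h, htY⟩⟩) ?_
          rintro ⟨j, hj, hv, hji, hsj, -⟩
          exact ⟨j, hj, hv, ⟨t, hsj, htY⟩, hji⟩
      obtain ⟨hj, hv, ⟨a, ha, haX⟩, b, hb, hbX⟩ := Finset.mem_filter.1 (eQ ⟨i, hq⟩).2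
      set j : ι := (eQ ⟨i, hq⟩).1 with hjdef
      have hbY : b ∈ Y := (hXY' (h.mem_of_notMem hj hb (by rintro rfl; exact hv hb))).resolve_left hbX
      have hcj : ∀ t, c j t = i := by
        intro t
        have h1 : ¬ hs j ⊆ X := fun h => hbX (h hb)
        have h2 : ¬ hs j ⊆ Y := fun h => hXY haX (h ha)
        simp only [c, hv, not_false_eq_true, if_true, g0, h1, h2, if_false]
        exact heq'.extend_apply Subtype.val π ⟨i, hq⟩
      exact ⟨j, hj, a, ha, b, hb, haX, hbY, hcj a, hcj b⟩
  refine ⟨c, ?_, ?_, ?_, ?_⟩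
  · intro j hj hv s t
    simp [c, hv]
  · intro j hj hv
    by_cases hjc : j ∈ CR
    · obtain ⟨-, -, ⟨a, ha, haX⟩, b, hb, hbY⟩ := Finset.mem_filter.1 hjc
      by_cases hn : j ∈ Set.range (f true)
      · refine ⟨b, hb, by rintro rfl; exact hvY hbY, hcY j hj hv b hbY ?_⟩
        rintro ⟨q, rfl⟩
        obtain ⟨p, hp⟩ := hn
        exact hfne p q hp
      · exact ⟨a, ha, by rintro rfl; exact hvX haX, hcX j hj hv a haX hn⟩
    · obtain ⟨t, ht, htv, -⟩ := h.exists_mem_ne hj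
      exact ⟨t, ht, htv, hcn j hj hv hjc t ht htv⟩
  · intro _ t ht i
    rcases hXY' ht with htX | htY
    · by_cases hs' : ∃ s ∈ X, s ≠ t
      · choose j hj hv hc hci a ha b hb haZ hbZ using fun x =>
          hconX i x {t} ⟨t, htX, rfl⟩ hs'
        refine two_le_card_of_bool (fun p : Unit × Bool => j p.2) () (fun heq => ?_) (fun x => ?_)
        · have := (hc true).symm.trans ((congrArg colX heq).trans (hc false))
          simp at this
        · have : a x = t := haZ x
          have h1 := ha x
          rw [this] at h1
          simp [hj, h1, hci]
      · push Not at hs'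
        refine two_le_card_of_bool (f true) i (fun heq => ?_) (fun x => ?_)
        · simpa using hfinj _ heq
        · obtain ⟨hj, hv, ⟨a, ha, haX⟩, -⟩ := Finset.mem_filter.1 (hfCR true (i, x)).1
          rw [hs' a haX] at ha
          refine Finset.mem_filter.2 ⟨hj, ha, ?_⟩
          simp only [c, hv, not_true_eq_false, if_false, htX, if_true]
          exact (hfinj true).extend_apply _ _ _
    · by_cases hs' : ∃ s ∈ Y, s ≠ t
      · choose j hj hv hc hci a ha b hb haZ hbZ using fun x =>
          hconY i x {t} ⟨t, htY, rfl⟩ hs'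
        refine two_le_card_of_bool (fun p : Unit × Bool => j p.2) () (fun heq => ?_) (fun x => ?_)
        · have := (hc true).symm.trans ((congrArg colY heq).trans (hc false))
          simp at this
        · have : a x = t := haZ x
          have h1 := ha x
          rw [this] at h1
          simp [hj, h1, hci]
      · push Not at hs'
        have htX : t ∉ X := fun h => hXY h htY
        refine two_le_card_of_bool (f false) i (fun heq => ?_) (fun x => ?_)
        · simpa using hfinj _ heq
        · obtain ⟨hj, hv, -, a, ha, haY⟩ := Finset.mem_filter.1 (hfCR false (i, x)).1
          rw [hs' a haY] at ha
          refine Finset.mem_filter.2 ⟨hj, ha, ?_⟩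
          simp only [c, hv, not_true_eq_false, if_false, htX, htY, if_true]
          exact (hfinj false).extend_apply _ _ _
  · rintro i Z ⟨s, hsT, hs', hsZ⟩ ⟨t, htT, ht', htZ⟩
    by_cases hX2 : (∃ a ∈ X, a ∈ Z) ∧ ∃ a ∈ X, a ∉ Z
    · obtain ⟨j, hj, hv, -, hc, a, ha, b, hb, haZ, hbZ⟩ := hconX i true Z hX2.1 hX2.2
      exact ⟨j, hj, a, ha, b, hb, by rintro rfl; exact hv ha, by rintro rfl; exact hv hb,
        haZ, hbZ, hc a, hc b⟩
    by_cases hY2 : (∃ a ∈ Y, a ∈ Z) ∧ ∃ a ∈ Y, a ∉ Z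
    · obtain ⟨j, hj, hv, -, hc, a, ha, b, hb, haZ, hbZ⟩ := hconY i true Z hY2.1 hY2.2
      exact ⟨j, hj, a, ha, b, hb, by rintro rfl; exact hv ha, by rintro rfl; exact hv hb,
        haZ, hbZ, hc a, hc b⟩
    have hX3 : ∀ {a b}, a ∈ X → b ∈ X → a ∈ Z → b ∈ Z := by
      intro a b ha hb haZ
      by_contra hbZ
      exact hX2 ⟨⟨a, ha, haZ⟩, b, hb, hbZ⟩
    have hY3 : ∀ {a b}, a ∈ Y → b ∈ Y → a ∈ Z → b ∈ Z := by
      intro a b ha hb haZ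
      by_contra hbZ
      exact hY2 ⟨⟨a, ha, haZ⟩, b, hb, hbZ⟩
    rcases hXY' hsT with hsX | hsY
    · have htY : t ∈ Y := (hXY' htT).resolve_left (fun h => htZ (hX3 hsX h hsZ))
      obtain ⟨j, hj, a, ha, b, hb, haX, hbY, hca, hcb⟩ := hcross i ⟨s, hsX, hs'⟩ ⟨t, htY, ht'⟩
      exact ⟨j, hj, a, ha, b, hb, by rintro rfl; exact hvX haX, by rintro rfl; exact hvY hbY,
        hX3 hsX haX hsZ, fun hbZ => htZ (hY3 hbY htY hbZ), hca, hcb⟩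
    · have htX : t ∈ X := (hXY' htT).resolve_right (fun h => htZ (hY3 hsY h hsZ))
      obtain ⟨j, hj, a, ha, b, hb, haX, hbY, hca, hcb⟩ := hcross i ⟨t, htX, ht'⟩ ⟨s, hsY, hs'⟩
      exact ⟨j, hj, b, hb, a, ha, by rintro rfl; exact hvY hbY, by rintro rfl; exact hvX haX,
        hY3 hsY hbY hsZ, fun haZ => htZ (hX3 haX htX haZ), hcb, hca⟩

theorem exists_coloring [Fintype V] (h : IsCubicInstance J hs T S v k L D π) :
    ∃ c, IsCubicColoring J hs T S v π c := by
  by_cases hT : T.card ≤ 1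
  · exact h.exists_coloring_singleton (le_antisymm hT (Finset.card_pos.2 h.nonempty))
  by_cases hsm : ∃ X ⊆ T, X.Nonempty ∧ X ≠ T ∧
      3 * (J.filter (fun j => v ∉ hs j ∧ Separates X (hs j))).card < 14 * k
  · obtain ⟨X, hXT, hX, hne, hsm⟩ := hsm
    refine h.exists_coloring_of_small (X := X) (Y := T \ X) Finset.disjoint_sdiff
      (Finset.union_sdiff_of_subset hXT) hX ?_ hsm
    exact Finset.sdiff_nonempty.2 (fun h => hne (hXT.antisymm h))
  · push Not at hsm
    exact h.exists_coloring_of_large (by omega) hsm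

end IsCubicInstance
end Hyper

section Cuts
open scoped Classical

variable {V E : Type*}

/-- The edge `e` has exactly one end in `Z`. -/
def Crosses (g : E → V × V) (Z : Set V) (e : E) : Prop := ¬ ((g e).1 ∈ Z ↔ (g e).2 ∈ Z)

/-- The vertex `x` is an end of `e`. -/
def Inc (g : E → V × V) (e : E) (x : V) : Prop := (g e).1 = x ∨ (g e).2 = x

/-- The edge `e` has one end in `X` and the other one in `Y`. -/
def Joins (g : E → V × V) (X Y : Set V) (e : E) : Prop :=
  ((g e).1 ∈ X ∧ (g e).2 ∈ Y) ∨ ((g e).1 ∈ Y ∧ (g e).2 ∈ X)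

/-- The number of edges leaving `Z`. -/
noncomputable def cut (g : E → V × V) (F : Finset E) (Z : Set V) : ℕ := (F.filter (Crosses g Z)).card

/-- The number of edges between two sets. -/
noncomputable def between (g : E → V × V) (F : Finset E) (X Y : Set V) : ℕ :=
  (F.filter (Joins g X Y)).card

/-- The set `Z` contains some but not all of `A`. -/
def Splits (A Z : Set V) : Prop := (∃ a ∈ A, a ∈ Z) ∧ ∃ a ∈ A, a ∉ Z

/-- The required size of a cut. -/
noncomputable def req (A B : Set V) (α β : ℕ) (Z : Set V) : ℕ :=
  if Splits A Z then α else if Splits B Z then β else 0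

variable {g : E → V × V} {F : Finset E} {A B : Set V} {α β : ℕ}

theorem crosses_iff {Z : Set V} {e : E} : Crosses g Z e ↔
    ((g e).1 ∈ Z ∧ (g e).2 ∉ Z) ∨ ((g e).1 ∉ Z ∧ (g e).2 ∈ Z) := by
  unfold Crosses; tauto

theorem Inc.exists_other {e : E} {x : V} (h : Inc g e x) : ∃ y, Inc g e y ∧ ∀ z, Inc g e z → z = x ∨ z = y := by
  rcases h with h | h
  · exact ⟨(g e).2, Or.inr rfl, fun z hz => hz.imp (fun h' => h'.symm.trans h) Eq.symm⟩
  · exact ⟨(g e).1, Or.inl rfl, fun z hz => hz.symm.imp (fun h' => h'.symm.trans h) Eq.symm⟩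

theorem crosses_iff_exists {Z : Set V} {e : E} : Crosses g Z e ↔
    ∃ a b, a ∈ Z ∧ b ∉ Z ∧ Inc g e a ∧ Inc g e b := by
  rw [crosses_iff]
  constructor
  · rintro (⟨h1, h2⟩ | ⟨h1, h2⟩)
    · exact ⟨_, _, h1, h2, Or.inl rfl, Or.inr rfl⟩
    · exact ⟨_, _, h2, h1, Or.inr rfl, Or.inl rfl⟩
  · rintro ⟨a, b, ha, hb, rfl | rfl, rfl | rfl⟩
    · exact absurd ha hb
    · exact Or.inl ⟨ha, hb⟩
    · exact Or.inr ⟨hb, ha⟩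
    · exact absurd ha hb

theorem crosses_compl {Z : Set V} {e : E} : Crosses g Zᶜ e ↔ Crosses g Z e := by
  simp only [Crosses, Set.mem_compl_iff]; tauto

theorem cut_compl (Z : Set V) : cut g F Zᶜ = cut g F Z := by
  simp only [cut, crosses_compl]

theorem splits_compl {Z : Set V} : Splits A Zᶜ ↔ Splits A Z := by
  simp only [Splits, Set.mem_compl_iff, not_not]; tauto

theorem req_compl (Z : Set V) : req A B α β Zᶜ = req A B α β Z := by
  simp only [req, splits_compl]

theorem cut_congr {Z Z' : Set V} (h : ∀ e ∈ F, ((g e).1 ∈ Z ↔ (g e).1 ∈ Z') ∧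
    ((g e).2 ∈ Z ↔ (g e).2 ∈ Z')) : cut g F Z = cut g F Z' := by
  unfold cut
  congr 1
  refine Finset.filter_congr (fun e he => ?_)
  rw [Crosses, Crosses, (h e he).1, (h e he).2]

theorem splits_congr {Z Z' : Set V} (h : ∀ a ∈ A, (a ∈ Z ↔ a ∈ Z')) :
    Splits A Z ↔ Splits A Z' := by
  unfold Splits
  refine and_congr (exists_congr fun a => and_congr_right (h a))
    (exists_congr fun a => and_congr_right fun ha => not_congr (h a ha))

theorem req_congr (hAB : A ⊆ B) {Z Z' : Set V} (h : ∀ a ∈ B, (a ∈ Z ↔ a ∈ Z')) :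
    req A B α β Z = req A B α β Z' := by
  simp only [req, splits_congr h, splits_congr fun a ha => h a (hAB ha)]

theorem req_pos {Z : Set V} (hAB : A ⊆ B) (h : 0 < req A B α β Z) : Splits B Z := by
  unfold req at h
  split_ifs at h with h1 h2
  · exact ⟨h1.1.imp fun a ha => ⟨hAB ha.1, ha.2⟩, h1.2.imp fun a ha => ⟨hAB ha.1, ha.2⟩⟩
  · exact h2
  · exact absurd h (lt_irrefl 0)

theorem le_req_of_splits {Z : Set V} (h : β ≤ α) (hZ : Splits B Z) : β ≤ req A B α β Z := by
  unfold req
  split_ifs <;> simp [h]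

theorem req_of_splits {Z : Set V} (hZ : Splits A Z) : req A B α β Z = α := if_pos hZ

theorem req_le {Z : Set V} (h : β ≤ α) : req A B α β Z ≤ α := by
  unfold req
  split_ifs <;> simp [h]

theorem cut_inter_add_cut_union (X Y : Set V) :
    cut g F X + cut g F Y = cut g F (X ∩ Y) + cut g F (X ∪ Y) + 2 * between g F (X \ Y) (Y \ X) := by
  simp only [cut, between, Finset.card_filter, Finset.mul_sum, ← Finset.sum_add_distrib]
  refine Finset.sum_congr rfl (fun e _ => ?_)
  simp only [Crosses, Joins, Set.mem_inter_iff, Set.mem_union, Set.mem_sdiff]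
  by_cases h1 : (g e).1 ∈ X <;> by_cases h2 : (g e).1 ∈ Y <;> by_cases h3 : (g e).2 ∈ X <;>
    by_cases h4 : (g e).2 ∈ Y <;> simp [h1, h2, h3, h4]

theorem cut_sdiff_add_cut_sdiff (X Y : Set V) :
    cut g F X + cut g F Y = cut g F (X \ Y) + cut g F (Y \ X) +
      2 * between g F (X ∩ Y) (X ∪ Y)ᶜ := by
  simp only [cut, between, Finset.card_filter, Finset.mul_sum, ← Finset.sum_add_distrib]
  refine Finset.sum_congr rfl (fun e _ => ?_)
  simp only [Crosses, Joins, Set.mem_inter_iff, Set.mem_union, Set.mem_sdiff, Set.mem_compl_iff]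
  by_cases h1 : (g e).1 ∈ X <;> by_cases h2 : (g e).1 ∈ Y <;> by_cases h3 : (g e).2 ∈ X <;>
    by_cases h4 : (g e).2 ∈ Y <;> simp [h1, h2, h3, h4]

theorem cut_insert {X : Set V} {w : V} (hw : w ∉ X) :
    cut g F (insert w X) + 2 * between g F {w} X = cut g F X + cut g F {w} := by
  have h := cut_inter_add_cut_union (g := g) (F := F) {w} X
  have h1 : ({w} : Set V) ∩ X = ∅ := Set.singleton_inter_eq_empty.2 hw
  have h2 : ({w} : Set V) \ X = {w} := by
    ext y; simp only [Set.mem_sdiff, Set.mem_singleton_iff, and_iff_left_iff_imp]; rintro rfl; exact hw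
  have h3 : X \ {w} = X := Set.sdiff_singleton_eq_self hw
  have h4 : cut g F ∅ = 0 := by simp [cut, Crosses]
  rw [h1, h2, h3, h4, Set.singleton_union] at h
  omega

theorem between_mono {X Y X' Y' : Set V} (hX : X ⊆ X') (hY : Y ⊆ Y') :
    between g F X Y ≤ between g F X' Y' := by
  refine Finset.card_le_card (Finset.monotone_filter_right _ ?_)
  rintro e - (⟨h1, h2⟩ | ⟨h1, h2⟩)
  · exact Or.inl ⟨hX h1, hY h2⟩
  · exact Or.inr ⟨hY h1, hX h2⟩

theorem between_union_add_between_inter {w : V} {X Y : Set V} (hX : w ∉ X) (hY : w ∉ Y) :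
    between g F {w} X + between g F {w} Y =
      between g F {w} (X ∪ Y) + between g F {w} (X ∩ Y) := by
  simp only [between, Finset.card_filter, ← Finset.sum_add_distrib]
  refine Finset.sum_congr rfl (fun e _ => ?_)
  simp only [Joins, Set.mem_inter_iff, Set.mem_union, Set.mem_singleton_iff]
  by_cases h1 : (g e).1 = w <;> by_cases h2 : (g e).2 = w <;> by_cases h3 : (g e).1 ∈ X <;>
    by_cases h4 : (g e).1 ∈ Y <;> by_cases h5 : (g e).2 ∈ X <;> by_cases h6 : (g e).2 ∈ Y <;>
    simp_all

theorem between_pos {X Y : Set V} {e : E} (he : e ∈ F) {a b : V} (ha : a ∈ X) (hb : b ∈ Y)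
    (hab : a ≠ b) (hea : Inc g e a) (heb : Inc g e b) : 0 < between g F X Y := by
  refine Finset.card_pos.2 ⟨e, Finset.mem_filter.2 ⟨he, ?_⟩⟩
  rcases hea with rfl | rfl <;> rcases heb with rfl | rfl
  · exact absurd rfl hab
  · exact Or.inl ⟨ha, hb⟩
  · exact Or.inr ⟨hb, ha⟩
  · exact absurd rfl hab

/-- Cut requirements are skew-supermodular. -/
theorem req_skew (hAB : A ⊆ B) (X Y : Set V) (hX : 0 < req A B α β X)
    (hY : 0 < req A B α β Y) :
    (req A B α β X + req A B α β Y ≤ req A B α β (X ∩ Y) + req A B α β (X ∪ Y) ∧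
      0 < req A B α β (X ∩ Y) ∧ 0 < req A B α β (X ∪ Y)) ∨
    (req A B α β X + req A B α β Y ≤ req A B α β (X \ Y) + req A B α β (Y \ X) ∧
      0 < req A B α β (X \ Y) ∧ 0 < req A B α β (Y \ X)) := by
  have hquad : ∀ C : Set V, ∃ p q r s : Bool,
      (p = true ↔ ∃ a ∈ C, a ∈ X ∧ a ∈ Y) ∧ (q = true ↔ ∃ a ∈ C, a ∈ X ∧ a ∉ Y) ∧
      (r = true ↔ ∃ a ∈ C, a ∉ X ∧ a ∈ Y) ∧ (s = true ↔ ∃ a ∈ C, a ∉ X ∧ a ∉ Y) := fun C =>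
    ⟨decide _, decide _, decide _, decide _, decide_eq_true_iff, decide_eq_true_iff,
      decide_eq_true_iff, decide_eq_true_iff⟩
  have hsp : ∀ C : Set V, ∀ p q r s : Bool,
      (p = true ↔ ∃ a ∈ C, a ∈ X ∧ a ∈ Y) → (q = true ↔ ∃ a ∈ C, a ∈ X ∧ a ∉ Y) →
      (r = true ↔ ∃ a ∈ C, a ∉ X ∧ a ∈ Y) → (s = true ↔ ∃ a ∈ C, a ∉ X ∧ a ∉ Y) →
      (Splits C X ↔ ((p || q) && (r || s)) = true) ∧ (Splits C Y ↔ ((p || r) && (q || s)) = true) ∧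
      (Splits C (X ∩ Y) ↔ (p && (q || r || s)) = true) ∧
      (Splits C (X ∪ Y) ↔ ((p || q || r) && s) = true) ∧
      (Splits C (X \ Y) ↔ (q && (p || r || s)) = true) ∧
      (Splits C (Y \ X) ↔ (r && (p || q || s)) = true) := by
    intro C p q r s hp hq hr hs
    simp only [Bool.and_eq_true, Bool.or_eq_true, hp, hq, hr, hs, ← exists_or, ← and_or_left]
    refine ⟨?_, ?_, ?_, ?_, ?_, ?_⟩ <;>
    · refine and_congr (exists_congr fun a => and_congr_right fun _ => ?_)
        (exists_congr fun a => and_congr_right fun _ => ?_) <;>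
      by_cases h1 : a ∈ X <;> by_cases h2 : a ∈ Y <;> simp [h1, h2]
  obtain ⟨p, q, r, s, hp, hq, hr, hs⟩ := hquad A
  obtain ⟨p', q', r', s', hp', hq', hr', hs'⟩ := hquad B
  have h1 := hsp A p q r s hp hq hr hs
  have h2 := hsp B p' q' r' s' hp' hq' hr' hs'
  have ip : p = true → p' = true := fun h => hp'.2 ((hp.1 h).imp fun a ha => ⟨hAB ha.1, ha.2⟩)
  have iq : q = true → q' = true := fun h => hq'.2 ((hq.1 h).imp fun a ha => ⟨hAB ha.1, ha.2⟩)
  have ir : r = true → r' = true := fun h => hr'.2 ((hr.1 h).imp fun a ha => ⟨hAB ha.1, ha.2⟩)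
  have is : s = true → s' = true := fun h => hs'.2 ((hs.1 h).imp fun a ha => ⟨hAB ha.1, ha.2⟩)
  clear hp hq hr hs hp' hq' hr' hs' hsp hquad
  simp only [req, h1, h2] at hX hY ⊢
  clear h1 h2
  revert p q r s p' q' r' s'
  intro p q r s p' q' r' s'
  cases p <;> cases q <;> cases r <;> cases s <;> simp <;> cases p' <;> cases q' <;> cases r' <;>
    cases s' <;> simp <;> omega

end Cuts

section Contraction
open scoped Classical

variable {V E : Type*} {k : ℕ}

/-- The vertices that the `i`-th subgraph has to connect in the complement of `v`. -/
def Target (g : E → V × V) (F : Finset E) (v : V) (A : Set V) (π : E → Fin k) (i : Fin k) :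
    Set V :=
  {x | x ≠ v ∧ ((v ∈ A ∧ x ∈ A) ∨ ∃ e ∈ F, π e = i ∧ Inc g e v ∧ Inc g e x)}

/-- A colouring of the edges extending `π` at `v`, connecting the targets away from `v` and
balancing `B`. -/
structure IsSolution (g : E → V × V) (F : Finset E) (v : V) (A B : Set V) (π c : E → Fin k) :
    Prop where
  agree : ∀ e ∈ F, Inc g e v → c e = π e
  conn : ∀ i Z, Splits (Target g F v A π i) Z → ∃ e ∈ F, c e = i ∧ ¬ Inc g e v ∧ Crosses g Z e
  bal : ((∃ s ∈ B, ∃ t ∈ B, s ≠ v ∧ t ≠ v ∧ s ≠ t) ∨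
      ∀ i, 2 ≤ (F.filter fun e => Inc g e v ∧ π e = i).card) →
    ∀ t ∈ B, t ≠ v → ∀ i, 2 ≤ (F.filter fun e => Inc g e t ∧ c e = i).card

/-- The ends of the edges after applying a map to the vertices. -/
def mapEnds (f : V → V) (g : E → V × V) (e : E) : V × V := (f (g e).1, f (g e).2)

/-- The edges that are not loops. -/
noncomputable def nonLoops (g : E → V × V) (F : Finset E) : Finset E :=
  F.filter fun e => (g e).1 ≠ (g e).2

variable {g : E → V × V} {F : Finset E} {v x : V} {A B A' B' X : Set V} {α β : ℕ}
  {π c₁ c₂ : E → Fin k}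

theorem mem_nonLoops {e : E} : e ∈ nonLoops g F ↔ e ∈ F ∧ (g e).1 ≠ (g e).2 := Finset.mem_filter

theorem crosses_mapEnds (f : V → V) (Z : Set V) (e : E) :
    Crosses (mapEnds f g) Z e ↔ Crosses g (f ⁻¹' Z) e := Iff.rfl

theorem cut_nonLoops (Z : Set V) : cut g (nonLoops g F) Z = cut g F Z := by
  unfold cut nonLoops
  rw [Finset.filter_filter]
  congr 1
  refine Finset.filter_congr fun e _ => ⟨fun h => h.2, fun h => ⟨fun h' => h ?_, h⟩⟩
  rw [h']

theorem cut_mapEnds (f : V → V) (Z : Set V) :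
    cut (mapEnds f g) (nonLoops (mapEnds f g) F) Z = cut g F (f ⁻¹' Z) := by
  rw [cut_nonLoops]; rfl

theorem splits_image (f : V → V) (Z : Set V) : Splits (f '' A) Z ↔ Splits A (f ⁻¹' Z) := by
  simp [Splits]

theorem req_image (f : V → V) (Z : Set V) :
    req (f '' A) (f '' B) α β Z = req A B α β (f ⁻¹' Z) := by
  simp only [req, splits_image]

theorem Splits.mono {C D Z : Set V} (h : C ⊆ D) (hC : Splits C Z) : Splits D Z :=
  ⟨hC.1.imp fun _ ha => ⟨h ha.1, ha.2⟩, hC.2.imp fun _ ha => ⟨h ha.1, ha.2⟩⟩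

/-- Contract the set `X` to `x`. -/
noncomputable def shrink (X : Set V) (x y : V) : V := if y ∈ X then x else y

theorem inc_iff_of_not_mem (hx : x ∈ X) {y : V} (hy : y ∉ X) {e : E} :
    Inc (mapEnds (shrink X x) g) e y ↔ Inc g e y := by
  have : ∀ z, shrink X x z = y ↔ z = y := by
    intro z
    unfold shrink
    split_ifs with h
    · exact ⟨fun h' => absurd (h' ▸ hx) hy, fun h' => absurd (h' ▸ h) hy⟩
    · rfl
  simp only [Inc, mapEnds, this]

theorem inc_shrink_self (hx : x ∈ X) {e : E} :
    Inc (mapEnds (shrink X x) g) e x ↔ ∃ y ∈ X, Inc g e y := by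
  have : ∀ z, shrink X x z = x ↔ z ∈ X := by
    intro z
    unfold shrink
    split_ifs with h
    · simp [h]
    · exact ⟨fun h' => h' ▸ hx, fun h' => absurd h' h⟩
  simp only [Inc, mapEnds, this]
  constructor
  · rintro (h | h)
    · exact ⟨_, h, Or.inl rfl⟩
    · exact ⟨_, h, Or.inr rfl⟩
  · rintro ⟨y, hy, rfl | rfl⟩
    · exact Or.inl hy
    · exact Or.inr hy

theorem mem_nonLoops_of_inc {f : V → V} {e : E} (he : e ∈ F) {y z : V} (hy : Inc g e y)
    (hz : Inc g e z) (hyz : f y ≠ f z) : e ∈ nonLoops (mapEnds f g) F := by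
  refine mem_nonLoops.2 ⟨he, ?_⟩
  rcases hy with rfl | rfl <;> rcases hz with rfl | rfl
  · exact absurd rfl hyz
  · exact hyz
  · exact hyz.symm
  · exact absurd rfl hyz

theorem Inc.mapEnds {e : E} {y : V} (f : V → V) (h : Inc g e y) : Inc (mapEnds f g) e (f y) :=
  h.imp (congrArg f) (congrArg f)

theorem Inc.eq_or_eq {e : E} {y z t : V} (hy : Inc g e y) (hz : Inc g e z) (hyz : y ≠ z)
    (ht : Inc g e t) : t = y ∨ t = z := by
  obtain ⟨w, hw, h⟩ := hy.exists_other
  have := h z hz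
  have := h t ht
  grind

/-- Solutions of the two sides of a cut can be glued. -/
theorem IsSolution.glue (hloop : ∀ e ∈ F, Inc g e v → (g e).1 ≠ (g e).2) (hvX : v ∉ X)
    (hxX : x ∈ X) (hxB : B.Nonempty → x ∈ B)
    (h₁ : IsSolution (mapEnds (shrink X x) g) (nonLoops (mapEnds (shrink X x) g) F) v
      (shrink X x '' A) (shrink X x '' B) π c₁)
    (h₂ : IsSolution (mapEnds (shrink Xᶜ v) g) (nonLoops (mapEnds (shrink Xᶜ v) g) F) v
      A' B' c₁ c₂)
    (hA : v ∈ A → ∀ a ∈ A, a ∈ X → v ∈ A' ∧ a ∈ A') (hB : ∀ t ∈ B, t ∈ X → t ∈ B') :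
    IsSolution g F v A B π (fun e => if (g e).1 ∈ X ∧ (g e).2 ∈ X then c₂ e else c₁ e) := by
  set g₁ := mapEnds (shrink X x) g with hg₁
  set g₂ := mapEnds (shrink Xᶜ v) g with hg₂
  set F₁ := nonLoops g₁ F with hF₁
  set F₂ := nonLoops g₂ F with hF₂
  have hvX' : v ∈ Xᶜ := hvX
  have hin : ∀ y ∈ X, shrink X x y = x := fun y hy => if_pos hy
  have hout : ∀ y, y ∉ X → shrink X x y = y := fun y hy => if_neg hy
  have hin₂ : ∀ y ∈ X, shrink Xᶜ v y = y := fun y hy => if_neg (not_not.2 hy)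
  have hout₂ : ∀ y, y ∉ X → shrink Xᶜ v y = v := fun y hy => if_pos hy
  have hxv : x ≠ v := fun h => hvX (h ▸ hxX)
  have hinX : ∀ {e}, ¬ ((g e).1 ∈ X ∧ (g e).2 ∈ X) ↔ ∃ y, y ∉ X ∧ Inc g e y := by
    intro e
    constructor
    · intro h
      by_cases h1 : (g e).1 ∈ X
      · exact ⟨_, fun h2 => h ⟨h1, h2⟩, Or.inr rfl⟩
      · exact ⟨_, h1, Or.inl rfl⟩
    · rintro ⟨y, hy, rfl | rfl⟩ h
      exacts [hy h.1, hy h.2]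
  have hv₂ : ∀ {e}, Inc g₂ e v ↔ ∃ y, y ∉ X ∧ Inc g e y := fun {e} => by
    rw [hg₂, inc_shrink_self hvX']; rfl
  have hv₁ : ∀ {e}, Inc g₁ e v ↔ Inc g e v := inc_iff_of_not_mem hxX hvX
  have ht₂ : ∀ {t e}, t ∈ X → (Inc g₂ e t ↔ Inc g e t) := fun {t e} ht =>
    inc_iff_of_not_mem hvX' (not_not.2 ht)
  -- edges leaving `X`
  have hcross : ∀ {e y z}, e ∈ F → y ∈ X → z ∉ X → Inc g e y → Inc g e z →
      e ∈ F₁ ∧ e ∈ F₂ ∧ Inc g₂ e v ∧ Inc g₂ e y := by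
    intro e y z he hy hz hey hez
    refine ⟨mem_nonLoops_of_inc he hey hez ?_, mem_nonLoops_of_inc he hey hez ?_,
      hv₂.2 ⟨z, hz, hez⟩, (ht₂ hy).2 hey⟩
    · rw [hin y hy, hout z hz]; exact fun h => hz (h ▸ hxX)
    · rw [hin₂ y hy, hout₂ z hz]; exact fun h => hvX (h ▸ hy)
  have hother : ∀ {e y}, e ∈ F₁ → y ∈ X → Inc g e y → ∃ z, z ∉ X ∧ Inc g e z := by
    intro e y he hy hey
    rw [← hinX]
    rintro ⟨h1, h2⟩
    refine (mem_nonLoops.1 he).2 ?_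
    simp only [hg₁, mapEnds, hin _ h1, hin _ h2]
  have hother₂ : ∀ {e}, e ∈ F₂ → ∃ y, y ∈ X ∧ Inc g e y := by
    intro e he
    by_contra! h
    refine (mem_nonLoops.1 he).2 ?_
    simp only [hg₂, mapEnds, hout₂ _ fun h1 => h _ h1 (Or.inl rfl),
      hout₂ _ fun h1 => h _ h1 (Or.inr rfl)]
  have hF₁F : ∀ {e}, e ∈ F₁ → e ∈ F := fun he => (mem_nonLoops.1 he).1
  have hF₂F : ∀ {e}, e ∈ F₂ → e ∈ F := fun he => (mem_nonLoops.1 he).1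
  set c : E → Fin k := fun e => if (g e).1 ∈ X ∧ (g e).2 ∈ X then c₂ e else c₁ e with hc
  have hc₁' : ∀ {e y}, y ∉ X → Inc g e y → c e = c₁ e := fun {e y} hy hey =>
    if_neg (hinX.2 ⟨y, hy, hey⟩)
  have hc₁ : ∀ {e}, e ∈ F₁ → c e = c₁ e := by
    intro e he
    by_cases h : ∃ y, y ∉ X ∧ Inc g e y
    · exact hc₁' h.choose_spec.1 h.choose_spec.2
    · have h' := not_not.1 (mt hinX.1 h)
      exact absurd (hother he h'.1 (Or.inl rfl)) h
  have hc₂ : ∀ {e}, e ∈ F₂ → c e = c₂ e := by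
    intro e he
    by_cases h : ∃ y, y ∉ X ∧ Inc g e y
    · rw [hc₁' h.choose_spec.1 h.choose_spec.2, h₂.agree e he (hv₂.2 h)]
    · exact if_pos (not_not.1 (mt hinX.1 h))
  have hvF₁ : ∀ {e}, e ∈ F → Inc g e v → e ∈ F₁ := by
    intro e he hev
    by_contra h
    have h1 : ∀ y, Inc g e y → shrink X x y = v := by
      intro y hy
      by_contra h2
      exact h (mem_nonLoops_of_inc he hy hev (by rwa [hout v hvX]))
    have h2 : ∀ y, Inc g e y → y = v := by
      intro y hy
      have := h1 y hy
      by_cases hyX : y ∈ X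
      · rw [hin y hyX] at this; exact absurd this hxv
      · rwa [hout y hyX] at this
    exact hloop e he hev ((h2 _ (Or.inl rfl)).trans (h2 _ (Or.inr rfl)).symm)
  have hP₂ : B.Nonempty → ((∃ s ∈ B, s ∉ X ∧ s ≠ v) ∨
      ∀ i, 2 ≤ (F.filter fun e => Inc g e v ∧ π e = i).card) →
      (∀ i, 2 ≤ (F₂.filter fun e => Inc g₂ e v ∧ c₁ e = i).card) ∧
      ∀ t ∈ B, t ≠ v → t ∉ X → ∀ i, 2 ≤ (F.filter fun e => Inc g e t ∧ c e = i).card := by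
    intro hBne h
    replace hxB := hxB hBne
    have hcond : (∃ s ∈ shrink X x '' B, ∃ t ∈ shrink X x '' B, s ≠ v ∧ t ≠ v ∧ s ≠ t) ∨
        ∀ i, 2 ≤ (F₁.filter fun e => Inc g₁ e v ∧ π e = i).card := by
      refine h.imp ?_ ?_
      · rintro ⟨s, hs, hsX, hsv⟩
        exact ⟨s, ⟨s, hs, hout s hsX⟩, x, ⟨x, hxB, hin x hxX⟩, hsv, hxv, fun h => hsX (h ▸ hxX)⟩
      · intro h i
        refine (h i).trans (Finset.card_le_card fun e he => ?_)
        rw [Finset.mem_filter] at he ⊢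
        exact ⟨hvF₁ he.1 he.2.1, hv₁.2 he.2.1, he.2.2⟩
    have hbal := h₁.bal hcond
    constructor
    · intro i
      refine (hbal x ⟨x, hxB, hin x hxX⟩ hxv i).trans (Finset.card_le_card fun e he => ?_)
      rw [Finset.mem_filter] at he ⊢
      obtain ⟨y, hy, hey⟩ := (inc_shrink_self hxX).1 he.2.1
      obtain ⟨z, hz, hez⟩ := hother he.1 hy hey
      have := hcross (hF₁F he.1) hy hz hey hez
      exact ⟨this.2.1, this.2.2.1, he.2.2⟩
    · intro t htB htv htX i
      refine (hbal t ⟨t, htB, hout t htX⟩ htv i).trans (Finset.card_le_card fun e he => ?_)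
      rw [Finset.mem_filter] at he ⊢
      exact ⟨hF₁F he.1, (inc_iff_of_not_mem hxX htX).1 he.2.1, (hc₁ he.1).trans he.2.2⟩
  refine ⟨fun e he hev => ?_, fun i Z hZ => ?_, fun hcond t htB htv i => ?_⟩
  · rw [hc₁ (hvF₁ he hev)]
    exact h₁.agree e (hvF₁ he hev) (hv₁.2 hev)
  · by_cases hT₂ : Splits (Target g₂ F₂ v A' c₁ i) Z
    · obtain ⟨e, he, hei, hev, hZe⟩ := h₂.conn i Z hT₂
      rw [hv₂, ← hinX, not_not] at hev
      refine ⟨e, hF₂F he, (hc₂ he).trans hei, ?_, ?_⟩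
      · rintro (h | h)
        exacts [hvX (h ▸ hev.1), hvX (h ▸ hev.2)]
      · simpa only [Crosses, hg₂, mapEnds, hin₂ _ hev.1, hin₂ _ hev.2] using hZe
    · set Z₁ : Set V := {y | (y ∉ X ∧ y ∈ Z) ∨ (y ∈ X ∧ ∃ s ∈ Target g₂ F₂ v A' c₁ i, s ∈ Z)}
        with hZ₁
      have hout' : ∀ y, y ∉ X → (shrink X x y ∈ Z₁ ↔ y ∈ Z) := by
        intro y hy
        rw [hout y hy]
        simp [hZ₁, hy]
      have hin' : ∀ y ∈ X, y ∈ Target g₂ F₂ v A' c₁ i → (shrink X x y ∈ Z₁ ↔ y ∈ Z) := by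
        intro y hy hyT
        rw [hin y hy]
        simp only [hZ₁, Set.mem_ofPred_eq, hxX, not_true, false_and, true_and, false_or]
        refine ⟨fun h => ?_, fun h => ⟨y, hyT, h⟩⟩
        by_contra h'
        exact hT₂ ⟨h, y, hyT, h'⟩
      have hTX : ∀ t ∈ Target g F v A π i, (shrink X x t ∈ Z₁ ↔ t ∈ Z) := by
        rintro t ⟨htv, ht⟩
        by_cases htX : t ∈ X
        · refine hin' t htX ⟨htv, ?_⟩
          rcases ht with ⟨h1, h2⟩ | ⟨e, he, hei, hev, het⟩
          · exact Or.inl (hA h1 t h2 htX)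
          · have := hcross he htX hvX het hev
            refine Or.inr ⟨e, this.2.1, ?_, this.2.2⟩
            rw [h₁.agree e this.1 (hv₁.2 hev), hei]
        · exact hout' t htX
      have hT₁ : ∀ t ∈ Target g F v A π i, shrink X x t ∈ Target g₁ F₁ v (shrink X x '' A) π i := by
        rintro t ⟨htv, ht⟩
        refine ⟨?_, ?_⟩
        · by_cases htX : t ∈ X
          · rwa [hin t htX]
          · rwa [hout t htX]
        · rcases ht with ⟨h1, h2⟩ | ⟨e, he, hei, hev, het⟩
          · exact Or.inl ⟨⟨v, h1, hout v hvX⟩, ⟨t, h2, rfl⟩⟩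
          · exact Or.inr ⟨e, hvF₁ he hev, hei, hv₁.2 hev, het.mapEnds _⟩
      obtain ⟨⟨a, haT, haZ⟩, b, hbT, hbZ⟩ := hZ
      obtain ⟨e, he, hei, hev, hZe⟩ := h₁.conn i Z₁
        ⟨⟨_, hT₁ a haT, (hTX a haT).2 haZ⟩, _, hT₁ b hbT, mt (hTX b hbT).1 hbZ⟩
      refine ⟨e, hF₁F he, (hc₁ he).trans hei, mt hv₁.2 hev, ?_⟩
      have hend : ∀ y, Inc g e y → (shrink X x y ∈ Z₁ ↔ y ∈ Z) := by
        intro y hey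
        by_cases hyX : y ∈ X
        · refine hin' y hyX ⟨fun h => hvX (h ▸ hyX), Or.inr ⟨e, ?_⟩⟩
          obtain ⟨z, hz, hez⟩ := hother he hyX hey
          have := hcross (hF₁F he) hyX hz hey hez
          exact ⟨this.2.1, hei, this.2.2⟩
        · exact hout' y hyX
      rw [hg₁, crosses_mapEnds, Crosses, Set.mem_preimage, Set.mem_preimage,
        hend _ (Or.inl rfl), hend _ (Or.inr rfl)] at hZe
      exact hZe
  · replace hP₂ := hP₂ ⟨t, htB⟩
    by_cases htX : t ∈ X
    · have hcond₂ : (∃ s ∈ B', ∃ t ∈ B', s ≠ v ∧ t ≠ v ∧ s ≠ t) ∨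
          ∀ i, 2 ≤ (F₂.filter fun e => Inc g₂ e v ∧ c₁ e = i).card := by
        rcases hcond with ⟨s, hs, s', hs', hsv, hsv', hss⟩ | h
        · by_cases h1 : s ∈ X
          · by_cases h2 : s' ∈ X
            · exact Or.inl ⟨s, hB s hs h1, s', hB s' hs' h2, hsv, hsv', hss⟩
            · exact Or.inr (hP₂ (Or.inl ⟨s', hs', h2, hsv'⟩)).1
          · exact Or.inr (hP₂ (Or.inl ⟨s, hs, h1, hsv⟩)).1
        · exact Or.inr (hP₂ (Or.inr h)).1
      refine (h₂.bal hcond₂ t (hB t htB htX) htv i).trans (Finset.card_le_card fun e he => ?_)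
      rw [Finset.mem_filter] at he ⊢
      exact ⟨hF₂F he.1, (ht₂ htX).1 he.2.1, (hc₂ he.1).trans he.2.2⟩
    · exact (hP₂ (hcond.imp_left fun ⟨s, hs, s', hs', hsv, hsv', hss⟩ =>
        ⟨t, htB, htX, htv⟩)).2 t htB htv htX i

end Contraction

section Instances
open scoped Classical

variable {V E : Type*} {k : ℕ}

/-- The data of the main induction. Either `A` is highly connected and contains `v`, or `A` is
highly connected, does not contain `v` and `v` is joined to it by a smaller cut. -/
structure IsInstance (g : E → V × V) (F : Finset E) (U : Finset V) (v : V) (A B : Set V)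
    (α β : ℕ) (π : E → Fin k) : Prop where
  ends : ∀ e ∈ F, (g e).1 ∈ U ∧ (g e).2 ∈ U
  loopless : ∀ e ∈ F, (g e).1 ≠ (g e).2
  base : v ∈ B
  subset : A ⊆ B
  verts : ∀ b ∈ B, b ∈ U
  le : β ≤ α
  pos : 0 < k
  cuts : ∀ Z, req A B α β Z ≤ cut g F Z
  degree : cut g F {v} = req A B α β {v}
  kind : (v ∈ A ∧ (∃ a ∈ A, a ≠ v) ∧ 32 * k ≤ β ∧ α ≤ β + 4 * k ∧
      ∀ i, 2 ≤ (F.filter fun e => Inc g e v ∧ π e = i).card) ∨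
    (v ∉ A ∧ A.Nonempty ∧ B = insert v A ∧ 32 * k ≤ α)

variable {g : E → V × V} {F : Finset E} {U : Finset V} {v x : V} {A B X : Set V} {α β : ℕ}
  {π c : E → Fin k}

theorem card_image_shrink_lt {y z : V} (hy : y ∈ X) (hz : z ∈ X) (hyU : y ∈ U) (hzU : z ∈ U)
    (hyz : y ≠ z) : (U.image (shrink X x)).card < U.card := by
  refine lt_of_le_of_ne Finset.card_image_le fun h => hyz ?_
  refine Finset.card_image_iff.1 h hyU hzU ?_
  simp [shrink, hy, hz]

/-- Contracting a set avoiding the base vertex. -/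
theorem IsInstance.contract (h : IsInstance g F U v A B α β π) (hvX : v ∉ X) (hxX : x ∈ X) :
    IsInstance (mapEnds (shrink X x) g) (nonLoops (mapEnds (shrink X x) g) F)
      (U.image (shrink X x)) v (shrink X x '' A) (shrink X x '' B) α β π := by
  have hv : shrink X x v = v := if_neg hvX
  have hxv : x ≠ v := fun h => hvX (h ▸ hxX)
  have hsv : ∀ y, shrink X x y = v ↔ y = v := by
    intro y
    refine ⟨fun hy => ?_, fun hy => hy ▸ hv⟩
    unfold shrink at hy
    split_ifs at hy
    exacts [absurd hy hxv, hy]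
  refine ⟨fun e he => ?_, fun e he => (mem_nonLoops.1 he).2, ⟨v, h.base, hv⟩,
    Set.image_mono h.subset, ?_, h.le, h.pos, fun Z => ?_, ?_, ?_⟩
  · have := h.ends e (mem_nonLoops.1 he).1
    exact ⟨Finset.mem_image_of_mem _ this.1, Finset.mem_image_of_mem _ this.2⟩
  · rintro _ ⟨b, hb, rfl⟩
    exact Finset.mem_image_of_mem _ (h.verts b hb)
  · rw [req_image, cut_mapEnds]
    exact h.cuts _
  · have : shrink X x ⁻¹' {v} = {v} := by ext y; simp [hsv]
    rw [req_image, cut_mapEnds, this]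
    exact h.degree
  · refine h.kind.imp ?_ ?_
    · rintro ⟨h1, ⟨a, ha, hav⟩, h3, h4, h5⟩
      refine ⟨⟨v, h1, hv⟩, ⟨_, ⟨a, ha, rfl⟩, mt (hsv a).1 hav⟩, h3, h4, fun i => ?_⟩
      refine (h5 i).trans (Finset.card_le_card fun e he => ?_)
      rw [Finset.mem_filter] at he ⊢
      refine ⟨mem_nonLoops.2 ⟨he.1, fun h' => ?_⟩, (inc_iff_of_not_mem hxX hvX).2 he.2.1, he.2.2⟩
      have hl := h.loopless e he.1
      simp only [mapEnds] at h'
      rcases he.2.1 with h6 | h6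
      · rw [h6, hv, eq_comm, hsv] at h'
        exact hl (h6.trans h'.symm)
      · rw [h6, hv, hsv] at h'
        exact hl (h'.trans h6.symm)
    · rintro ⟨h1, ⟨a, ha⟩, h3, h4⟩
      refine ⟨?_, ⟨_, a, ha, rfl⟩, ?_, h4⟩
      · rintro ⟨a, ha, hav⟩
        exact h1 ((hsv a).1 hav ▸ ha)
      · rw [h3, Set.image_insert_eq, hv]

theorem preimage_shrink_compl_singleton (hvX : v ∉ X) : shrink Xᶜ v ⁻¹' {v} = Xᶜ := by
  ext y
  by_cases h : y ∈ X
  · have : y ≠ v := fun h' => hvX (h' ▸ h)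
    simp [shrink, h, this]
  · simp [shrink, h]

/-- The other side of a tight cut. -/
theorem IsInstance.contract_compl (h : IsInstance g F U v A B α β π) (hvX : v ∉ X) (hxX : x ∈ X)
    (hxB : x ∈ B) (htight : cut g F X = req A B α β X) (hpos : 0 < req A B α β X)
    (hc : IsSolution (mapEnds (shrink X x) g) (nonLoops (mapEnds (shrink X x) g) F) v
      (shrink X x '' A) (shrink X x '' B) π c) :
    ∃ A' B' α' β', IsInstance (mapEnds (shrink Xᶜ v) g) (nonLoops (mapEnds (shrink Xᶜ v) g) F)
      (U.image (shrink Xᶜ v)) v A' B' α' β' c ∧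
      (v ∈ A → ∀ a ∈ A, a ∈ X → v ∈ A' ∧ a ∈ A') ∧ ∀ t ∈ B, t ∈ X → t ∈ B' := by
  have hsplit := req_pos h.subset hpos
  have hv : shrink Xᶜ v v = v := if_pos hvX
  have hin : ∀ y ∈ X, shrink Xᶜ v y = y := fun y hy => if_neg (not_not.2 hy)
  have hxv : x ≠ v := fun h => hvX (h ▸ hxX)
  have hvU := h.verts v h.base
  have hsub : B ∩ X ⊆ shrink Xᶜ v '' B := fun b hb => ⟨b, hb.1, hin b hb.2⟩
  have hsub' : insert v (B ∩ X) ⊆ shrink Xᶜ v '' B :=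
    Set.insert_subset ⟨v, h.base, hv⟩ hsub
  have hU : ∀ b ∈ shrink Xᶜ v '' B, b ∈ U.image (shrink Xᶜ v) := by
    rintro _ ⟨b, hb, rfl⟩
    exact Finset.mem_image_of_mem _ (h.verts b hb)
  have hends : ∀ e ∈ nonLoops (mapEnds (shrink Xᶜ v) g) F,
      (mapEnds (shrink Xᶜ v) g e).1 ∈ U.image (shrink Xᶜ v) ∧
      (mapEnds (shrink Xᶜ v) g e).2 ∈ U.image (shrink Xᶜ v) := by
    intro e he
    have := h.ends e (mem_nonLoops.1 he).1
    exact ⟨Finset.mem_image_of_mem _ this.1, Finset.mem_image_of_mem _ this.2⟩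
  have hdeg : cut (mapEnds (shrink Xᶜ v) g) (nonLoops (mapEnds (shrink Xᶜ v) g) F) {v} =
      cut g F X := by
    rw [cut_mapEnds, preimage_shrink_compl_singleton hvX, cut_compl]
  have hspv : ∀ C : Set V, C.Nonempty → v ∉ C → Splits (insert v C) {v} := by
    rintro C ⟨a, ha⟩ hvC
    exact ⟨⟨v, Set.mem_insert _ _, rfl⟩, a, Set.mem_insert_of_mem _ ha, fun h => hvC (h ▸ ha)⟩
  rcases h.kind with ⟨h1, -, h3, h4, h5⟩ | ⟨h1, h2, h3, h4⟩
  · by_cases hA : Splits A X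
    · refine ⟨shrink Xᶜ v '' A, shrink Xᶜ v '' B, α, β,
        ⟨hends, fun e he => (mem_nonLoops.1 he).2, ⟨v, h.base, hv⟩, Set.image_mono h.subset,
          hU, h.le, h.pos, fun Z => ?_, ?_, Or.inl ⟨⟨v, h1, hv⟩, ?_, h3, h4, fun i => ?_⟩⟩,
        fun _ a ha haX => ⟨⟨v, h1, hv⟩, a, ha, hin a haX⟩, fun t ht htX => ⟨t, ht, hin t htX⟩⟩
      · rw [req_image, cut_mapEnds]; exact h.cuts _
      · rw [hdeg, htight, req_image, preimage_shrink_compl_singleton hvX, req_compl]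
      · obtain ⟨a, ha, haX⟩ := hA.1
        exact ⟨a, ⟨a, ha, hin a haX⟩, fun h => hvX (h ▸ haX)⟩
      · have := (h.contract hvX hxX).kind
        rcases this with ⟨-, -, -, -, hP⟩ | h'
        · refine (hc.bal (Or.inr hP) x ⟨x, hxB, if_pos hxX⟩ hxv i).trans
            (Finset.card_le_card fun e he => ?_)
          rw [Finset.mem_filter] at he ⊢
          obtain ⟨y, hy, hey⟩ := (inc_shrink_self hxX).1 he.2.1
          have hz : ∃ z, z ∉ X ∧ Inc g e z := by
            by_contra! hz
            refine (mem_nonLoops.1 he.1).2 ?_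
            have h1 : (g e).1 ∈ X := not_not.1 fun h => hz _ h (Or.inl rfl)
            have h2 : (g e).2 ∈ X := not_not.1 fun h => hz _ h (Or.inr rfl)
            simp [mapEnds, shrink, h1, h2]
          obtain ⟨z, hz, hez⟩ := hz
          refine ⟨mem_nonLoops_of_inc (mem_nonLoops.1 he.1).1 hey hez ?_,
            (inc_shrink_self (X := Xᶜ) hvX).2 ⟨z, hz, hez⟩, he.2.2⟩
          rw [hin y hy, shrink, if_pos (show z ∈ Xᶜ from hz)]
          exact fun h => hvX (h ▸ hy)
        · exact absurd ⟨v, h1, if_neg hvX⟩ h'.1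
    · have hreq : req A B α β X = β := by rw [req, if_neg hA, if_pos hsplit]
      have hAX : ∀ a ∈ A, a ∉ X := fun a ha haX => hA ⟨⟨a, ha, haX⟩, v, h1, hvX⟩
      have hne : (B ∩ X).Nonempty := ⟨x, hxB, hxX⟩
      refine ⟨B ∩ X, insert v (B ∩ X), β, β,
        ⟨hends, fun e he => (mem_nonLoops.1 he).2, Set.mem_insert _ _, Set.subset_insert _ _,
          fun b hb => hU b (hsub' hb), le_rfl, h.pos, fun Z => ?_, ?_,
          Or.inr ⟨fun h => hvX h.2, hne, rfl, h3⟩⟩,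
        fun _ a ha haX => absurd haX (hAX a ha), fun t ht htX => Set.mem_insert_of_mem _ ⟨ht, htX⟩⟩
      · rw [cut_mapEnds]
        by_cases hs : Splits (insert v (B ∩ X)) Z
        · have := (splits_image _ _).1 (hs.mono hsub')
          exact ((req_le le_rfl).trans (le_req_of_splits h.le this)).trans (h.cuts _)
        · have : ¬ 0 < req (B ∩ X) (insert v (B ∩ X)) β β Z := fun h =>
            hs (req_pos (Set.subset_insert _ _) h)
          omega
      · rw [hdeg, htight, hreq]
        exact le_antisymm (le_req_of_splits le_rfl (hspv _ hne fun h => hvX h.2)) (req_le le_rfl)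
  · have hBX : ∀ b ∈ B, b ∈ X → b ∈ A := by
      intro b hb hbX
      rw [h3] at hb
      exact hb.resolve_left fun h => hvX (h ▸ hbX)
    have hne : (A ∩ X).Nonempty := ⟨x, hBX x hxB hxX, hxX⟩
    have hvn : v ∉ A ∩ X := fun h => hvX h.2
    have hAX : A ∩ X = B ∩ X := by
      ext y
      exact ⟨fun hy => ⟨h.subset hy.1, hy.2⟩, fun hy => ⟨hBX y hy.1 hy.2, hy.2⟩⟩
    refine ⟨A ∩ X, insert v (A ∩ X), α, req A B α β X,
        ⟨hends, fun e he => (mem_nonLoops.1 he).2, Set.mem_insert _ _, Set.subset_insert _ _,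
          fun b hb => hU b (hsub' (hAX ▸ hb)), req_le h.le, h.pos, fun Z => ?_, ?_,
          Or.inr ⟨hvn, hne, rfl, h4⟩⟩,
        fun hvA => absurd hvA h1, fun t ht htX => Set.mem_insert_of_mem _ ⟨hBX t ht htX, htX⟩⟩
    · rw [cut_mapEnds]
      refine le_trans ?_ (h.cuts _)
      by_cases hs : Splits (A ∩ X) Z
      · rw [req_of_splits hs, req_of_splits]
        exact (splits_image _ _).1 (hs.mono fun a ha => ⟨a, ha.1, hin a ha.2⟩)
      rw [req, if_neg hs]
      split_ifs with hs'
      · by_cases hvZ : v ∈ Z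
        · have hZ : ∀ a ∈ A ∩ X, a ∉ Z := by
            obtain ⟨-, b, hb, hbZ⟩ := hs'
            have hb' : b ∈ A ∩ X := hb.resolve_left fun h => hbZ (h ▸ hvZ)
            exact fun a ha haZ => hs ⟨⟨a, ha, haZ⟩, b, hb', hbZ⟩
          rw [← req_compl X]
          refine (req_congr h.subset fun b hb => ?_).le
          by_cases hbX : b ∈ X
          · have := hZ b ⟨hBX b hb hbX, hbX⟩
            simp [hbX, hin b hbX, this]
          · simp [hbX, shrink, hvZ]
        · have hZ : ∀ a ∈ A ∩ X, a ∈ Z := by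
            obtain ⟨⟨b, hb, hbZ⟩, -⟩ := hs'
            have hb' : b ∈ A ∩ X := hb.resolve_left fun h => hvZ (h ▸ hbZ)
            intro a ha
            by_contra haZ
            exact hs ⟨⟨b, hb', hbZ⟩, a, ha, haZ⟩
          refine (req_congr h.subset fun b hb => ?_).le
          by_cases hbX : b ∈ X
          · have := hZ b ⟨hBX b hb hbX, hbX⟩
            simp [hbX, hin b hbX, this]
          · simp [hbX, shrink, hvZ]
      · exact Nat.zero_le _
    · rw [hdeg, htight]
      refine le_antisymm (le_req_of_splits (req_le h.le) (hspv _ hne hvn)) ?_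
      rw [req, if_neg fun hs : Splits (A ∩ X) {v} => ?_]
      · split_ifs <;> simp
      · obtain ⟨a, ha, rfl⟩ := hs.1
        exact hvn ha

end Instances

section Reductions
open scoped Classical

variable {V E : Type*} {k : ℕ} {g : E → V × V} {F : Finset E} {U : Finset V} {v : V}
  {A B : Set V} {α β : ℕ} {π c : E → Fin k} {e₀ : E}

theorem cut_erase_of_not_crosses {Z : Set V} (h : ¬ Crosses g Z e₀) :
    cut g (F.erase e₀) Z = cut g F Z := by
  unfold cut
  congr 1
  ext e
  simp only [Finset.mem_filter, Finset.mem_erase]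
  exact ⟨fun h' => ⟨h'.1.2, h'.2⟩, fun h' => ⟨⟨fun h'' => h (h'' ▸ h'.2), h'.1⟩, h'.2⟩⟩

theorem cut_erase_of_crosses {Z : Set V} (he : e₀ ∈ F) (h : Crosses g Z e₀) :
    cut g (F.erase e₀) Z + 1 = cut g F Z := by
  unfold cut
  rw [Finset.filter_erase]
  exact Finset.card_erase_add_one (Finset.mem_filter.2 ⟨he, h⟩)

theorem crosses_singleton (hl : (g e₀).1 ≠ (g e₀).2) {x : V} :
    Crosses g {x} e₀ ↔ Inc g e₀ x := by
  simp only [Crosses, Set.mem_singleton_iff, Inc]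
  grind

/-- Delete an edge that crosses no tight set. -/
theorem IsInstance.erase (h : IsInstance g F U v A B α β π) (he : e₀ ∈ F) (hev : ¬ Inc g e₀ v)
    (hcr : ∀ Z, Crosses g Z e₀ → 0 < req A B α β Z → req A B α β Z ≠ cut g F Z) :
    IsInstance g (F.erase e₀) U v A B α β π := by
  refine ⟨fun e he => h.ends e (Finset.mem_of_mem_erase he),
    fun e he => h.loopless e (Finset.mem_of_mem_erase he), h.base, h.subset, h.verts, h.le, h.pos,
    fun Z => ?_, ?_, ?_⟩
  · by_cases hZ : Crosses g Z e₀
    · have h1 := cut_erase_of_crosses he hZ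
      have h2 := h.cuts Z
      have h3 := hcr Z hZ
      omega
    · rw [cut_erase_of_not_crosses hZ]; exact h.cuts Z
  · rw [cut_erase_of_not_crosses (mt (crosses_singleton (h.loopless _ he)).1 hev)]; exact h.degree
  · refine h.kind.imp_left fun ⟨h1, h2, h3, h4, h5⟩ => ⟨h1, h2, h3, h4, fun i => ?_⟩
    refine (h5 i).trans (Finset.card_le_card fun e he => ?_)
    rw [Finset.mem_filter] at he ⊢
    exact ⟨Finset.mem_erase.2 ⟨fun h' => hev (h' ▸ he.2.1), he.1⟩, he.2⟩

theorem IsSolution.of_erase (h : IsSolution g (F.erase e₀) v A B π c) (hev : ¬ Inc g e₀ v) :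
    IsSolution g F v A B π c := by
  have hF : ∀ e ∈ F, Inc g e v → e ∈ F.erase e₀ := fun e he hv =>
    Finset.mem_erase.2 ⟨fun h' => hev (h' ▸ hv), he⟩
  refine ⟨fun e he hv => h.agree e (hF e he hv) hv, fun i Z hZ => ?_, fun hcond t ht htv i => ?_⟩
  · obtain ⟨e, he, h'⟩ := h.conn i Z (hZ.mono fun x hx => ⟨hx.1, hx.2.imp_right
      fun ⟨e, he, hi, hev, hex⟩ => ⟨e, hF e he hev, hi, hev, hex⟩⟩)
    exact ⟨e, Finset.mem_of_mem_erase he, h'⟩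
  · refine (h.bal (hcond.imp_right fun hP i => (hP i).trans (Finset.card_le_card
      fun e he => ?_)) t ht htv i).trans (Finset.card_le_card fun e he => ?_)
    · rw [Finset.mem_filter] at he ⊢
      exact ⟨Finset.mem_of_mem_erase he.1, he.2⟩
    · rw [Finset.mem_filter] at he ⊢
      exact ⟨hF e he.1 he.2.1, he.2⟩

theorem cut_singleton_eq (hl : ∀ e ∈ F, (g e).1 ≠ (g e).2) (x : V) :
    cut g F {x} = (F.filter fun e => Inc g e x).card := by
  unfold cut
  congr 1
  exact Finset.filter_congr fun e he => crosses_singleton (hl e he)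

/-- Delete the only edge at the base vertex. -/
theorem IsInstance.erase_base (h : IsInstance g F U v A B α 1 π) (hv : v ∉ A) (he : e₀ ∈ F)
    (hev : Inc g e₀ v) (huniq : ∀ e ∈ F, Inc g e v → e = e₀) :
    IsInstance g (F.erase e₀) U v A B α 0 π := by
  have hA : ¬ Splits A {v} := fun hs => by
    obtain ⟨a, ha, rfl⟩ := hs.1
    exact hv ha
  refine ⟨fun e he => h.ends e (Finset.mem_of_mem_erase he),
    fun e he => h.loopless e (Finset.mem_of_mem_erase he), h.base, h.subset, h.verts,
    Nat.zero_le _, h.pos, fun Z => ?_, ?_, Or.inr (h.kind.resolve_left fun h' => hv h'.1)⟩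
  · by_cases hs : Splits A Z
    · rw [req_of_splits hs]
      by_cases hZ : Crosses g Z e₀
      · set Z' : Set V := {x | x ∈ Z ↔ x ≠ v} with hZ'
        have hs' : Splits A Z' := (splits_congr fun a ha => by
          have : a ≠ v := fun h => hv (h ▸ ha)
          simp [hZ', this]).1 hs
        have h1 := h.cuts Z'
        rw [req_of_splits hs'] at h1
        refine h1.trans (Finset.card_le_card fun e he' => ?_)
        rw [Finset.mem_filter] at he' ⊢
        have hl := h.loopless e he'.1
        have hne : e ≠ e₀ := by
          rintro rfl
          refine absurd he'.2 ?_
          simp only [Crosses, hZ', Set.mem_ofPred_eq] at hZ ⊢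
          rcases hev with h' | h'
          · have : (g e).2 ≠ v := fun h'' => hl (h'.trans h''.symm)
            rw [h'] at hZ ⊢
            simp only [this, ne_eq, not_true, iff_false, not_false_eq_true, iff_true]
            tauto
          · have : (g e).1 ≠ v := fun h'' => hl (h''.trans h'.symm)
            rw [h'] at hZ ⊢
            simp only [this, ne_eq, not_true, iff_false, not_false_eq_true, iff_true]
            tauto
        have hnv : ¬ Inc g e v := fun h' => hne (huniq e he'.1 h')
        refine ⟨Finset.mem_erase.2 ⟨hne, he'.1⟩, ?_⟩
        have h3 : (g e).1 ≠ v := fun h' => hnv (Or.inl h')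
        have h4 : (g e).2 ≠ v := fun h' => hnv (Or.inr h')
        simpa [Crosses, hZ', h3, h4] using he'.2
      · have := h.cuts Z
        rw [req_of_splits hs] at this
        rwa [cut_erase_of_not_crosses hZ]
    · rw [req, if_neg hs, ite_self]; exact Nat.zero_le _
  · rw [req, if_neg hA, ite_self, cut_singleton_eq fun e he => h.loopless e
      (Finset.mem_of_mem_erase he), Finset.card_eq_zero, Finset.filter_eq_empty_iff]
    exact fun e he' h' => (Finset.mem_erase.1 he').1 (huniq e (Finset.mem_erase.1 he').2 h')

theorem IsSolution.of_erase_base (h : IsSolution g (F.erase e₀) v A B π c) (hk : 0 < k)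
    (hv : v ∉ A) (hev : Inc g e₀ v) (huniq : ∀ e ∈ F, Inc g e v → e = e₀) :
    IsSolution g F v A B π (Function.update c e₀ (π e₀)) := by
  refine ⟨fun e he hev => ?_, fun i Z hZ => ?_, fun hcond t ht htv i => ?_⟩
  · rw [huniq e he hev, Function.update_self]
  · exfalso
    obtain ⟨⟨a, ⟨hav, ha⟩, haZ⟩, b, ⟨hbv, hb⟩, hbZ⟩ := hZ
    obtain ⟨e, he, -, h1, h2⟩ := ha.resolve_left fun h => hv h.1
    obtain ⟨e', he', -, h1', h2'⟩ := hb.resolve_left fun h => hv h.1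
    rw [huniq e he h1] at h2
    rw [huniq e' he' h1'] at h2'
    have := Inc.eq_or_eq hev h2 hav.symm h2'
    exact hbZ ((this.resolve_left hbv) ▸ haZ)
  · refine (h.bal (Or.inl (hcond.resolve_right fun hP => ?_)) t ht htv i).trans
      (Finset.card_le_card fun e he => ?_)
    · have := (hP ⟨0, hk⟩).trans (Finset.card_le_card (t := {e₀}) fun e he => by
        rw [Finset.mem_filter] at he
        exact Finset.mem_singleton.2 (huniq e he.1 he.2.1))
      simp at this
    · rw [Finset.mem_filter, Finset.mem_erase] at he
      rw [Finset.mem_filter, Function.update_of_ne he.1.1]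
      exact ⟨he.1.2, he.2⟩

variable {w a b : V} {e₁ e₂ : E}

/-- Replace the two edges `wa` and `wb` by one edge `ab`. -/
theorem IsInstance.split (h : IsInstance g F U v A B α β π) (hw : w ∉ B)
    (he₁ : e₁ ∈ F) (he₂ : e₂ ∈ F) (h1w : Inc g e₁ w) (h1a : Inc g e₁ a) (h2w : Inc g e₂ w)
    (h2b : Inc g e₂ b) (haw : a ≠ w) (hbw : b ≠ w) (hab : a ≠ b) (hbv : b ≠ v)
    (hsafe : ∀ Z, w ∉ Z → a ∈ Z → b ∈ Z → 0 < req A B α β Z →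
      req A B α β Z + 2 ≤ cut g F Z) :
    IsInstance (Function.update g e₁ (a, b)) (F.erase e₂) U v A B α β π := by
  have hne : e₁ ≠ e₂ := by
    rintro rfl
    rcases Inc.eq_or_eq h1w h1a haw.symm h2b with h | h
    exacts [hbw h, hab h.symm]
  have hwv : w ≠ v := fun h' => hw (h' ▸ h.base)
  have hm : e₁ ∈ F.erase e₂ := Finset.mem_erase.2 ⟨hne, he₁⟩
  have hinc : ∀ {e x}, Inc (Function.update g e₁ (a, b)) e x ↔
      if e = e₁ then a = x ∨ b = x else Inc g e x := by
    intro e x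
    split_ifs with h
    · subst h; simp [Inc]
    · simp [Inc, h]
  have hU : ∀ {e x}, e ∈ F → Inc g e x → x ∈ U := by
    rintro e x he (rfl | rfl)
    exacts [(h.ends e he).1, (h.ends e he).2]
  have hcut : ∀ Z, cut (Function.update g e₁ (a, b)) (F.erase e₂) Z +
      (if Crosses g Z e₁ then 1 else 0) + (if Crosses g Z e₂ then 1 else 0) =
      cut g F Z + if (a ∈ Z ↔ b ∈ Z) then 0 else 1 := by
    intro Z
    have h3 : ∀ g' : E → V × V, cut g' (F.erase e₂) Z =
        cut g' ((F.erase e₂).erase e₁) Z + if Crosses g' Z e₁ then 1 else 0 := by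
      intro g'
      split_ifs with h
      · rw [cut_erase_of_crosses hm h]
      · rw [cut_erase_of_not_crosses h, add_zero]
    have h4 : cut g F Z = cut g (F.erase e₂) Z + if Crosses g Z e₂ then 1 else 0 := by
      split_ifs with h
      · rw [cut_erase_of_crosses he₂ h]
      · rw [cut_erase_of_not_crosses h, add_zero]
    have h5 : cut (Function.update g e₁ (a, b)) ((F.erase e₂).erase e₁) Z =
        cut g ((F.erase e₂).erase e₁) Z := by
      unfold cut
      congr 1
      refine Finset.filter_congr fun e he => ?_
      simp only [Crosses, Function.update_of_ne (Finset.ne_of_mem_erase he)]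
    have h6 : Crosses (Function.update g e₁ (a, b)) Z e₁ ↔ ¬ (a ∈ Z ↔ b ∈ Z) := by
      simp [Crosses]
    have h7 := h3 g
    rw [h3, h5, h4, h7]
    simp only [h6]
    split_ifs <;> omega
  have hcr : ∀ {e x} (Z : Set V), Inc g e w → Inc g e x → x ≠ w →
      (Crosses g Z e ↔ ¬ (w ∈ Z ↔ x ∈ Z)) := by
    intro e x Z hew hex hxw
    simp only [Crosses]
    have := hew.eq_or_eq hex hxw.symm (Or.inl rfl)
    have := hew.eq_or_eq hex hxw.symm (Or.inr rfl)
    rcases hew with rfl | rfl <;> rcases hex with rfl | rfl <;> tauto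
  refine ⟨fun e he => ?_, fun e he => ?_, h.base, h.subset, h.verts, h.le, h.pos,
    fun Z => ?_, ?_, ?_⟩
  · by_cases hee : e = e₁
    · subst hee; simp only [Function.update_self]; exact ⟨hU he₁ h1a, hU he₂ h2b⟩
    · rw [Function.update_of_ne hee]; exact h.ends e (Finset.mem_of_mem_erase he)
  · by_cases hee : e = e₁
    · subst hee; simpa
    · rw [Function.update_of_ne hee]; exact h.loopless e (Finset.mem_of_mem_erase he)
  · have h1 := hcut Z
    have h2 := h.cuts Z
    rw [hcr Z h1w h1a haw, hcr Z h2w h2b hbw] at h1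
    have h3 : w ∉ Z → a ∈ Z → b ∈ Z → 0 < req A B α β Z → req A B α β Z + 2 ≤ cut g F Z :=
      hsafe Z
    have h4 : w ∈ Z → a ∉ Z → b ∉ Z → 0 < req A B α β Z → req A B α β Z + 2 ≤ cut g F Z := by
      intro hwZ haZ hbZ hp
      have := hsafe Zᶜ (not_not.2 hwZ) haZ hbZ
      rw [req_compl, cut_compl] at this
      exact this hp
    by_cases hwZ : w ∈ Z <;> by_cases haZ : a ∈ Z <;> by_cases hbZ : b ∈ Z <;>
      simp only [hwZ, haZ, hbZ, iff_true, iff_false, not_true, not_false_eq_true,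
        if_true, if_false, forall_const] at h1 h3 h4 <;> omega
  · have h1 := hcut {v}
    rw [hcr _ h1w h1a haw, hcr _ h2w h2b hbw] at h1
    have h2 := h.degree
    generalize cut (Function.update g e₁ (a, b)) (F.erase e₂) {v} = m at h1 ⊢
    by_cases hav : a = v <;> simp [hav, hbv, hwv] at h1 <;> omega
  · refine h.kind.imp_left fun ⟨h1, h2, h3, h4, h5⟩ => ⟨h1, h2, h3, h4, fun i => ?_⟩
    refine (h5 i).trans (Finset.card_le_card fun e he => ?_)
    rw [Finset.mem_filter] at he ⊢
    refine ⟨Finset.mem_erase.2 ⟨?_, he.1⟩, ?_, he.2.2⟩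
    · rintro rfl
      rcases Inc.eq_or_eq h2w h2b hbw.symm he.2.1 with h | h
      exacts [hwv h.symm, hbv h.symm]
    · rw [hinc]
      split_ifs with hee
      · subst hee
        rcases Inc.eq_or_eq h1w h1a haw.symm he.2.1 with h | h
        exacts [absurd h.symm hwv, Or.inl h.symm]
      · exact he.2.1

theorem IsSolution.of_split
    (h : IsSolution (Function.update g e₁ (a, b)) (F.erase e₂) v A B π c)
    (hw : w ∉ B) (hwv : w ≠ v) (hwA : w ∉ A)
    (he₁ : e₁ ∈ F) (he₂ : e₂ ∈ F) (h1w : Inc g e₁ w) (h1a : Inc g e₁ a) (h2w : Inc g e₂ w)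
    (h2b : Inc g e₂ b) (haw : a ≠ w) (hbw : b ≠ w) (hab : a ≠ b) (hbv : b ≠ v) :
    IsSolution g F v A B π (Function.update c e₂ (c e₁)) := by
  set g' := Function.update g e₁ (a, b) with hg'
  set c' := Function.update c e₂ (c e₁) with hc'
  have hne : e₁ ≠ e₂ := by
    rintro rfl
    rcases Inc.eq_or_eq h1w h1a haw.symm h2b with h | h
    exacts [hbw h, hab h.symm]
  have hm : e₁ ∈ F.erase e₂ := Finset.mem_erase.2 ⟨hne, he₁⟩
  have hc₂ : c' e₂ = c e₁ := Function.update_self ..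
  have hcc : ∀ {e}, e ≠ e₂ → c' e = c e := fun h => Function.update_of_ne h ..
  have hinc : ∀ {e x}, e ≠ e₁ → (Inc g' e x ↔ Inc g e x) := by
    intro e x h; simp [Inc, h, hg']
  have hinc₁ : ∀ {x}, Inc g' e₁ x ↔ x = a ∨ x = b := by
    intro x; simp [Inc, hg', eq_comm]
  have h1 : ∀ {x}, Inc g e₁ x ↔ x = w ∨ x = a := fun {x} =>
    ⟨h1w.eq_or_eq h1a haw.symm, by rintro (rfl | rfl) <;> assumption⟩
  have h2 : ∀ {x}, Inc g e₂ x ↔ x = w ∨ x = b := fun {x} =>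
    ⟨h2w.eq_or_eq h2b hbw.symm, by rintro (rfl | rfl) <;> assumption⟩
  have h2v : ¬ Inc g e₂ v := by rw [h2]; rintro (h | h); exacts [hwv h.symm, hbv h.symm]
  have hv₁ : Inc g' e₁ v ↔ Inc g e₁ v := by
    rw [hinc₁, h1]; simp [hwv.symm, hbv.symm]
  have hv : ∀ {e}, Inc g' e v ↔ Inc g e v := by
    intro e
    by_cases hee : e = e₁
    · rw [hee, hv₁]
    · exact hinc hee
  have hF : ∀ {e}, e ∈ F → Inc g e v → e ∈ F.erase e₂ := fun he h' =>
    Finset.mem_erase.2 ⟨fun h'' => h2v (h'' ▸ h'), he⟩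
  have hcr : ∀ {e x} (Z : Set V), Inc g e w → Inc g e x → x ≠ w →
      (Crosses g Z e ↔ ¬ (w ∈ Z ↔ x ∈ Z)) := by
    intro e x Z hew hex hxw
    simp only [Crosses]
    rcases hew with rfl | rfl <;> rcases hex with rfl | rfl <;> tauto
  refine ⟨fun e he hev => ?_, fun i Z hZ => ?_, fun hcond t ht htv i => ?_⟩
  · have := hF he hev
    rw [hcc (Finset.ne_of_mem_erase this)]
    exact h.agree e this (hv.2 hev)
  · by_contra! hno
    have hno2 : c e₁ = i → (w ∈ Z ↔ b ∈ Z) := by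
      intro hi
      by_contra h'
      exact hno e₂ he₂ (hc₂.trans hi) h2v ((hcr Z h2w h2b hbw).2 h')
    have hno1 : c e₁ = i → a ≠ v → (w ∈ Z ↔ a ∈ Z) := by
      intro hi hav
      by_contra h'
      refine hno e₁ he₁ ((hcc hne).trans hi) ?_ ((hcr Z h1w h1a haw).2 h')
      rw [h1]; rintro (h | h); exacts [hwv h.symm, hav h.symm]
    have hT : ∀ t ∈ Target g F v A π i, ∃ t' ∈ Target g' (F.erase e₂) v A π i,
        (t ∈ Z ↔ t' ∈ Z) := by
      rintro t ⟨htv, ht | ⟨e, he, hei, hev, het⟩⟩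
      · exact ⟨t, ⟨htv, Or.inl ht⟩, Iff.rfl⟩
      · by_cases hee : e = e₁
        · subst hee
          have hei' : c e = i := (h.agree e hm (hv.2 hev)).trans hei
          refine ⟨b, ⟨hbv, Or.inr ⟨e, hm, hei, hv.2 hev, hinc₁.2 (Or.inr rfl)⟩⟩, ?_⟩
          rcases h1.1 het with rfl | rfl
          · exact hno2 hei'
          · rcases h1.1 hev with h' | h'
            exacts [absurd h'.symm hwv, absurd h'.symm htv]
        · exact ⟨t, ⟨htv, Or.inr ⟨e, hF he hev, hei, hv.2 hev, (hinc hee).2 het⟩⟩, Iff.rfl⟩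
    have hZ' : Splits (Target g' (F.erase e₂) v A π i) Z := by
      obtain ⟨⟨x, hx, hxZ⟩, y, hy, hyZ⟩ := hZ
      obtain ⟨x', hx', hxx⟩ := hT x hx
      obtain ⟨y', hy', hyy⟩ := hT y hy
      exact ⟨⟨x', hx', hxx.1 hxZ⟩, y', hy', fun h => hyZ (hyy.2 h)⟩
    obtain ⟨e, he, hei, hev, hZe⟩ := h.conn i Z hZ'
    by_cases hee : e = e₁
    · subst hee
      have hav : a ≠ v := fun h' => hev (hinc₁.2 (Or.inl h'.symm))
      have : Crosses g' Z e ↔ ¬ (a ∈ Z ↔ b ∈ Z) := by simp [Crosses, hg']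
      exact (this.1 hZe) ((hno1 hei hav).symm.trans (hno2 hei))
    · refine hno e (Finset.mem_of_mem_erase he) ((hcc (Finset.ne_of_mem_erase he)).trans hei)
        (mt hv.2 hev) ?_
      simpa [Crosses, hg', hee] using hZe
  · refine (h.bal (hcond.imp_right fun hP i => (hP i).trans (Finset.card_le_card
      fun e he => ?_)) t ht htv i).trans ?_
    rotate_left
    · rw [Finset.mem_filter] at he ⊢
      exact ⟨hF he.1 he.2.1, hv.2 he.2.1, he.2.2⟩
    · refine Finset.card_le_card_of_injOn (fun e => if e = e₁ ∧ t = b then e₂ else e) ?_ ?_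
      · intro e he
        simp only [Finset.coe_filter, Finset.mem_erase, Set.mem_ofPred_eq] at he ⊢
        obtain ⟨⟨hne2, heF⟩, het, hei⟩ := he
        split_ifs with hif
        · obtain ⟨rfl, rfl⟩ := hif
          exact ⟨he₂, h2b, hc₂.trans hei⟩
        · refine ⟨heF, ?_, (hcc hne2).trans hei⟩
          by_cases hee : e = e₁
          · subst hee
            exact h1.2 (Or.inr ((hinc₁.1 het).resolve_right fun h' => hif ⟨rfl, h'⟩))
          · exact (hinc hee).1 het
      · intro e he e' he' hEq
        simp only [Finset.coe_filter, Finset.mem_erase, Set.mem_ofPred_eq] at he he' hEq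
        split_ifs at hEq with h3 h4 h4
        · exact h3.1.trans h4.1.symm
        · exact absurd hEq.symm he'.1.1
        · exact absurd hEq he.1.1
        · exact hEq

end Reductions

section SafePairs
open scoped Classical

variable {V E : Type*} {k : ℕ} {g : E → V × V} {F : Finset E} {U : Finset V} {v w t : V}
  {A B X Y Z : Set V} {α β : ℕ} {π : E → Fin k}

/-- `z` is a neighbour of `w`. -/
def Nbr (g : E → V × V) (F : Finset E) (w z : V) : Prop :=
  z ≠ w ∧ ∃ e ∈ F, Inc g e w ∧ Inc g e z

/-- An instance without nontrivial tight sets, and a vertex `w` all of whose neighbours are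
tight. -/
structure IsReducedAt (g : E → V × V) (F : Finset E) (U : Finset V) (v : V) (A B : Set V)
    (α β : ℕ) (π : E → Fin k) (w : V) : Prop extends IsInstance g F U v A B α β π where
  trivial_of_tight : ∀ X, 0 < req A B α β X → req A B α β X = cut g F X →
    (∀ y ∈ U, ∀ z ∈ U, y ∈ X → z ∈ X → y = z) ∨ ∀ y ∈ U, ∀ z ∈ U, y ∉ X → z ∉ X → y = z
  ne_one : β ≠ 1
  mem : w ∈ U
  notMem : w ∉ B
  nbr : ∀ z, Nbr g F w z → z ∈ B ∧ 0 < req A B α β {z} ∧ cut g F {z} = req A B α β {z}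

/-- The set `Z` obstructs splitting off at `w`. -/
def Dangerous (g : E → V × V) (F : Finset E) (U : Finset V) (A B : Set V) (α β : ℕ) (w t : V)
    (Z : Set V) : Prop :=
  Z ⊆ U ∧ w ∉ Z ∧ t ∈ Z ∧ (∃ b ∈ Z, b ≠ t) ∧ 0 < req A B α β Z ∧
    cut g F Z ≤ req A B α β Z + 1

theorem joins_singleton {z : V} (hz : z ≠ w) (hzZ : z ∈ Z) {e : E} (hw : Inc g e w)
    (hez : Inc g e z) : Joins g {w} Z e := by
  rcases hw with h | h <;> rcases hez with h' | h'
  · exact absurd (h'.symm.trans h) hz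
  · exact Or.inl ⟨h, h' ▸ hzZ⟩
  · exact Or.inr ⟨h' ▸ hzZ, h⟩
  · exact absurd (h'.symm.trans h) hz

theorem Joins.crosses (hw : w ∉ Z) {e : E} (h : Joins g {w} Z e) : Crosses g {w} e := by
  rw [crosses_iff]
  rcases h with ⟨h1, h2⟩ | ⟨h1, h2⟩
  · exact Or.inl ⟨h1, fun h => hw (Set.mem_singleton_iff.1 h ▸ h2)⟩
  · exact Or.inr ⟨fun h => hw (Set.mem_singleton_iff.1 h ▸ h1), h2⟩

theorem between_le_cut (hw : w ∉ Z) : between g F {w} Z ≤ cut g F {w} :=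
  Finset.card_le_card (Finset.monotone_filter_right _ fun _ _ h => h.crosses hw)

theorem exists_nbr_notMem (h : between g F {w} Z < cut g F {w}) : ∃ z, Nbr g F w z ∧ z ∉ Z := by
  by_contra! hno
  refine h.not_ge (Finset.card_le_card fun e he => ?_)
  rw [Finset.mem_filter] at he ⊢
  refine ⟨he.1, ?_⟩
  obtain ⟨a, b, ha, hb, hea, heb⟩ := crosses_iff_exists.1 he.2
  rw [Set.mem_singleton_iff] at ha hb
  subst ha
  exact joins_singleton hb (hno b ⟨hb, e, he.1, hea, heb⟩) hea heb

theorem between_pos_of_nbr {z : V} (h : Nbr g F w z) (hz : z ∈ Z) : 0 < between g F {w} Z := by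
  obtain ⟨hne, e, he, hew, hez⟩ := h
  exact between_pos he rfl hz hne.symm hew hez

theorem eq_of_between_eq_one (h : between g F X Y = 1) {e e' : E} (he : e ∈ F) (he' : e' ∈ F)
    (hj : Joins g X Y e) (hj' : Joins g X Y e') : e = e' :=
  Finset.card_le_one.1 h.le e (Finset.mem_filter.2 ⟨he, hj⟩) e' (Finset.mem_filter.2 ⟨he', hj'⟩)

theorem joins_of_inc {e : E} {a b : V} (ha : a ∈ X) (hb : b ∈ Y) (hab : a ≠ b) (hea : Inc g e a)
    (heb : Inc g e b) : Joins g X Y e := by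
  rcases hea with rfl | rfl <;> rcases heb with rfl | rfl
  exacts [absurd rfl hab, Or.inl ⟨ha, hb⟩, Or.inr ⟨hb, ha⟩, absurd rfl hab]

theorem mem_of_req_singleton_pos (hAB : A ⊆ B) (h : 0 < req A B α β {t}) : t ∈ B := by
  obtain ⟨b, hb, rfl⟩ := (req_pos hAB h).1
  exact hb

theorem two_le_req (h : IsInstance g F U v A B α β π) (hβ : β ≠ 1) {s s' : V}
    (hs : 0 < req A B α β {s}) (hs' : 0 < req A B α β {s'}) (hsZ : s ∈ Z) (hsZ' : s' ∉ Z) :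
    2 ≤ req A B α β Z := by
  have hB := mem_of_req_singleton_pos h.subset hs
  have hB' := mem_of_req_singleton_pos h.subset hs'
  have hk := h.pos
  by_cases h0 : β = 0
  · subst h0
    have hA : ∀ {s}, 0 < req A B α 0 {s} → s ∈ A := by
      intro s hs
      by_contra hsA
      rw [req, if_neg, ite_self] at hs
      · exact lt_irrefl _ hs
      · rintro ⟨⟨a, ha, rfl⟩, -⟩
        exact hsA ha
    rw [req_of_splits ⟨⟨s, hA hs, hsZ⟩, s', hA hs', hsZ'⟩]
    rcases h.kind with h' | h'
    · omega
    · omega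
  · have := le_req_of_splits (A := A) h.le (Z := Z) ⟨⟨s, hB, hsZ⟩, s', hB', hsZ'⟩
    omega

theorem IsReducedAt.req_insert (h : IsReducedAt g F U v A B α β π w) :
    req A B α β (insert w Z) = req A B α β Z :=
  req_congr h.subset fun a ha => by
    have : a ≠ w := fun h' => h.notMem (h' ▸ ha)
    simp [this]

theorem IsReducedAt.two_mul_between_singleton_le (h : IsReducedAt g F U v A B α β π w) {z : V}
    (hz : Nbr g F w z) : 2 * between g F {w} {z} ≤ cut g F {w} := by
  have h1 := cut_insert (g := g) (F := F) (X := {z}) (w := w) (fun h' => hz.1 h'.symm)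
  have h2 := h.cuts (insert w {z})
  rw [h.req_insert] at h2
  have := (h.nbr z hz).2.2
  omega

theorem IsReducedAt.cut_eq (h : IsReducedAt g F U v A B α β π w)
    (hZ : Dangerous g F U A B α β w t Z) : cut g F Z = req A B α β Z + 1 := by
  obtain ⟨hU, hw, ht, ⟨b, hb, hbt⟩, hpos, hcut⟩ := hZ
  have h1 := h.cuts Z
  by_contra hne
  rcases h.trivial_of_tight Z hpos (by omega) with h2 | h2
  · exact hbt (h2 b (hU hb) t (hU ht) hb ht)
  · obtain ⟨-, x, hx, hxZ⟩ := req_pos h.subset hpos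
    exact h.notMem (h2 x (h.verts x hx) w h.mem hxZ hw ▸ hx)

theorem IsReducedAt.two_mul_between_le (h : IsReducedAt g F U v A B α β π w)
    (hZ : Dangerous g F U A B α β w t Z) : 2 * between g F {w} Z ≤ cut g F {w} + 1 ∧
      (2 * between g F {w} Z = cut g F {w} + 1 →
        ∀ y ∈ U, ∀ z ∈ U, y ≠ w → z ≠ w → y ∉ Z → z ∉ Z → y = z) := by
  have h0 := h.cut_eq hZ
  obtain ⟨hU, hw, ht, ⟨b, hb, hbt⟩, hpos, hcut⟩ := hZ
  have h1 := cut_insert (g := g) (F := F) hw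
  have h2 := h.cuts (insert w Z)
  rw [h.req_insert] at h2
  refine ⟨by omega, fun heq => ?_⟩
  rcases h.trivial_of_tight (insert w Z) (by rwa [h.req_insert])
    (by rw [h.req_insert]; omega) with h3 | h3
  · exact absurd (h3 b (hU hb) t (hU ht) (Or.inr hb) (Or.inr ht)) hbt
  · intro y hy z hz hyw hzw hyZ hzZ
    exact h3 y hy z hz (by simp [hyw, hyZ]) (by simp [hzw, hzZ])

/-- The two possible ways in which two maximal dangerous sets meet. -/
theorem IsReducedAt.dangerous_pair (h : IsReducedAt g F U v A B α β π w) (ht : Nbr g F w t)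
    (hX : Maximal (Dangerous g F U A B α β w t) X) (hY : Maximal (Dangerous g F U A B α β w t) Y)
    (hXY : X ≠ Y) :
    (∀ z, Nbr g F w z → z ∈ X → z ∈ Y → z = t) ∧
      (X ∩ Y = {t} ∨ (∃ x, X \ Y = {x}) ∧ (∃ y, Y \ X = {y}) ∧
        between g F (X ∩ Y) (X ∪ Y)ᶜ = 1) := by
  have hXc := h.cut_eq hX.prop
  have hYc := h.cut_eq hY.prop
  obtain ⟨hXU, hXw, hXt, ⟨b, hb, hbt⟩, hXp, -⟩ := hX.prop
  obtain ⟨hYU, hYw, hYt, -, hYp, -⟩ := hY.prop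
  rcases req_skew h.subset X Y hXp hYp with ⟨hs, hp, hp'⟩ | ⟨hs, hp, hp'⟩
  · have h1 := cut_inter_add_cut_union (g := g) (F := F) X Y
    have h2 := h.cuts (X ∩ Y)
    have h3 : req A B α β (X ∪ Y) + 2 ≤ cut g F (X ∪ Y) := by
      by_contra h3
      have hd : Dangerous g F U A B α β w t (X ∪ Y) := ⟨Set.union_subset hXU hYU,
        fun h => h.elim hXw hYw, Or.inl hXt, ⟨b, Or.inl hb, hbt⟩, hp', by omega⟩
      exact hXY ((hX.eq_of_subset hd Set.subset_union_left).trans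
        (hY.eq_of_subset hd Set.subset_union_right).symm)
    have hI : X ∩ Y = {t} := by
      rcases h.trivial_of_tight _ hp (by omega) with h4 | h4
      · refine Set.eq_singleton_iff_unique_mem.2 ⟨⟨hXt, hYt⟩, fun y hy => ?_⟩
        exact h4 y (hXU hy.1) t (hXU hXt) hy ⟨hXt, hYt⟩
      · exfalso
        refine hXY (Set.Subset.antisymm (fun y hy => ?_) fun y hy => ?_)
        · by_contra hyY
          exact hXw (h4 y (hXU hy) w h.mem (fun h => hyY h.2) (fun h => hXw h.1) ▸ hy)
        · by_contra hyX
          exact hYw (h4 y (hYU hy) w h.mem (fun h => hyX h.1) (fun h => hXw h.1) ▸ hy)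
    refine ⟨fun z _ hzX hzY => ?_, Or.inl hI⟩
    have : z ∈ X ∩ Y := ⟨hzX, hzY⟩
    rwa [hI] at this
  · have h1 := cut_sdiff_add_cut_sdiff (g := g) (F := F) X Y
    have h2 := h.cuts (X \ Y)
    have h3 := h.cuts (Y \ X)
    have hwc : w ∈ (X ∪ Y)ᶜ := fun h => h.elim hXw hYw
    obtain ⟨htw, e, he, hew, het⟩ := ht
    have h4 : 0 < between g F (X ∩ Y) (X ∪ Y)ᶜ :=
      between_pos he ⟨hXt, hYt⟩ hwc htw het hew
    have hone : between g F (X ∩ Y) (X ∪ Y)ᶜ = 1 := by omega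
    have hsing : ∀ {C : Set V}, C ⊆ U → w ∉ C → t ∉ C → 0 < req A B α β C →
        req A B α β C = cut g F C → ∃ x, C = {x} := by
      intro C hCU hwC htC hpC hC
      obtain ⟨⟨x, -, hx⟩, -⟩ := req_pos h.subset hpC
      rcases h.trivial_of_tight _ hpC hC with h4 | h4
      · exact ⟨x, Set.eq_singleton_iff_unique_mem.2 ⟨hx, fun y hy =>
          h4 y (hCU hy) x (hCU hx) hy hx⟩⟩
      · exact absurd (h4 t (hXU hXt) w h.mem htC hwC) htw
    refine ⟨fun z hz hzX hzY => ?_, Or.inr ⟨?_, ?_, hone⟩⟩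
    · obtain ⟨hzw, e', he', hew', hez⟩ := hz
      have : e = e' := eq_of_between_eq_one hone he he'
        (joins_of_inc ⟨hXt, hYt⟩ hwc htw het hew) (joins_of_inc ⟨hzX, hzY⟩ hwc hzw hez hew')
      subst this
      exact (hew.eq_or_eq het htw.symm hez).resolve_left hzw
    · exact hsing (Set.sdiff_subset.trans hXU) (fun h => hXw h.1) (fun h => h.2 hYt) hp
        (by omega)
    · exact hsing (Set.sdiff_subset.trans hYU) (fun h => hYw h.1) (fun h => h.2 hXt) hp'
        (by omega)

variable {x y z : V}

theorem IsReducedAt.not_mixed (h : IsReducedAt g F U v A B α β π w) (ht : Nbr g F w t)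
    (hXt : t ∈ X) (hYt : t ∈ Y) (hXw : w ∉ X) (hYw : w ∉ Y)
    (hYX : Y \ X = {y}) (hone : between g F (X ∩ Y) (X ∪ Y)ᶜ = 1)
    (hXZ : X ∩ Z = {t}) (hyZ : y ∉ Z) (hZ : Dangerous g F U A B α β w t Z)
    (hz : Nbr g F w z) (hzZ : z ∈ Z) (hzt : z ≠ t) : False := by
  have hZc := h.cut_eq hZ
  obtain ⟨hZU, hZw, hZt, -, hZp, -⟩ := hZ
  have hwc : w ∈ (X ∪ Y)ᶜ := fun h => h.elim hXw hYw
  have hZ' : insert t (Z \ {t}) = Z := by simp [hZt]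
  have ht' : t ∉ Z \ {t} := fun h => h.2 rfl
  have h0 : between g F {t} (Z \ {t}) = 0 := by
    by_contra hne
    obtain ⟨e, he⟩ := Finset.card_pos.1 (Nat.pos_of_ne_zero hne)
    rw [Finset.mem_filter] at he
    obtain ⟨u, huZ, hut, het, heu⟩ : ∃ u ∈ Z, u ≠ t ∧ Inc g e t ∧ Inc g e u := by
      rcases he.2 with ⟨h1, h2⟩ | ⟨h1, h2⟩
      · exact ⟨_, h2.1, h2.2, Or.inl h1, Or.inr rfl⟩
      · exact ⟨_, h1.1, h1.2, Or.inr h2, Or.inl rfl⟩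
    have huX : u ∉ X := fun huX => hut ((Set.ext_iff.1 hXZ u).1 ⟨huX, huZ⟩)
    have huY : u ∉ Y := fun huY => hyZ ((Set.ext_iff.1 hYX u).1 ⟨huY, huX⟩ ▸ huZ)
    obtain ⟨htw, e', he', hew', het'⟩ := ht
    have : e = e' := eq_of_between_eq_one hone he.1 he'
      (joins_of_inc ⟨hXt, hYt⟩ (fun h => h.elim huX huY) hut.symm het heu)
      (joins_of_inc ⟨hXt, hYt⟩ hwc htw het' hew')
    subst this
    exact ((hew'.eq_or_eq het htw.symm heu).resolve_right hut ▸ hZw) huZ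
  have h1 := cut_insert (g := g) (F := F) ht'
  rw [hZ', h0] at h1
  have h2 := h.cuts (Z \ {t})
  have h3 := h.cuts {t}
  have hk := h.pos
  have hzZ' : z ∈ Z \ {t} := ⟨hzZ, hzt⟩
  have htp := (h.nbr t ht).2.1
  have hzp := (h.nbr z hz).2.1
  have htB := (h.nbr t ht).1
  have hzB := (h.nbr z hz).1
  have h4 := two_le_req h.toIsInstance h.ne_one hzp htp hzZ' ht'
  have h5 := two_le_req (Z := {t}) h.toIsInstance h.ne_one htp hzp rfl hzt
  by_cases hs : Splits A Z
  · rw [req_of_splits hs] at hZc hZp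
    obtain ⟨⟨a, ha, haZ⟩, a', ha', haZ'⟩ := hs
    by_cases hat : a = t
    · have : req A B α β {t} = α := req_of_splits ⟨⟨a, ha, hat⟩, a', ha', fun h =>
        haZ' (Set.mem_singleton_iff.1 h ▸ hZt)⟩
      omega
    · have : req A B α β (Z \ {t}) = α := req_of_splits ⟨⟨a, ha, haZ, hat⟩, a', ha', fun h =>
        haZ' h.1⟩
      omega
  · have h6 := req_pos h.subset hZp
    have h7 : req A B α β Z = β := by rw [req, if_neg hs, if_pos h6]
    have h8 := h.ne_one
    have h9 := le_req_of_splits (A := A) h.le (Z := Z \ {t})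
      ⟨⟨z, hzB, hzZ'⟩, t, htB, ht'⟩
    have h10 := le_req_of_splits (A := A) h.le (Z := {t}) ⟨⟨t, htB, rfl⟩, z, hzB, hzt⟩
    omega

theorem IsReducedAt.not_all_sunflower (h : IsReducedAt g F U v A B α β π w) (ht : Nbr g F w t)
    (htv : t ≠ v) (hXY : X ∩ Y = {t}) (hXZ : X ∩ Z = {t}) (hYZ : Y ∩ Z = {t})
    (hX : Dangerous g F U A B α β w t X) (hY : Dangerous g F U A B α β w t Y)
    (hZ : Dangerous g F U A B α β w t Z)
    (hx : Nbr g F w x) (hy : Nbr g F w y) (hz : Nbr g F w z) (hxX : x ∈ X) (hyY : y ∈ Y)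
    (hzZ : z ∈ Z) (hxt : x ≠ t) (hyt : y ≠ t) (hzt : z ≠ t) : False := by
  have htp := (h.nbr t ht).2.1
  have htB := (h.nbr t ht).1
  have hk := h.pos
  have key : ∀ {X x}, Dangerous g F U A B α β w t X → Nbr g F w x → x ∈ X → x ≠ t →
      req A B α β (X \ {t}) + cut g F {t} ≤
        req A B α β X + 1 + 2 * between g F {t} (X \ {t}) ∧
      req A B α β X ≤ α ∧ 2 ≤ req A B α β (X \ {t}) ∧ β ≤ req A B α β (X \ {t}) ∧
      (x ∈ A → t ∈ A → req A B α β (X \ {t}) = α ∧ req A B α β {t} = α) := by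
    intro X x hX hx hxX hxt
    have h1 := cut_insert (g := g) (F := F) (X := X \ {t}) (w := t) (fun h => h.2 rfl)
    have h2 : insert t (X \ {t}) = X := by simp [hX.2.2.1]
    have h3 := h.cuts (X \ {t})
    have h4 := h.cut_eq hX
    rw [h2] at h1
    refine ⟨by omega, req_le h.le, two_le_req h.toIsInstance h.ne_one (h.nbr x hx).2.1 htp
      ⟨hxX, hxt⟩ (fun h => h.2 rfl), le_req_of_splits h.le
        ⟨⟨x, (h.nbr x hx).1, hxX, hxt⟩, t, htB, fun h => h.2 rfl⟩, fun hxA htA => ⟨?_, ?_⟩⟩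
    · exact req_of_splits ⟨⟨x, hxA, hxX, hxt⟩, t, htA, fun h => h.2 rfl⟩
    · exact req_of_splits ⟨⟨t, htA, rfl⟩, x, hxA, hxt⟩
  have hsum : between g F {t} (X \ {t}) + between g F {t} (Y \ {t}) + between g F {t} (Z \ {t}) + 1
      ≤ cut g F {t} := by
    have hn : ∀ C : Set V, t ∉ C \ {t} := fun C h => h.2 rfl
    have h1 := between_union_add_between_inter (g := g) (F := F) (hn X) (hn Y)
    have h2 := between_union_add_between_inter (g := g) (F := F) (w := t)
      (X := X \ {t} ∪ Y \ {t}) (fun h => h.elim (hn X) (hn Y)) (hn Z)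
    have h3 := between_union_add_between_inter (g := g) (F := F) (w := t)
      (X := X \ {t} ∪ Y \ {t} ∪ Z \ {t}) (Y := {w})
      (fun h => h.elim (fun h => h.elim (hn X) (hn Y)) (hn Z)) ht.1
    have h4 : 0 < between g F {t} {w} :=
      between_pos_of_nbr ⟨ht.1.symm, ht.2.imp fun e he => ⟨he.1, he.2.2, he.2.1⟩⟩ rfl
    have h5 : between g F {t} (X \ {t} ∪ Y \ {t} ∪ Z \ {t} ∪ {w}) ≤ cut g F {t} :=
      between_le_cut fun h => h.elim (fun h => h.elim (fun h => h.elim (hn X) (hn Y)) (hn Z)) ht.1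
    have hempty : ∀ C : Set V, C = ∅ → between g F {t} C = 0 := by
      rintro _ rfl
      simp [between, Joins]
    have h6 := hempty ((X \ {t}) ∩ (Y \ {t})) (by
      ext u
      have := Set.ext_iff.1 hXY u
      simp only [Set.mem_inter_iff, Set.mem_sdiff, Set.mem_singleton_iff,
        Set.mem_empty_iff_false] at this ⊢
      tauto)
    have h7 := hempty ((X \ {t} ∪ Y \ {t}) ∩ (Z \ {t})) (by
      ext u
      have h1 := Set.ext_iff.1 hXZ u
      have h2 := Set.ext_iff.1 hYZ u
      simp only [Set.mem_inter_iff, Set.mem_sdiff, Set.mem_singleton_iff,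
        Set.mem_empty_iff_false, Set.mem_union] at h1 h2 ⊢
      tauto)
    have h8 := hempty ((X \ {t} ∪ Y \ {t} ∪ Z \ {t}) ∩ {w}) (by
      ext u
      simp only [Set.mem_inter_iff, Set.mem_sdiff, Set.mem_singleton_iff,
        Set.mem_empty_iff_false, Set.mem_union]
      have := hX.2.1
      have := hY.2.1
      have := hZ.2.1
      grind)
    omega
  obtain ⟨a1, a2, a3, a4, a5⟩ := key hX hx hxX hxt
  obtain ⟨b1, b2, b3, b4, b5⟩ := key hY hy hyY hyt
  obtain ⟨c1, c2, c3, c4, c5⟩ := key hZ hz hzZ hzt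
  have ht1 := (h.nbr t ht).2.2
  rcases h.kind with ⟨-, -, h3, h4, -⟩ | ⟨-, -, h3, h4⟩
  · have : β ≤ req A B α β {t} := le_req_of_splits h.le
      ⟨⟨t, htB, rfl⟩, x, (h.nbr x hx).1, hxt⟩
    omega
  · have hA : ∀ {x}, x ∈ B → x ≠ v → x ∈ A := fun {x} hx hxv => by
      rw [h3] at hx
      exact hx.resolve_left hxv
    have htA := hA htB htv
    have a6 := fun hxv => a5 (hA (h.nbr x hx).1 hxv) htA
    have b6 := fun hyv => b5 (hA (h.nbr y hy).1 hyv) htA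
    have c6 := fun hzv => c5 (hA (h.nbr z hz).1 hzv) htA
    have hxy : x ≠ y := fun h' => hxt ((Set.ext_iff.1 hXY x).1 ⟨hxX, h' ▸ hyY⟩)
    have hxz : x ≠ z := fun h' => hxt ((Set.ext_iff.1 hXZ x).1 ⟨hxX, h' ▸ hzZ⟩)
    have hyz : y ≠ z := fun h' => hyt ((Set.ext_iff.1 hYZ y).1 ⟨hyY, h' ▸ hzZ⟩)
    by_cases hxv : x = v
    · have := b6 fun h => hxy (hxv.trans h.symm)
      have := c6 fun h => hxz (hxv.trans h.symm)
      omega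
    · have := a6 hxv
      by_cases hyv : y = v
      · have := c6 fun h => hyz (hyv.trans h.symm)
        omega
      · have := b6 hyv
        omega

theorem IsReducedAt.not_all_core (h : IsReducedAt g F U v A B α β π w) (ht : Nbr g F w t)
    (hXt : t ∈ X) (hYt : t ∈ Y) (hZt : t ∈ Z) (hXw : w ∉ X) (hYw : w ∉ Y) (hZw : w ∉ Z)
    (hX : X \ Y = {x}) (hY : Y \ X = {y}) (hX' : X \ Z = {x}) (hY' : Y \ Z = {y})
    (h12 : between g F (X ∩ Y) (X ∪ Y)ᶜ = 1) (h13 : between g F (X ∩ Z) (X ∪ Z)ᶜ = 1)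
    (h23 : between g F (Y ∩ Z) (Y ∪ Z)ᶜ = 1) (hx : Nbr g F w x) : False := by
  have h2 : 2 ≤ req A B α β (X ∩ Y) := two_le_req h.toIsInstance h.ne_one (h.nbr t ht).2.1
    (h.nbr x hx).2.1 ⟨hXt, hYt⟩ fun h' => ((Set.ext_iff.1 hX x).2 rfl).2 h'.2
  obtain ⟨htw, e, he, hew, het⟩ := ht
  have h1 : cut g F (X ∩ Y) ≤ 1 := by
    refine (Finset.card_le_card (t := {e}) fun e' he' => ?_).trans (Finset.card_singleton e).le
    rw [Finset.mem_filter] at he'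
    obtain ⟨a, b, ha, hb, hea, heb⟩ := crosses_iff_exists.1 he'.2
    rw [Finset.mem_singleton]
    have hab : a ≠ b := fun h => hb (h ▸ ha)
    have haZ : a ∈ Z := by
      by_contra haZ
      have : a = x := (Set.ext_iff.1 hX' a).1 ⟨ha.1, haZ⟩
      exact ((Set.ext_iff.1 hX a).2 this).2 ha.2
    by_cases hbX : b ∈ X
    · have hbY : b ∉ Y := fun h => hb ⟨hbX, h⟩
      have hbZ : b ∉ Z := ((Set.ext_iff.1 hX' b).2 ((Set.ext_iff.1 hX b).1 ⟨hbX, hbY⟩)).2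
      exact eq_of_between_eq_one h23 he'.1 he
        (joins_of_inc ⟨ha.2, haZ⟩ (fun h => h.elim hbY hbZ) hab hea heb)
        (joins_of_inc ⟨hYt, hZt⟩ (fun h => h.elim hYw hZw) htw het hew)
    · by_cases hbY : b ∈ Y
      · have hbZ : b ∉ Z := ((Set.ext_iff.1 hY' b).2 ((Set.ext_iff.1 hY b).1 ⟨hbY, hbX⟩)).2
        exact eq_of_between_eq_one h13 he'.1 he
          (joins_of_inc ⟨ha.1, haZ⟩ (fun h => h.elim hbX hbZ) hab hea heb)
          (joins_of_inc ⟨hXt, hZt⟩ (fun h => h.elim hXw hZw) htw het hew)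
      · exact eq_of_between_eq_one h12 he'.1 he
          (joins_of_inc ha (fun h => h.elim hbX hbY) hab hea heb)
          (joins_of_inc ⟨hXt, hYt⟩ (fun h => h.elim hXw hYw) htw het hew)
  have := h.cuts (X ∩ Y)
  omega

theorem IsReducedAt.not_three_maximal (h : IsReducedAt g F U v A B α β π w) (ht : Nbr g F w t)
    (htv : t ≠ v) (hX : Maximal (Dangerous g F U A B α β w t) X)
    (hY : Maximal (Dangerous g F U A B α β w t) Y) (hZ : Maximal (Dangerous g F U A B α β w t) Z)
    (hXY : X ≠ Y) (hXZ : X ≠ Z) (hYZ : Y ≠ Z)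
    (hx : Nbr g F w x) (hy : Nbr g F w y) (hz : Nbr g F w z) (hxX : x ∈ X) (hyY : y ∈ Y)
    (hzZ : z ∈ Z) (hxt : x ≠ t) (hyt : y ≠ t) (hzt : z ≠ t) : False := by
  have key : ∀ {X Y x y}, Maximal (Dangerous g F U A B α β w t) X →
      Maximal (Dangerous g F U A B α β w t) Y → X ≠ Y → Nbr g F w x → Nbr g F w y →
      x ∈ X → y ∈ Y → x ≠ t → y ≠ t → x ∉ Y ∧ y ∉ X ∧ (X ∩ Y = {t} ∨
        (X \ Y = {x} ∧ Y \ X = {y} ∧ between g F (X ∩ Y) (X ∪ Y)ᶜ = 1)) := by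
    intro X Y x y hX hY hXY hx hy hxX hyY hxt hyt
    obtain ⟨h1, h2⟩ := h.dangerous_pair ht hX hY hXY
    have hxY : x ∉ Y := fun hxY => hxt (h1 x hx hxX hxY)
    have hyX : y ∉ X := fun hyX => hyt (h1 y hy hyX hyY)
    refine ⟨hxY, hyX, h2.imp_right ?_⟩
    rintro ⟨⟨x', hx'⟩, ⟨y', hy'⟩, hone⟩
    have h3 : x = x' := (Set.ext_iff.1 hx' x).1 ⟨hxX, hxY⟩
    have h4 : y = y' := (Set.ext_iff.1 hy' y).1 ⟨hyY, hyX⟩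
    exact ⟨h3 ▸ hx', h4 ▸ hy', hone⟩
  obtain ⟨hxY, hyX, h12⟩ := key hX hY hXY hx hy hxX hyY hxt hyt
  obtain ⟨hxZ, hzX, h13⟩ := key hX hZ hXZ hx hz hxX hzZ hxt hzt
  obtain ⟨hyZ, hzY, h23⟩ := key hY hZ hYZ hy hz hyY hzZ hyt hzt
  obtain ⟨-, hXw, hXt, -⟩ := hX.prop
  obtain ⟨-, hYw, hYt, -⟩ := hY.prop
  obtain ⟨-, hZw, hZt, -⟩ := hZ.prop
  have hcomm : ∀ {X Y : Set V} {x y}, (X \ Y = {x} ∧ Y \ X = {y} ∧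
      between g F (X ∩ Y) (X ∪ Y)ᶜ = 1) → Y \ X = {y} ∧ X \ Y = {x} ∧
      between g F (Y ∩ X) (Y ∪ X)ᶜ = 1 := by
    rintro X Y x y ⟨h1, h2, h3⟩
    exact ⟨h2, h1, by rwa [Set.inter_comm, Set.union_comm]⟩
  have mixed : ∀ {X Y Z x y z}, t ∈ X → t ∈ Y → w ∉ X → w ∉ Y → (X \ Y = {x} ∧ Y \ X = {y} ∧
      between g F (X ∩ Y) (X ∪ Y)ᶜ = 1) → X ∩ Z = {t} → y ∉ Z → Nbr g F w z → z ∈ Z → z ≠ t →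
      Dangerous g F U A B α β w t Z → False :=
    fun hXt hYt hXw hYw h12 hXZ hyZ hz hzZ hzt hZ =>
      h.not_mixed ht hXt hYt hXw hYw h12.2.1 h12.2.2 hXZ hyZ hZ hz hzZ hzt
  rcases h12 with h12 | h12
  · rcases h13 with h13 | h13
    · rcases h23 with h23 | h23
      · exact h.not_all_sunflower ht htv h12 h13 h23 hX.prop hY.prop hZ.prop hx hy hz hxX hyY hzZ
          hxt hyt hzt
      · exact mixed hYt hZt hYw hZw h23 ((Set.inter_comm _ _).trans h12) hzX hx hxX hxt hX.prop
    · exact mixed hXt hZt hXw hZw h13 h12 hzY hy hyY hyt hY.prop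
  · rcases h13 with h13 | h13
    · exact mixed hXt hYt hXw hYw h12 h13 hyZ hz hzZ hzt hZ.prop
    · rcases h23 with h23 | h23
      · exact mixed hYt hXt hYw hXw (hcomm h12) h23 hxZ hz hzZ hzt hZ.prop
      · exact h.not_all_core ht hXt hYt hZt hXw hYw hZw h12.1 h12.2.1 h13.1 h23.1 h12.2.2 h13.2.2
          h23.2.2 hx

/-- A vertex outside `B` of positive degree other than three has a splitting preserving all
requirements. -/
theorem IsReducedAt.exists_safe_pair [Finite V] (h : IsReducedAt g F U v A B α β π w)
    (hpos : 0 < cut g F {w}) (h3 : cut g F {w} ≠ 3) :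
    ∃ a b, Nbr g F w a ∧ Nbr g F w b ∧ a ≠ b ∧ b ≠ v ∧ ∀ Z, w ∉ Z → a ∈ Z → b ∈ Z →
      0 < req A B α β Z → req A B α β Z + 2 ≤ cut g F Z := by
  by_contra! hno
  have hU : ∀ {z}, Nbr g F w z → z ∈ U := fun hz => h.verts _ (h.nbr _ hz).1
  have hD : ∀ a b, Nbr g F w a → Nbr g F w b → a ≠ b →
      ∃ Z, Dangerous g F U A B α β w a Z ∧ b ∈ Z := by
    intro a b ha hb hab
    obtain ⟨Z, hwZ, haZ, hbZ, hp, hc⟩ : ∃ Z, w ∉ Z ∧ a ∈ Z ∧ b ∈ Z ∧ 0 < req A B α β Z ∧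
        cut g F Z < req A B α β Z + 2 := by
      by_cases hbv : b = v
      · obtain ⟨Z, h1, h2, h3, h4⟩ := hno b a hb ha hab.symm (fun h => hab (h.trans hbv.symm))
        exact ⟨Z, h1, h3, h2, h4⟩
      · exact hno a b ha hb hab hbv
    have h1 : cut g F (Z ∩ U) = cut g F Z := cut_congr fun e he => by simp [h.ends e he]
    have h2 : req A B α β (Z ∩ U) = req A B α β Z :=
      req_congr h.subset fun x hx => by simp [h.verts x hx]
    refine ⟨Z ∩ U, ⟨Set.inter_subset_right, fun h => hwZ h.1, ⟨haZ, hU ha⟩,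
      ⟨b, ⟨hbZ, hU hb⟩, hab.symm⟩, by rwa [h2], ?_⟩, hbZ, hU hb⟩
    rw [h1, h2]
    omega
  have hmax : ∀ {t Z}, Dangerous g F U A B α β w t Z →
      ∃ X, Z ⊆ X ∧ Maximal (Dangerous g F U A B α β w t) X := fun {t Z} hZ =>
    (Set.toFinite {X | Dangerous g F U A B α β w t X}).exists_le_maximal hZ
  have hall : ∀ {Z : Set V}, (∀ z, Nbr g F w z → z ∈ Z) → cut g F {w} ≤ between g F {w} Z := by
    intro Z hZ
    by_contra hlt
    obtain ⟨z, hz, hzZ⟩ := exists_nbr_notMem (not_le.1 hlt)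
    exact hzZ (hZ z hz)
  obtain ⟨t, ht, htv⟩ : ∃ t, Nbr g F w t ∧ t ∉ ({v} : Set V) := by
    by_cases hvn : Nbr g F w v
    · exact exists_nbr_notMem (by have := h.two_mul_between_singleton_le hvn; omega)
    · have : between g F {w} ∅ < cut g F {w} := by
        have h0 : between g F {w} ∅ = 0 := Finset.card_eq_zero.2 <|
          Finset.filter_eq_empty_iff.2 fun e _ h => by
            rcases h with ⟨_, h⟩ | ⟨h, _⟩ <;> exact h
        rwa [h0]
      obtain ⟨t, ht, -⟩ := exists_nbr_notMem this
      exact ⟨t, ht, fun h => hvn (h ▸ ht)⟩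
  have ht1 := h.two_mul_between_singleton_le ht
  have ht2 : 0 < between g F {w} {t} := between_pos_of_nbr ht rfl
  obtain ⟨b, hb, hbt⟩ := exists_nbr_notMem (Z := {t}) (w := w) (g := g) (F := F) (by omega)
  obtain ⟨Z, hZ, hbZ⟩ := hD t b ht hb (fun h => hbt h.symm)
  have hZ2 : 2 ≤ between g F {w} Z := by
    have h1 := between_union_add_between_inter (g := g) (F := F) (w := w) (X := {t}) (Y := {b})
      ht.1.symm hb.1.symm
    have h2 : between g F {w} {b} > 0 := between_pos_of_nbr hb rfl
    have h3 : between g F {w} ({t} ∩ {b}) = 0 := by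
      rw [Set.singleton_inter_eq_empty.2 fun h => hbt h.symm]
      simp [between, Joins]
    have h4 : between g F {w} ({t} ∪ {b}) ≤ between g F {w} Z :=
      between_mono le_rfl (Set.union_subset (Set.singleton_subset_iff.2 hZ.2.2.1)
        (Set.singleton_subset_iff.2 hbZ))
    omega
  have hZ3 := (h.two_mul_between_le hZ).1
  obtain ⟨X, hZX, hX⟩ := hmax hZ
  have hX1 := h.two_mul_between_le hX.prop
  obtain ⟨c, hc, hcX⟩ := exists_nbr_notMem (Z := X) (w := w) (g := g) (F := F) (by omega)
  have hct : c ≠ t := fun h => hcX (h ▸ hX.prop.2.2.1)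
  obtain ⟨Z', hZ', hcZ'⟩ := hD t c ht hc hct.symm
  obtain ⟨Y, hZY, hY⟩ := hmax hZ'
  have hXY : X ≠ Y := fun h => hcX (h ▸ hZY hcZ')
  have hY1 := h.two_mul_between_le hY.prop
  by_cases he : ∃ e, Nbr g F w e ∧ e ∉ X ∧ e ∉ Y
  · obtain ⟨e, he, heX, heY⟩ := he
    have het : e ≠ t := fun h => heX (h ▸ hX.prop.2.2.1)
    obtain ⟨Z'', hZ'', heZ''⟩ := hD t e ht he het.symm
    obtain ⟨W, hZW, hW⟩ := hmax hZ''
    exact h.not_three_maximal ht htv hX hY hW hXY (fun h => heX (h ▸ hZW heZ''))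
      (fun h => heY (h ▸ hZW heZ'')) hb hc he (hZX hbZ) (hZY hcZ') (hZW heZ'') hbt hct het
  · push Not at he
    have h1 := hall (Z := X ∪ Y) fun z hz => by
      by_cases hzX : z ∈ X
      exacts [Or.inl hzX, Or.inr (he z hz hzX)]
    have h2 := between_union_add_between_inter (g := g) (F := F) hX.prop.2.1 hY.prop.2.1
    have h4 : 0 < between g F {w} (X ∩ Y) :=
      between_pos_of_nbr ht ⟨hX.prop.2.2.1, hY.prop.2.2.1⟩
    obtain ⟨d, hd, hdY⟩ := exists_nbr_notMem (Z := Y) (w := w) (g := g) (F := F) (by omega)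
    have hdX : d ∈ X := by
      by_contra hdX
      exact hdY (he d hd hdX)
    obtain ⟨W, hW, hcW⟩ := hD d c hd hc (fun h => hcX (h ▸ hdX))
    have hW1 := (h.two_mul_between_le hW).1
    have h5 := hall (Z := W ∪ (X ∩ Y)) fun z hz => by
      by_cases hzX : z ∈ X
      · by_cases hzY : z ∈ Y
        · exact Or.inr ⟨hzX, hzY⟩
        · exact Or.inl (hY1.2 (by omega) z (hU hz) d (hU hd) hz.1 hd.1 hzY hdY ▸ hW.2.2.1)
      · exact Or.inl (hX1.2 (by omega) z (hU hz) c (hU hc) hz.1 hc.1 hzX hcX ▸ hcW)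
    have h6 := between_union_add_between_inter (g := g) (F := F) (Y := X ∩ Y) hW.2.1
      (fun h => hX.prop.2.1 h.1)
    omega

end SafePairs

section Terminal
open scoped Classical

variable {V E : Type*} {k : ℕ} {g : E → V × V} {F : Finset E} {U : Finset V} {v : V}
  {A B : Set V} {α β : ℕ} {π : E → Fin k}

/-- An instance to which none of the reductions applies. -/
structure IsTerminal (g : E → V × V) (F : Finset E) (U : Finset V) (v : V) (A B : Set V)
    (α β : ℕ) (π : E → Fin k) : Prop extends IsInstance g F U v A B α β π where
  edge : ∀ e ∈ F, ∃ t ∈ B, Inc g e t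
  three : ∀ w ∉ B, (∃ e ∈ F, Inc g e w) → cut g F {w} = 3
  unique : ∀ w ∉ B, ∀ t, t ≠ w → ∀ e ∈ F, ∀ e' ∈ F, Inc g e w → Inc g e' w → Inc g e t →
    Inc g e' t → e = e'

/-- An end of `e` in `B`. -/
noncomputable def inner (g : E → V × V) (B : Set V) (e : E) : V :=
  if (g e).1 ∈ B then (g e).1 else (g e).2

/-- The hyperedge to which `e` belongs when the vertices outside `B` are replaced by
hyperedges. -/
noncomputable def hyp (g : E → V × V) (B : Set V) (e : E) : E ⊕ V :=
  if (g e).1 ∈ B then if (g e).2 ∈ B then Sum.inl e else Sum.inr (g e).2 else Sum.inr (g e).1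

/-- The vertices of a hyperedge. -/
noncomputable def hypVerts (g : E → V × V) (F : Finset E) (U : Finset V) (B : Set V)
    (j : E ⊕ V) : Finset V :=
  U.filter fun t => t ∈ B ∧ ∃ e ∈ F, hyp g B e = j ∧ Inc g e t

theorem hyp_of_subset {e : E} (h : ∀ x, Inc g e x → x ∈ B) : hyp g B e = Sum.inl e := by
  rw [hyp, if_pos (h _ (Or.inl rfl)), if_pos (h _ (Or.inr rfl))]

theorem inc_inner {e : E} : Inc g e (inner g B e) := by
  unfold inner; split_ifs
  exacts [Or.inl rfl, Or.inr rfl]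

namespace IsTerminal

theorem mem_of_inc (h : IsTerminal g F U v A B α β π) {e : E} (he : e ∈ F) {x : V}
    (hx : Inc g e x) : x ∈ U := by
  rcases hx with rfl | rfl
  exacts [(h.ends e he).1, (h.ends e he).2]

theorem inner_mem (h : IsTerminal g F U v A B α β π) {e : E} (he : e ∈ F) :
    inner g B e ∈ B := by
  unfold inner
  split_ifs with h1
  · exact h1
  · obtain ⟨t, ht, rfl | rfl⟩ := h.edge e he
    exacts [absurd ht h1, ht]

theorem eq_inner (h : IsTerminal g F U v A B α β π) {e : E} (he : e ∈ F) {w t : V} (hw : w ∉ B)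
    (hew : Inc g e w) (ht : t ≠ w) (het : Inc g e t) : t = inner g B e := by
  have h1 : w ≠ inner g B e := fun h' => hw (h' ▸ h.inner_mem he)
  exact (hew.eq_or_eq inc_inner h1 het).resolve_left ht

theorem hyp_of_notMem (h : IsTerminal g F U v A B α β π) {e : E} (he : e ∈ F) {w : V}
    (hw : w ∉ B) (hew : Inc g e w) : hyp g B e = Sum.inr w := by
  unfold hyp
  rcases hew with rfl | rfl
  · rw [if_neg hw]
  · split_ifs with h1
    · rfl
    · obtain ⟨t, ht, rfl | rfl⟩ := h.edge e he
      exacts [absurd ht h1, absurd ht hw]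

theorem hyp_cases (h : IsTerminal g F U v A B α β π) {e : E} (he : e ∈ F) :
    ((∀ x, Inc g e x → x ∈ B) ∧ hyp g B e = Sum.inl e) ∨
      ∃ w ∉ B, Inc g e w ∧ hyp g B e = Sum.inr w := by
  by_cases h1 : ∀ x, Inc g e x → x ∈ B
  · exact Or.inl ⟨h1, hyp_of_subset h1⟩
  · push Not at h1
    obtain ⟨w, hw, hwB⟩ := h1
    exact Or.inr ⟨w, hwB, hw, h.hyp_of_notMem he hwB hw⟩

theorem hyp_inj (h : IsTerminal g F U v A B α β π) {e e' : E} (he : e ∈ F) (he' : e' ∈ F)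
    {t : V} (ht : t ∈ B) (het : Inc g e t) (het' : Inc g e' t) (hh : hyp g B e = hyp g B e') :
    e = e' := by
  rcases h.hyp_cases he with ⟨-, h1⟩ | ⟨w, hw, hew, h1⟩ <;>
    rcases h.hyp_cases he' with ⟨-, h2⟩ | ⟨w', hw', hew', h2⟩ <;> rw [h1, h2] at hh
  · exact Sum.inl_injective hh
  · cases hh
  · cases hh
  · obtain rfl := Sum.inr_injective hh
    exact h.unique w hw t (fun h' => hw (h' ▸ ht)) e he e' he' hew hew' het het'

theorem mem_hypVerts (h : IsTerminal g F U v A B α β π) {e : E} (he : e ∈ F) {t : V}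
    (ht : t ∈ B) (het : Inc g e t) : t ∈ hypVerts g F U B (hyp g B e) :=
  Finset.mem_filter.2 ⟨h.mem_of_inc he het, ht, e, he, rfl, het⟩

theorem hypVerts_inl (h : IsTerminal g F U v A B α β π) {e : E} (he : e ∈ F)
    (hB : ∀ x, Inc g e x → x ∈ B) :
    hypVerts g F U B (hyp g B e) = {(g e).1, (g e).2} := by
  ext t
  rw [Finset.mem_insert, Finset.mem_singleton]
  constructor
  · intro ht
    obtain ⟨-, -, e', he', hh, het⟩ := Finset.mem_filter.1 ht
    rw [hyp_of_subset hB] at hh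
    rcases h.hyp_cases he' with ⟨-, h2⟩ | ⟨w', hw', hew', h2⟩ <;> rw [h2] at hh
    · obtain rfl := Sum.inl_injective hh
      exact het.imp Eq.symm Eq.symm
    · cases hh
  · rintro (rfl | rfl)
    · exact h.mem_hypVerts he (hB _ (Or.inl rfl)) (Or.inl rfl)
    · exact h.mem_hypVerts he (hB _ (Or.inr rfl)) (Or.inr rfl)

theorem hypVerts_inr (h : IsTerminal g F U v A B α β π) {w : V} (hw : w ∉ B) :
    hypVerts g F U B (Sum.inr w) = (F.filter (Inc g · w)).image (inner g B) := by
  ext t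
  rw [Finset.mem_image, hypVerts, Finset.mem_filter]
  constructor
  · rintro ⟨-, ht, e, he, hh, het⟩
    rcases h.hyp_cases he with ⟨-, h2⟩ | ⟨w', hw', hew', h2⟩ <;> rw [h2] at hh
    · cases hh
    · obtain rfl := Sum.inr_injective hh
      exact ⟨e, Finset.mem_filter.2 ⟨he, hew'⟩,
        (h.eq_inner he hw hew' (fun h' => hw (h' ▸ ht)) het).symm⟩
  · rintro ⟨e, he, rfl⟩
    obtain ⟨he, hew⟩ := Finset.mem_filter.1 he
    exact ⟨h.mem_of_inc he inc_inner, h.inner_mem he, e, he, h.hyp_of_notMem he hw hew, inc_inner⟩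

theorem inner_injOn (h : IsTerminal g F U v A B α β π) {w : V} (hw : w ∉ B) :
    Set.InjOn (inner g B) (F.filter (Inc g · w)) := by
  intro e he e' he' hh
  obtain ⟨he, hew⟩ := Finset.mem_filter.1 he
  obtain ⟨he', hew'⟩ := Finset.mem_filter.1 he'
  exact h.unique w hw (inner g B e) (fun h' => hw (h' ▸ h.inner_mem he)) e he e' he' hew hew'
    inc_inner (hh ▸ inc_inner)

theorem card_hypVerts_inr (h : IsTerminal g F U v A B α β π) {w : V} (hw : w ∉ B)
    (he : ∃ e ∈ F, Inc g e w) : (hypVerts g F U B (Sum.inr w)).card = 3 := by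
  rw [h.hypVerts_inr hw, Finset.card_image_of_injOn (h.inner_injOn hw),
    ← cut_singleton_eq h.loopless, h.three w hw he]

theorem card_hypVerts (h : IsTerminal g F U v A B α β π) {e : E} (he : e ∈ F) :
    (hypVerts g F U B (hyp g B e)).card = 2 ∨ (hypVerts g F U B (hyp g B e)).card = 3 := by
  rcases h.hyp_cases he with ⟨h1, -⟩ | ⟨w, hw, hew, h1⟩
  · left
    rw [h.hypVerts_inl he h1, Finset.card_pair (h.loopless e he)]
  · right
    rw [h1, h.card_hypVerts_inr hw ⟨e, he, hew⟩]

/-- The number of hyperedges at a vertex. -/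
theorem card_filter_hyp (h : IsTerminal g F U v A B α β π) {t : V} (ht : t ∈ B)
    (p : E → Prop) (q : E ⊕ V → Prop) [DecidablePred p] [DecidablePred q]
    (hpq : ∀ e ∈ F, Inc g e t → (p e ↔ q (hyp g B e))) :
    ((F.image (hyp g B)).filter fun j => t ∈ hypVerts g F U B j ∧ q j).card =
      (F.filter fun e => Inc g e t ∧ p e).card := by
  symm
  refine Finset.card_bij (fun e _ => hyp g B e) (fun e he => ?_) (fun e he e' he' hh => ?_)
    fun j hj => ?_
  · obtain ⟨he, het, hp⟩ := Finset.mem_filter.1 he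
    exact Finset.mem_filter.2 ⟨Finset.mem_image_of_mem _ he, h.mem_hypVerts he ht het,
      (hpq e he het).1 hp⟩
  · obtain ⟨he, het, hp⟩ := Finset.mem_filter.1 he
    obtain ⟨he', het', hp'⟩ := Finset.mem_filter.1 he'
    exact h.hyp_inj he he' ht het het' hh
  · obtain ⟨-, htj, hq⟩ := Finset.mem_filter.1 hj
    obtain ⟨-, -, e, he, rfl, het⟩ := Finset.mem_filter.1 htj
    exact ⟨e, Finset.mem_filter.2 ⟨he, het, (hpq e he het).2 hq⟩, rfl⟩

/-- Every set of vertices in `B` extends to a set whose cut is at most the hypergraph cut. -/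
theorem exists_cut_le (h : IsTerminal g F U v A B α β π) {X : Finset V} (hX : ∀ x ∈ X, x ∈ B) :
    ∃ Z : Set V, (∀ b ∈ B, b ∈ Z ↔ b ∈ X) ∧ cut g F Z ≤
      ((F.image (hyp g B)).filter (Separates X <| hypVerts g F U B ·)).card := by
  set N : V → Finset V := fun w => hypVerts g F U B (Sum.inr w) with hN
  set Z : Set V := {w | w ∈ X ∨ w ∉ B ∧ 2 ≤ (N w ∩ X).card} with hZ
  have hB : ∀ b ∈ B, b ∈ Z ↔ b ∈ X := fun b hb => by simp [hZ, hb]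
  have hZB : ∀ w ∉ B, w ∈ Z ↔ 2 ≤ (N w ∩ X).card := fun w hw => by
    have : w ∉ X := fun h' => hw (hX w h')
    simp [hZ, hw, this]
  have hcross : ∀ {e}, e ∈ F → Crosses g Z e → ∀ {x y}, Inc g e x → Inc g e y → x ≠ y →
      (x ∈ Z ↔ y ∉ Z) := by
    intro e he hc x y hx hy hxy
    rw [Crosses] at hc
    rcases hx with rfl | rfl <;> rcases hy with rfl | rfl
    · exact absurd rfl hxy
    · exact (not_iff_comm.1 (not_iff.1 hc)).symm
    · exact (not_iff.1 hc).symm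
    · exact absurd rfl hxy
  have hout : ∀ {e w}, e ∈ F → Crosses g Z e → w ∉ B → Inc g e w →
      (2 ≤ (N w ∩ X).card ↔ inner g B e ∉ X) ∧ inner g B e ∈ N w := by
    intro e w he hc hw hew
    have h1 : w ≠ inner g B e := fun h' => hw (h' ▸ h.inner_mem he)
    have h2 := hcross he hc hew inc_inner h1
    rw [hZB w hw, hB _ (h.inner_mem he)] at h2
    refine ⟨h2, ?_⟩
    have := h.mem_hypVerts he (h.inner_mem he) inc_inner
    rwa [h.hyp_of_notMem he hw hew] at this
  refine ⟨Z, hB, Finset.card_le_card_of_injOn (hyp g B) (fun e he => ?_) fun e he e' he' hh => ?_⟩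
  · obtain ⟨he, hc⟩ := Finset.mem_filter.1 he
    refine Finset.mem_filter.2 ⟨Finset.mem_image_of_mem _ he, ?_⟩
    rcases h.hyp_cases he with ⟨h1, -⟩ | ⟨w, hw, hew, h1⟩
    · rw [h.hypVerts_inl he h1]
      have := hcross he hc (Or.inl rfl) (Or.inr rfl) (h.loopless e he)
      rw [hB _ (h1 _ (Or.inl rfl)), hB _ (h1 _ (Or.inr rfl))] at this
      by_cases h2 : (g e).1 ∈ X
      · exact ⟨⟨_, by simp, h2⟩, (g e).2, by simp, this.1 h2⟩
      · exact ⟨⟨(g e).2, by simp, by tauto⟩, (g e).1, by simp, h2⟩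
    · rw [h1]
      obtain ⟨h2, h3⟩ := hout he hc hw hew
      have h4 := h.card_hypVerts_inr hw ⟨e, he, hew⟩
      by_cases h5 : inner g B e ∈ X
      · refine ⟨⟨_, h3, h5⟩, ?_⟩
        by_contra! h6
        have : N w ∩ X = N w := Finset.inter_eq_left.2 h6
        rw [this] at h2
        exact h2.1 (by simp only [hN]; omega) h5
      · have h6 := h2.2 h5
        obtain ⟨x, hx⟩ : (N w ∩ X).Nonempty := Finset.card_pos.1 (by omega)
        exact ⟨⟨x, (Finset.mem_inter.1 hx).1, (Finset.mem_inter.1 hx).2⟩, _, h3, h5⟩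
  · obtain ⟨he, hc⟩ := Finset.mem_filter.1 he
    obtain ⟨he', hc'⟩ := Finset.mem_filter.1 he'
    rcases h.hyp_cases he with ⟨h1, hh1⟩ | ⟨w, hw, hew, h1⟩ <;>
    rcases h.hyp_cases he' with ⟨h2, hh2⟩ | ⟨w', hw', hew', h2⟩
    · rw [hh1, hh2] at hh; exact Sum.inl_injective hh
    · rw [hh1, h2] at hh; cases hh
    · rw [h1, hh2] at hh; cases hh
    · rw [h1, h2] at hh
      obtain rfl := Sum.inr_injective hh
      refine h.inner_injOn hw (Finset.mem_filter.2 ⟨he, hew⟩) (Finset.mem_filter.2 ⟨he', hew'⟩) ?_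
      obtain ⟨h3, h4⟩ := hout he hc hw hew
      obtain ⟨h5, h6⟩ := hout he' hc' hw hew'
      have h7 : (N w).card = 3 := h.card_hypVerts_inr hw ⟨e, he, hew⟩
      by_contra hne
      by_cases h8 : 2 ≤ (N w ∩ X).card
      · have h9 : ({inner g B e, inner g B e'} : Finset V) ⊆ N w \ X := by
          intro x hx
          rw [Finset.mem_insert, Finset.mem_singleton] at hx
          rw [Finset.mem_sdiff]
          rcases hx with rfl | rfl
          exacts [⟨h4, h3.1 h8⟩, ⟨h6, h5.1 h8⟩]
        have h10 := Finset.card_le_card h9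
        rw [Finset.card_pair hne] at h10
        have := Finset.card_inter_add_card_sdiff (N w) X
        omega
      · have h9 : ({inner g B e, inner g B e'} : Finset V) ⊆ N w ∩ X := by
          intro x hx
          rw [Finset.mem_insert, Finset.mem_singleton] at hx
          rw [Finset.mem_inter]
          rcases hx with rfl | rfl
          exacts [⟨h4, by tauto⟩, ⟨h6, by tauto⟩]
        have h10 := Finset.card_le_card h9
        rw [Finset.card_pair hne] at h10
        exact h8 h10

/-- The prescribed colour of a hyperedge at the base vertex. -/
theorem exists_color (h : IsTerminal g F U v A B α β π) :
    ∃ π' : E ⊕ V → Fin k, ∀ e ∈ F, Inc g e v → π' (hyp g B e) = π e := by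
  refine ⟨fun j => if hj : ∃ e ∈ F, Inc g e v ∧ hyp g B e = j then π hj.choose else ⟨0, h.pos⟩,
    fun e he hev => ?_⟩
  have hj : ∃ e' ∈ F, Inc g e' v ∧ hyp g B e' = hyp g B e := ⟨e, he, hev, rfl⟩
  simp only [dif_pos hj]
  obtain ⟨h1, h2, h3⟩ := hj.choose_spec
  rw [h.hyp_inj h1 he h.base h2 hev h3]

end IsTerminal
end Terminal

section TerminalSolution
open scoped Classical

variable {V E : Type*} {k : ℕ} {g : E → V × V} {F : Finset E} {U : Finset V} {v : V}
  {A B : Set V} {α β : ℕ} {π : E → Fin k}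

namespace IsTerminal

theorem isCubicInstance (h : IsTerminal g F U v A B α β π) {π' : E ⊕ V → Fin k}
    (hπ : ∀ e ∈ F, Inc g e v → π' (hyp g B e) = π e) :
    ∃ S L, IsCubicInstance (F.image (hyp g B)) (hypVerts g F U B)
      (U.filter fun t => t ∈ B ∧ t ≠ v) S v k L (cut g F {v}) π' ∧
      (v ∈ A → ∀ a ∈ A, a ≠ v → a ∈ S) := by
  set T := U.filter fun t => t ∈ B ∧ t ≠ v with hT
  have hmemT : ∀ t, t ∈ T ↔ t ∈ B ∧ t ≠ v := fun t => by
    rw [hT, Finset.mem_filter]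
    exact ⟨fun h => h.2, fun h' => ⟨h.verts t h'.1, h'⟩⟩
  have hsub : ∀ j ∈ F.image (hyp g B), hypVerts g F U B j ⊆ insert v T := by
    intro j _ t ht
    rw [Finset.mem_insert, hmemT]
    have := (Finset.mem_filter.1 ht).2.1
    tauto
  have hcard : ∀ j ∈ F.image (hyp g B),
      (hypVerts g F U B j).card = 2 ∨ (hypVerts g F U B j).card = 3 := by
    intro j hj
    obtain ⟨e, he, rfl⟩ := Finset.mem_image.1 hj
    exact h.card_hypVerts he
  have hvT : v ∉ T := fun h' => ((hmemT v).1 h').2 rfl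
  have hdeg : ((F.image (hyp g B)).filter (v ∈ hypVerts g F U B ·)).card = cut g F {v} := by
    have := h.card_filter_hyp h.base (fun _ => True) (fun _ => True) fun _ _ _ => Iff.rfl
    simp only [and_true] at this
    rw [this, cut_singleton_eq h.loopless]
  have htwo : ∀ i, ((F.image (hyp g B)).filter
      fun j => v ∈ hypVerts g F U B j ∧ π' j = i).card =
      (F.filter fun e => Inc g e v ∧ π e = i).card := fun i =>
    h.card_filter_hyp h.base (fun e => π e = i) (fun j => π' j = i) fun e he hev => by
      rw [hπ e he hev]
  have hcut : ∀ X ⊆ T, ∃ Z : Set V, (∀ b ∈ B, b ∈ Z ↔ b ∈ X) ∧ req A B α β Z ≤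
      ((F.image (hyp g B)).filter (Separates X <| hypVerts g F U B ·)).card := by
    intro X hX
    obtain ⟨Z, hZ, hle⟩ := h.exists_cut_le (X := X) fun x hx => ((hmemT x).1 (hX hx)).1
    exact ⟨Z, hZ, (h.cuts Z).trans hle⟩
  rcases h.kind with ⟨h1, ⟨a₀, ha₀, ha₀v⟩, h3, h4, h5⟩ | ⟨h1, ⟨a₀, ha₀⟩, h3, h4⟩
  · have hreq : cut g F {v} = α := by
      rw [h.degree]
      exact req_of_splits ⟨⟨v, h1, rfl⟩, a₀, ha₀, ha₀v⟩
    set S := U.filter fun t => t ∈ A ∧ t ≠ v with hS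
    have hmemS : ∀ t, t ∈ S ↔ t ∈ A ∧ t ≠ v := fun t => by
      rw [hS, Finset.mem_filter]
      exact ⟨fun h => h.2, fun h' => ⟨h.verts t (h.subset h'.1), h'⟩⟩
    have hST : S ⊆ T := fun t ht => (hmemT t).2 ⟨h.subset ((hmemS t).1 ht).1, ((hmemS t).1 ht).2⟩
    have ha₀S : a₀ ∈ S := (hmemS _).2 ⟨ha₀, ha₀v⟩
    refine ⟨S, β, ⟨hsub, hcard, hvT, ⟨a₀, hST ha₀S⟩, hST, h.pos, h3, by omega, hdeg,
      fun X hX hne hXT => ?_, fun X hX hne => ?_, fun hS => ?_, fun _ i => ?_⟩,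
      fun _ a ha hav => (hmemS a).2 ⟨ha, hav⟩⟩
    · obtain ⟨Z, hZ, hle⟩ := hcut X hX
      obtain ⟨x, hx⟩ := hne
      have hxB := ((hmemT x).1 (hX hx)).1
      exact (le_req_of_splits h.le ⟨⟨x, hxB, (hZ x hxB).2 hx⟩, v, h.base,
        fun h' => hvT (hX ((hZ v h.base).1 h'))⟩).trans hle
    · obtain ⟨Z, hZ, hle⟩ := hcut X hX
      obtain ⟨x, hx⟩ := hne
      obtain ⟨hx, hxS⟩ := Finset.mem_inter.1 hx
      have hxA := ((hmemS x).1 hxS).1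
      rw [req_of_splits ⟨⟨x, hxA, (hZ x (h.subset hxA)).2 hx⟩, v, h1,
        fun h' => hvT (hX ((hZ v h.base).1 h'))⟩] at hle
      omega
    · rw [hS] at ha₀S
      simp at ha₀S
    · rw [htwo]; exact h5 i
  · have hmem : ∀ t, t ∈ T ↔ t ∈ A := fun t => by
      rw [hmemT, h3]
      constructor
      · rintro ⟨rfl | h, h'⟩
        exacts [absurd rfl h', h]
      · exact fun h => ⟨Or.inr h, fun h' => h1 (h' ▸ h)⟩
    have hreq : cut g F {v} = β := by
      rw [h.degree, req, if_neg, if_pos]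
      · exact ⟨⟨v, h.base, rfl⟩, a₀, h.subset ha₀, fun h => h1 (h ▸ ha₀)⟩
      · rintro ⟨⟨a, ha, rfl⟩, -⟩
        exact h1 ha
    refine ⟨∅, α, ⟨hsub, hcard, hvT, ⟨a₀, (hmem _).2 ha₀⟩, Finset.empty_subset _, h.pos, h4,
      by have := h.le; omega, hdeg, fun X hX hne hXT => ?_, fun X hX hne => ?_,
      fun _ => hreq ▸ h.le, fun h => absurd h Finset.not_nonempty_empty⟩,
      fun h => absurd h h1⟩
    · obtain ⟨Z, hZ, hle⟩ := hcut X hX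
      obtain ⟨x, hx⟩ := hne
      obtain ⟨y, hyT, hyX⟩ := Finset.exists_of_ssubset (hX.ssubset_of_ne hXT)
      have hxA := (hmem x).1 (hX hx)
      have hyA := (hmem y).1 hyT
      rwa [req_of_splits ⟨⟨x, hxA, (hZ x (h.subset hxA)).2 hx⟩, y, hyA,
        fun h' => hyX ((hZ y (h.subset hyA)).1 h')⟩] at hle
    · simp at hne

/-- Terminal instances have solutions. -/
theorem exists_solution [Fintype V] (h : IsTerminal g F U v A B α β π) :
    ∃ c, IsSolution g F v A B π c := by
  obtain ⟨π', hπ⟩ := h.exists_color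
  obtain ⟨S, L, hI, hS⟩ := h.isCubicInstance hπ
  obtain ⟨cc, hc⟩ := hI.exists_coloring
  have hmemT : ∀ t, t ∈ U.filter (fun t => t ∈ B ∧ t ≠ v) ↔ t ∈ B ∧ t ≠ v := fun t => by
    rw [Finset.mem_filter]
    exact ⟨fun h => h.2, fun h' => ⟨h.verts t h'.1, h'⟩⟩
  have hJ : ∀ {e}, e ∈ F → hyp g B e ∈ F.image (hyp g B) := Finset.mem_image_of_mem _
  set c : E → Fin k := fun e => if Inc g e v then π e else cc (hyp g B e) (inner g B e) with hcdef
  have hcv : ∀ {e}, Inc g e v → c e = π e := fun h => if_pos h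
  have hcc : ∀ {e}, e ∈ F → ∀ {t}, t ∈ B → t ≠ v → Inc g e t → c e = cc (hyp g B e) t := by
    intro e he t ht htv het
    by_cases hev : Inc g e v
    · have hB : ∀ x, Inc g e x → x ∈ B := fun x hx => by
        rcases het.eq_or_eq hev htv hx with rfl | rfl
        exacts [ht, h.base]
      have h1 := h.hypVerts_inl he hB
      obtain ⟨s, hs, hsv, hs'⟩ := hc.extend _ (hJ he) (h.mem_hypVerts he h.base hev)
      have hes : Inc g e s := by
        rw [h1, Finset.mem_insert, Finset.mem_singleton] at hs
        exact hs.imp Eq.symm Eq.symm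
      rw [hcv hev, ← hπ e he hev, ← hs', (het.eq_or_eq hev htv hes).resolve_right hsv]
    · have h1 : c e = cc (hyp g B e) (inner g B e) := if_neg hev
      rw [h1]
      rcases h.hyp_cases he with ⟨hB, -⟩ | ⟨w, hw, hew, -⟩
      · refine hc.const _ (hJ he) (fun h' => hev ?_) _ _
        rw [h.hypVerts_inl he hB, Finset.mem_insert, Finset.mem_singleton] at h'
        exact h'.imp Eq.symm Eq.symm
      · rw [h.eq_inner he hw hew (fun h' => hw (h' ▸ ht)) het]
  refine ⟨c, fun e he hev => hcv hev, fun i Z hZ => ?_, fun hcond t ht htv i => ?_⟩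
  · -- it suffices to separate vertices that are targets of the hypergraph colouring
    have hedge : ∀ {j t}, t ∈ hypVerts g F U B j → t ≠ v → cc j t = i →
        ∃ e ∈ F, c e = i ∧ Inc g e t ∧ hyp g B e = j := by
      intro j t ht htv hi
      obtain ⟨-, htB, e, he, rfl, het⟩ := Finset.mem_filter.1 ht
      exact ⟨e, he, by rw [hcc he htB htv het, hi], het, rfl⟩
    have hrep : ∀ {Z : Set V}, (∀ e ∈ F, c e = i → ¬ Inc g e v → ¬ Crosses g Z e) →
        ∀ x ∈ Target g F v A π i, x ∈ Z → ∃ t, (t ∈ B ∧ t ≠ v) ∧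
          CubicTarget (F.image (hyp g B)) (hypVerts g F U B) S v π' cc i t ∧ t ∈ Z := by
      rintro Z hno x ⟨hxv, h1 | ⟨e, he, hei, hev, hex⟩⟩ hxZ
      · exact ⟨x, ⟨h.subset h1.2, hxv⟩, Or.inl (hS h1.1 x h1.2 hxv), hxZ⟩
      · by_cases hxB : x ∈ B
        · refine ⟨x, ⟨hxB, hxv⟩, Or.inr ⟨_, hJ he, h.mem_hypVerts he h.base hev, ?_,
            h.mem_hypVerts he hxB hex, hxv, ?_⟩, hxZ⟩
          · rw [hπ e he hev, hei]
          · rw [← hcc he hxB hxv hex, hcv hev, hei]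
        · have hx := h.hyp_of_notMem he hxB hex
          obtain ⟨t, ht, htv, htc⟩ := hc.extend _ (hJ he) (h.mem_hypVerts he h.base hev)
          rw [hπ e he hev, hei] at htc
          obtain ⟨e', he', hi', het', hh⟩ := hedge ht htv htc
          have htB := (Finset.mem_filter.1 ht).2.1
          have htx : t ≠ x := fun h' => hxB (h' ▸ htB)
          have hex' : Inc g e' x := by
            rw [hx] at hh
            rcases h.hyp_cases he' with ⟨-, h2⟩ | ⟨w, hw, hew, h2⟩ <;> rw [h2] at hh
            · cases hh
            · exact Sum.inr_injective hh ▸ hew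
          refine ⟨t, ⟨htB, htv⟩, Or.inr ⟨_, hJ he, h.mem_hypVerts he h.base hev,
            by rw [hπ e he hev, hei], ht, htv, htc⟩, ?_⟩
          by_contra htZ
          refine hno e' he' hi' (fun hv' => ?_) (crosses_iff_exists.2 ⟨x, t, hxZ, htZ, hex', het'⟩)
          rcases hex'.eq_or_eq het' htx.symm hv' with h' | h'
          exacts [hxv h'.symm, htv h'.symm]
    by_contra! hno
    obtain ⟨⟨x, hx, hxZ⟩, y, hy, hyZ⟩ := hZ
    obtain ⟨s, hs, hsT, hsZ⟩ := hrep (Z := Z) hno x hx hxZ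
    obtain ⟨t, ht, htT, htZ⟩ := hrep (Z := Zᶜ)
      (fun e he hi hev hcr => hno e he hi hev (crosses_compl.1 hcr)) y hy hyZ
    obtain ⟨j, hj, a, ha, b, hb, hav, hbv, haZ, hbZ, hai, hbi⟩ := hc.conn i Z
      ⟨s, (hmemT s).2 hs, hsT, hsZ⟩ ⟨t, (hmemT t).2 ht, htT, htZ⟩
    obtain ⟨e, he, hei, hea, rfl⟩ := hedge ha hav hai
    obtain ⟨e', he', hei', heb, hh⟩ := hedge hb hbv hbi
    have haB := (Finset.mem_filter.1 ha).2.1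
    have hbB := (Finset.mem_filter.1 hb).2.1
    have hab : a ≠ b := fun h' => hbZ (h' ▸ haZ)
    rcases h.hyp_cases he with ⟨hB, -⟩ | ⟨w, hw, hew, h1⟩
    · have heb' : Inc g e b := by
        rw [h.hypVerts_inl he hB, Finset.mem_insert, Finset.mem_singleton] at hb
        exact hb.imp Eq.symm Eq.symm
      refine hno e he hei (fun hv => ?_) (crosses_iff_exists.2 ⟨a, b, haZ, hbZ, hea, heb'⟩)
      rcases hea.eq_or_eq heb' hab hv with h' | h'
      exacts [hav h'.symm, hbv h'.symm]
    · have hwv : w ≠ v := fun h' => hw (h' ▸ h.base)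
      have hew' : Inc g e' w := by
        rw [h1] at hh
        rcases h.hyp_cases he' with ⟨-, h2⟩ | ⟨w', hw', hew', h2⟩ <;> rw [h2] at hh
        · cases hh
        · exact Sum.inr_injective hh ▸ hew'
      by_cases hwZ : w ∈ Z
      · refine hno e' he' hei' (fun hv => ?_)
          (crosses_iff_exists.2 ⟨w, b, hwZ, hbZ, hew', heb⟩)
        rcases hew'.eq_or_eq heb (fun h' => hw (h' ▸ hbB)) hv with h' | h'
        exacts [hwv h'.symm, hbv h'.symm]
      · refine hno e he hei (fun hv => ?_)
          (crosses_iff_exists.2 ⟨a, w, haZ, hwZ, hea, hew⟩)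
        rcases hew.eq_or_eq hea (fun h' => hw (h' ▸ haB)) hv with h' | h'
        exacts [hwv h'.symm, hav h'.symm]
  · rw [← h.card_filter_hyp ht (fun e => c e = i) (fun j => cc j t = i)
      fun e he het => by rw [hcc he ht htv het]]
    refine hc.balance ?_ t ((hmemT t).2 ⟨ht, htv⟩) i
    rcases hcond with ⟨s, hs, t, ht, hsv, htv, hst⟩ | h5
    · left
      exact Finset.one_lt_card.2 ⟨s, (hmemT s).2 ⟨hs, hsv⟩, t, (hmemT t).2 ⟨ht, htv⟩, hst⟩
    · right
      intro i
      rw [h.card_filter_hyp h.base (fun e => π e = i) (fun j => π' j = i)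
        fun e he hev => by rw [hπ e he hev]]
      exact h5 i

end IsTerminal
end TerminalSolution

section MainInduction
open scoped Classical

variable {V E : Type*} {k : ℕ} {g : E → V × V} {F : Finset E} {U : Finset V} {v : V}
  {A B : Set V} {α β : ℕ} {π : E → Fin k}

/-- An edge crossing a tight set with a single vertex has a tight end. -/
theorem IsInstance.exists_tight_end (h : IsInstance g F U v A B α β π) {e : E} (he : e ∈ F)
    {Z : Set V} (hc : Crosses g Z e) (hpos : 0 < req A B α β Z)
    (htight : req A B α β Z = cut g F Z) (hZ : ∀ y ∈ U, ∀ z ∈ U, y ∈ Z → z ∈ Z → y = z) :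
    ∃ t ∈ B, Inc g e t ∧ 0 < req A B α β {t} ∧ cut g F {t} = req A B α β {t} := by
  obtain ⟨t, -, htZ, -, het, -⟩ := crosses_iff_exists.1 hc
  have htU : t ∈ U := by
    rcases het with rfl | rfl
    exacts [(h.ends e he).1, (h.ends e he).2]
  have hmem : ∀ y ∈ U, (y ∈ ({t} : Set V) ↔ y ∈ Z) := fun y hy =>
    ⟨fun h' => h' ▸ htZ, fun h' => hZ y hy t htU h' htZ⟩
  have h1 : cut g F {t} = cut g F Z := cut_congr fun e he =>
    ⟨hmem _ (h.ends e he).1, hmem _ (h.ends e he).2⟩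
  have h2 : req A B α β {t} = req A B α β Z :=
    req_congr h.subset fun b hb => hmem b (h.verts b hb)
  exact ⟨t, mem_of_req_singleton_pos h.subset (α := α) (β := β) (by rwa [h2]), het, by rwa [h2],
    by rw [h1, h2, htight]⟩

theorem IsInstance.exists_solution_aux [Fintype V] (n : ℕ) :
    ∀ (g : E → V × V) (F : Finset E) (U : Finset V) (v : V) (A B : Set V) (α β : ℕ)
      (π : E → Fin k), U.card + F.card = n → IsInstance g F U v A B α β π →
      ∃ c, IsSolution g F v A B π c := by
  induction n using Nat.strong_induction_on with | _ n ih
  intro g F U v A B α β π hn h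
  have hcardF : ∀ e ∈ F, U.card + (F.erase e).card < n := fun e he => by
    have := Finset.card_erase_lt_of_mem he
    omega
  by_cases hβ : β = 1
  · rcases h.kind with ⟨-, -, h3, -⟩ | ⟨hvA, ⟨a₀, ha₀⟩, h3, -⟩
    · have := h.pos
      omega
    · subst hβ
      have hdeg : cut g F {v} = 1 := by
        rw [h.degree, req, if_neg, if_pos]
        · exact ⟨⟨v, h.base, rfl⟩, a₀, h.subset ha₀, fun h => hvA (h ▸ ha₀)⟩
        · rintro ⟨⟨a, ha, rfl⟩, -⟩
          exact hvA ha
      rw [cut_singleton_eq h.loopless, Finset.card_eq_one] at hdeg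
      obtain ⟨e₀, he₀⟩ := hdeg
      obtain ⟨he, hev⟩ := Finset.mem_filter.1 (he₀ ▸ Finset.mem_singleton_self e₀)
      have huniq : ∀ e ∈ F, Inc g e v → e = e₀ := fun e he hev =>
        Finset.mem_singleton.1 (he₀ ▸ Finset.mem_filter.2 ⟨he, hev⟩)
      obtain ⟨c, hc⟩ := ih _ (hcardF e₀ he) _ _ _ _ _ _ _ _ _ rfl
        (h.erase_base hvA he hev huniq)
      exact ⟨_, hc.of_erase_base h.pos hvA hev huniq⟩
  by_cases htight : ∃ X, 0 < req A B α β X ∧ req A B α β X = cut g F X ∧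
      (∃ y ∈ U, ∃ z ∈ U, y ∈ X ∧ z ∈ X ∧ y ≠ z) ∧ ∃ y ∈ U, ∃ z ∈ U, y ∉ X ∧ z ∉ X ∧ y ≠ z
  · obtain ⟨X, hvX, hpos, htight, ⟨y, hy, z, hz, hyX, hzX, hyz⟩, y', hy', z', hz', hyX', hzX',
        hyz'⟩ : ∃ X, v ∉ X ∧ 0 < req A B α β X ∧ req A B α β X = cut g F X ∧
        (∃ y ∈ U, ∃ z ∈ U, y ∈ X ∧ z ∈ X ∧ y ≠ z) ∧
        ∃ y ∈ U, ∃ z ∈ U, y ∉ X ∧ z ∉ X ∧ y ≠ z := by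
      obtain ⟨X, h1, h2, h3, y, hy, z, hz, hyX, hzX, hyz⟩ := htight
      by_cases hvX : v ∈ X
      · refine ⟨Xᶜ, not_not.2 hvX, by rwa [req_compl], by rwa [req_compl, cut_compl],
          ⟨y, hy, z, hz, hyX, hzX, hyz⟩, ?_⟩
        simpa only [Set.mem_compl_iff, not_not] using h3
      · exact ⟨X, hvX, h1, h2, h3, y, hy, z, hz, hyX, hzX, hyz⟩
    obtain ⟨⟨x, hxB, hxX⟩, -⟩ := req_pos h.subset hpos
    have hlt : ∀ (f : V → V), (U.image f).card < U.card →
        (U.image f).card + (nonLoops (mapEnds f g) F).card < n := fun f hf => by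
      have : (nonLoops (mapEnds f g) F).card ≤ F.card := Finset.card_filter_le _ _
      omega
    obtain ⟨c₁, hc₁⟩ := ih _ (hlt _ (card_image_shrink_lt hyX hzX hy hz hyz)) _ _ _ _ _ _ _ _ _ rfl
      (h.contract hvX hxX)
    obtain ⟨A', B', α', β', h', hA', hB'⟩ :=
      h.contract_compl hvX hxX hxB htight.symm hpos hc₁
    obtain ⟨c₂, hc₂⟩ := ih _ (hlt _ (card_image_shrink_lt (X := Xᶜ) hyX' hzX' hy' hz' hyz'))
      _ _ _ _ _ _ _ _ _ rfl h'
    exact ⟨_, IsSolution.glue (fun e he _ => h.loopless e he) hvX hxX (fun _ => hxB) hc₁ hc₂ hA' hB'⟩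
  push Not at htight
  have htriv : ∀ X, 0 < req A B α β X → req A B α β X = cut g F X →
      (∀ y ∈ U, ∀ z ∈ U, y ∈ X → z ∈ X → y = z) ∨
        ∀ y ∈ U, ∀ z ∈ U, y ∉ X → z ∉ X → y = z := by
    intro X h1 h2
    by_contra! h3
    obtain ⟨h3, y, hy, z, hz, hyX, hzX, hyz⟩ := h3
    exact hyz (htight X h1 h2 h3 y hy z hz hyX hzX)
  by_cases herase : ∃ e ∈ F, ¬ Inc g e v ∧
      ∀ Z, Crosses g Z e → 0 < req A B α β Z → req A B α β Z ≠ cut g F Z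
  · obtain ⟨e, he, hev, hZ⟩ := herase
    obtain ⟨c, hc⟩ := ih _ (hcardF e he) _ _ _ _ _ _ _ _ _ rfl (h.erase he hev hZ)
    exact ⟨c, hc.of_erase hev⟩
  push Not at herase
  have hend : ∀ e ∈ F, ¬ Inc g e v →
      ∃ t ∈ B, Inc g e t ∧ 0 < req A B α β {t} ∧ cut g F {t} = req A B α β {t} := by
    intro e he hev
    obtain ⟨Z, hc, hpos, ht⟩ := herase e he hev
    rcases htriv Z hpos ht with h1 | h1
    · exact h.exists_tight_end he hc hpos ht h1
    · exact h.exists_tight_end he (crosses_compl.2 hc) (by rwa [req_compl])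
        (by rwa [req_compl, cut_compl]) h1
  have hred : ∀ w ∈ U, w ∉ B → IsReducedAt g F U v A B α β π w := by
    intro w hwU hw
    have hwv : w ≠ v := fun h' => hw (h' ▸ h.base)
    refine { h with trivial_of_tight := htriv, ne_one := hβ, mem := hwU, notMem := hw, nbr := ?_ }
    rintro z ⟨hzw, e, he, hew, hez⟩
    by_cases hzv : z = v
    · subst hzv
      refine ⟨h.base, ?_, h.degree⟩
      rw [← h.degree, cut_singleton_eq h.loopless]
      exact Finset.card_pos.2 ⟨e, Finset.mem_filter.2 ⟨he, hez⟩⟩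
    · have hev : ¬ Inc g e v := fun hev => by
        rcases hew.eq_or_eq hez hzw.symm hev with h' | h'
        exacts [hwv h'.symm, hzv h'.symm]
      obtain ⟨t, ht, het, h1, h2⟩ := hend e he hev
      obtain rfl := (hew.eq_or_eq hez hzw.symm het).resolve_left fun h' => hw (h' ▸ ht)
      exact ⟨ht, h1, h2⟩
  by_cases hw : ∃ w ∈ U, w ∉ B ∧ 0 < cut g F {w} ∧ cut g F {w} ≠ 3
  · obtain ⟨w, hwU, hwB, hpos, hne⟩ := hw
    obtain ⟨a, b, ⟨haw, e₁, he₁, h1w, h1a⟩, ⟨hbw, e₂, he₂, h2w, h2b⟩, hab, hbv, hsafe⟩ :=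
      (hred w hwU hwB).exists_safe_pair hpos hne
    obtain ⟨c, hc⟩ := ih _ (hcardF e₂ he₂) _ _ _ _ _ _ _ _ _ rfl
      (h.split hwB he₁ he₂ h1w h1a h2w h2b haw hbw hab hbv hsafe)
    exact ⟨_, hc.of_split hwB (fun h' => hwB (h' ▸ h.base)) (fun h' => hwB (h.subset h'))
      he₁ he₂ h1w h1a h2w h2b haw hbw hab hbv⟩
  push Not at hw
  have hinU : ∀ {w e}, e ∈ F → Inc g e w → w ∈ U := by
    rintro w e he (rfl | rfl)
    exacts [(h.ends e he).1, (h.ends e he).2]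
  have hthree : ∀ w ∉ B, (∃ e ∈ F, Inc g e w) → cut g F {w} = 3 := by
    rintro w hwB ⟨e, he, hew⟩
    refine hw w (hinU he hew) hwB ?_
    rw [cut_singleton_eq h.loopless]
    exact Finset.card_pos.2 ⟨e, Finset.mem_filter.2 ⟨he, hew⟩⟩
  refine IsTerminal.exists_solution (U := U) (α := α) (β := β)
    { h with edge := fun e he => ?_, three := hthree, unique := ?_ }
  · by_cases hev : Inc g e v
    · exact ⟨v, h.base, hev⟩
    · obtain ⟨t, ht, het, -⟩ := hend e he hev
      exact ⟨t, ht, het⟩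
  · intro w hwB t htw e he e' he' hew hew' het het'
    by_contra hne
    have h1 := (hred w (hinU he hew) hwB).two_mul_between_singleton_le ⟨htw, e, he, hew, het⟩
    rw [hthree w hwB ⟨e, he, hew⟩] at h1
    have h2 : ({e, e'} : Finset E) ⊆ F.filter (Joins g {w} {t}) := by
      intro x hx
      rw [Finset.mem_insert, Finset.mem_singleton] at hx
      rcases hx with rfl | rfl
      · exact Finset.mem_filter.2 ⟨he, joins_of_inc rfl rfl htw.symm hew het⟩
      · exact Finset.mem_filter.2 ⟨he', joins_of_inc rfl rfl htw.symm hew' het'⟩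
    have h3 := Finset.card_le_card h2
    rw [Finset.card_pair hne] at h3
    unfold between at h1
    omega

/-- Every instance has a solution. -/
theorem IsInstance.exists_solution [Fintype V] (h : IsInstance g F U v A B α β π) :
    ∃ c, IsSolution g F v A B π c :=
  exists_solution_aux _ _ _ _ _ _ _ _ _ _ rfl h

end MainInduction

section SingleVertex
open scoped Classical

variable {V E : Type*} {k : ℕ} {g : E → V × V} {F : Finset E} {v r : V} {π : E → Fin k}

theorem splits_pair {Z : Set V} : Splits (insert v {r}) Z ↔ (r ∈ Z ∧ v ∉ Z) ∨ (r ∉ Z ∧ v ∈ Z) := by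
  simp only [Splits, Set.mem_insert_iff, Set.mem_singleton_iff, exists_eq_or_imp, exists_eq_left]
  tauto

theorem not_splits_singleton {Z : Set V} : ¬ Splits {r} Z := by
  simp [Splits]

/-- A finite set of size at least `2 * k` has a colouring using every colour twice. -/
theorem exists_coloring_two_le (hk : 0 < k) (T : Finset E) (hT : 2 * k ≤ T.card) :
    ∃ φ : E → Fin k, ∀ i, 2 ≤ (T.filter fun e => φ e = i).card := by
  obtain ⟨T', hT', hcard⟩ := Finset.exists_subset_card_eq hT
  let f := T'.equivFinOfCardEq hcard
  refine ⟨fun e => if h : e ∈ T' then ⟨(f ⟨e, h⟩).val % k, Nat.mod_lt _ hk⟩ else ⟨0, hk⟩,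
    fun i => ?_⟩
  have hi := i.isLt
  have h1 : i.val < 2 * k := by omega
  have h2 : i.val + k < 2 * k := by omega
  have hne : (f.symm ⟨i.val, h1⟩).val ≠ (f.symm ⟨i.val + k, h2⟩).val := by
    intro h
    have := f.symm.injective (Subtype.ext h)
    rw [Fin.mk.injEq] at this
    omega
  refine (Finset.card_pair hne).symm.le.trans (Finset.card_le_card ?_)
  intro e he
  rw [Finset.mem_insert, Finset.mem_singleton] at he
  rcases he with rfl | rfl
  · refine Finset.mem_filter.2 ⟨hT' (f.symm _).2, ?_⟩
    simp only [Finset.coe_mem, dif_pos, Subtype.coe_eta, Equiv.apply_symm_apply]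
    exact Fin.ext (Nat.mod_eq_of_lt hi)
  · refine Finset.mem_filter.2 ⟨hT' (f.symm _).2, ?_⟩
    simp only [Finset.coe_mem, dif_pos, Subtype.coe_eta, Equiv.apply_symm_apply]
    exact Fin.ext ((Nat.add_mod_right _ _).trans (Nat.mod_eq_of_lt hi))

theorem exists_solution_single [Fintype V] {D : ℕ} (hk : 0 < k) (hrv : r ≠ v)
    (hcut : ∀ Z, r ∈ Z → v ∉ Z → D ≤ cut g F Z) (hdeg : cut g F {v} = D)
    (hr : D + 2 * k ≤ (F.filter fun e => Inc g e r).card) :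
    ∃ c, IsSolution g (nonLoops g F) v {r} ∅ π c ∧
      ∀ i, 2 ≤ (F.filter fun e => Inc g e r ∧ c e = i).card := by
  have hreq : ∀ Z : Set V, req {r} (insert v {r}) (D + 32 * k) D Z =
      if Splits (insert v {r}) Z then D else 0 := fun Z => by
    rw [req, if_neg not_splits_singleton]
  have hsv : Splits (insert v {r}) {v} := splits_pair.2 (Or.inr ⟨hrv, rfl⟩)
  have hinit : IsInstance g (nonLoops g F) Finset.univ v {r} (insert v {r}) (D + 32 * k) D π := by
    refine ⟨fun e _ => ⟨Finset.mem_univ _, Finset.mem_univ _⟩, fun e he => (mem_nonLoops.1 he).2,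
      Set.mem_insert _ _, Set.subset_insert _ _, fun _ _ => Finset.mem_univ _, by omega, hk,
      fun Z => ?_, ?_, Or.inr ⟨hrv.symm, ⟨r, rfl⟩, rfl, by omega⟩⟩
    · rw [hreq, cut_nonLoops]
      split_ifs with h
      · rcases splits_pair.1 h with h | h
        · exact hcut Z h.1 h.2
        · rw [← cut_compl]
          exact hcut Zᶜ h.1 (not_not.2 h.2)
      · exact Nat.zero_le _
    · rw [hreq, cut_nonLoops, hdeg, if_pos hsv]
  obtain ⟨F', ⟨hF', hI⟩, hmin⟩ := exists_minimal_of_wellFoundedLT (fun F' : Finset E =>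
    F' ⊆ nonLoops g F ∧
      IsInstance g F' Finset.univ v {r} (insert v {r}) (D + 32 * k) D π) ⟨_, subset_rfl, hinit⟩
  have hdeg' : cut g F' {v} = D := by
    rw [hI.degree, hreq, if_pos hsv]
  have hvF' : ∀ e ∈ nonLoops g F, Inc g e v → e ∈ F' := by
    have h1 : F'.filter (Crosses g {v}) = (nonLoops g F).filter (Crosses g {v}) := by
      refine Finset.eq_of_subset_of_card_le (Finset.filter_subset_filter _ hF') ?_
      change cut g _ _ ≤ cut g _ _
      rw [hdeg', cut_nonLoops, hdeg]
    intro e he hev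
    have h2 : e ∈ (nonLoops g F).filter (Crosses g {v}) :=
      Finset.mem_filter.2 ⟨he, (crosses_singleton (mem_nonLoops.1 he).2).2 hev⟩
    rw [← h1] at h2
    exact (Finset.mem_filter.1 h2).1
  have htight : ∀ e ∈ F', Inc g e r → ∃ Z, r ∈ Z ∧ v ∉ Z ∧ cut g F' Z = D ∧ Crosses g Z e := by
    intro e he her
    by_cases hev : Inc g e v
    · refine ⟨{v}ᶜ, hrv, not_not.2 rfl, by rw [cut_compl, hdeg'], ?_⟩
      rw [crosses_compl, crosses_singleton (hI.loopless e he)]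
      exact hev
    · by_contra! hno
      refine Finset.notMem_erase e F' (hmin ⟨(Finset.erase_subset _ _).trans hF',
        hI.erase he hev fun Z hZ hpos heq => ?_⟩ (Finset.erase_subset _ _) he)
      rw [hreq] at hpos heq
      split_ifs at hpos heq with hs
      · rcases splits_pair.1 hs with hs | hs
        · exact hno Z hs.1 hs.2 heq.symm hZ
        · exact hno Zᶜ hs.1 (not_not.2 hs.2) (by rw [cut_compl, heq]) (crosses_compl.2 hZ)
      · exact absurd hpos (lt_irrefl _)
  obtain ⟨Z₀, ⟨hrZ₀, hvZ₀, hZ₀⟩, hZmin⟩ := exists_minimal_of_wellFoundedLT (fun Z : Set V =>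
    r ∈ Z ∧ v ∉ Z ∧ cut g F' Z = D) ⟨{v}ᶜ, hrv, not_not.2 rfl, by rw [cut_compl, hdeg']⟩
  have hlow : ∀ Z, r ∈ Z → v ∉ Z → D ≤ cut g F' Z := by
    intro Z h1 h2
    have := hI.cuts Z
    rwa [hreq, if_pos (splits_pair.2 (Or.inl ⟨h1, h2⟩))] at this
  have hle : ((F'.filter fun e => Inc g e r)).card ≤ D := by
    rw [← hZ₀]
    refine Finset.card_le_card fun e he => ?_
    rw [Finset.mem_filter] at he ⊢
    obtain ⟨Z, hrZ, hvZ, hZ, hZe⟩ := htight e he.1 he.2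
    have hsub : Z₀ ⊆ Z := by
      have h1 := cut_inter_add_cut_union (g := g) (F := F') Z₀ Z
      have h2 := hlow (Z₀ ∩ Z) ⟨hrZ₀, hrZ⟩ fun h => hvZ h.2
      have h3 := hlow (Z₀ ∪ Z) (Or.inl hrZ₀) fun h => h.elim hvZ₀ hvZ
      have h4 : cut g F' (Z₀ ∩ Z) = D := by omega
      exact (hZmin (y := Z₀ ∩ Z) ⟨⟨hrZ₀, hrZ⟩, fun h => hvZ h.2, h4⟩ Set.inter_subset_left).trans
        Set.inter_subset_right
    refine ⟨he.1, ?_⟩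
    obtain ⟨a, b, ha, hb, hea, heb⟩ := crosses_iff_exists.1 hZe
    exact crosses_iff_exists.2 ⟨r, b, hrZ₀, fun h => hb (hsub h), he.2, heb⟩
  obtain ⟨c₀, hc₀⟩ := hI.exists_solution
  obtain ⟨φ, hφ⟩ := exists_coloring_two_le hk ((F.filter fun e => Inc g e r) \ F') <| by
    have h1 := Finset.card_sdiff_add_card_inter (F.filter fun e => Inc g e r) F'
    have h2 : ((F.filter fun e => Inc g e r) ∩ F').card ≤ D := by
      refine (Finset.card_le_card fun e he => ?_).trans hle
      rw [Finset.mem_inter, Finset.mem_filter] at he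
      exact Finset.mem_filter.2 ⟨he.2, he.1.2⟩
    omega
  refine ⟨fun e => if e ∈ F' then c₀ e else φ e, ⟨fun e he hev => ?_, fun i Z hZ => ?_, ?_⟩,
    fun i => ?_⟩
  · rw [if_pos (hvF' e he hev)]
    exact hc₀.agree e (hvF' e he hev) hev
  · obtain ⟨e, he, hei, hev, hZe⟩ := hc₀.conn i Z (hZ.mono fun x hx => ⟨hx.1, hx.2.imp_right
      fun ⟨e, he, hi, hev, hex⟩ => ⟨e, hvF' e he hev, hi, hev, hex⟩⟩)
    exact ⟨e, hF' he, by rw [if_pos he, hei], hev, hZe⟩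
  · exact fun _ t ht => absurd ht (Set.notMem_empty t)
  · refine (hφ i).trans (Finset.card_le_card fun e he => ?_)
    rw [Finset.mem_filter, Finset.mem_sdiff, Finset.mem_filter] at he
    exact Finset.mem_filter.2 ⟨he.1.1.1, he.1.1.2, (if_neg he.1.2).trans he.2⟩

end SingleVertex

section Islands
open scoped Classical

variable {V E : Type*} {k : ℕ} {g : E → V × V} {F : Finset E} {v x : V} {A B S R X : Set V}
  {π c : E → Fin k}

theorem IsSolution.to_nonLoops (h : IsSolution g F v A ∅ π c) :
    IsSolution g (nonLoops g F) v A ∅ π c := by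
  refine ⟨fun e he => h.agree e (mem_nonLoops.1 he).1, fun i Z hZ => ?_,
    fun _ t ht => absurd ht (Set.notMem_empty t)⟩
  obtain ⟨e, he, hei, hev, hZe⟩ := h.conn i Z (hZ.mono fun x hx => ⟨hx.1, hx.2.imp_right
    fun ⟨e, he, h'⟩ => ⟨e, (mem_nonLoops.1 he).1, h'⟩⟩)
  exact ⟨e, mem_nonLoops.2 ⟨he, fun h' => hZe (by rw [h'])⟩, hei, hev, hZe⟩

theorem IsSolution.of_nonLoops (h : IsSolution g (nonLoops g F) v A B π c)
    (hloop : ∀ e ∈ F, Inc g e v → (g e).1 ≠ (g e).2) : IsSolution g F v A ∅ π c := by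
  refine ⟨fun e he hev => h.agree e (mem_nonLoops.2 ⟨he, hloop e he hev⟩) hev, fun i Z hZ => ?_,
    fun _ t ht => absurd ht (Set.notMem_empty t)⟩
  obtain ⟨e, he, h'⟩ := h.conn i Z (hZ.mono fun x hx => ⟨hx.1, hx.2.imp_right
    fun ⟨e, he, hi, hev, h'⟩ => ⟨e, mem_nonLoops.2 ⟨he, hloop e he hev⟩, hi, hev, h'⟩⟩)
  exact ⟨e, (mem_nonLoops.1 he).1, h'⟩

theorem IsSolution.forget (h : IsSolution g F v A B π c) : IsSolution g F v A ∅ π c :=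
  ⟨h.agree, h.conn, fun _ t ht => absurd ht (Set.notMem_empty t)⟩

/-- The inside of a minimal set `X` that is separated from the rest by a small cut. -/
theorem exists_solution_inside [Fintype V] {N : ℕ} (hk : 0 < k) (hN : 36 * k ≤ N)
    (hR : ∀ r ∈ R, N - 2 * k ≤ (F.filter fun e => Inc g e r).card) (hvX : v ∉ X)
    (hXR : (R ∩ X).Nonempty) (hX : cut g F X < N - 4 * k)
    (hmin : ∀ Y ⊆ X, (R ∩ Y).Nonempty → Y ≠ X → N - 4 * k ≤ cut g F Y) :
    ∃ c, IsSolution (mapEnds (shrink Xᶜ v) g) (nonLoops (mapEnds (shrink Xᶜ v) g) F) v (R ∩ X) ∅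
      π c ∧ ∀ t ∈ R ∩ X, ∀ i,
        2 ≤ (F.filter fun e => Inc (mapEnds (shrink Xᶜ v) g) e t ∧ c e = i).card := by
  have hvX' : v ∈ Xᶜ := hvX
  set g' := mapEnds (shrink Xᶜ v) g with hg'
  have hinc : ∀ {t e}, t ∈ X → (Inc g' e t ↔ Inc g e t) := fun {t e} ht =>
    inc_iff_of_not_mem hvX' (not_not.2 ht)
  have hpre : ∀ Z, v ∉ Z → shrink Xᶜ v ⁻¹' Z = Z ∩ X := by
    intro Z hvZ
    ext y
    by_cases h : y ∈ X
    · simp [shrink, h]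
    · simp [shrink, h, hvZ]
  have hcut : ∀ Z, v ∉ Z → cut g' F Z = cut g F (Z ∩ X) := by
    intro Z hvZ
    rw [← hpre Z hvZ, hg', ← cut_nonLoops, cut_mapEnds]
  have hdeg : cut g' F {v} = cut g F X := by
    rw [hg', ← cut_nonLoops, cut_mapEnds, preimage_shrink_compl_singleton hvX, cut_compl]
  have hlow : ∀ Z, v ∉ Z → (R ∩ (Z ∩ X)).Nonempty → cut g F X ≤ cut g' F Z := by
    intro Z hvZ hne
    rw [hcut Z hvZ]
    by_cases h : Z ∩ X = X
    · rw [h]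
    · exact hX.le.trans (hmin _ Set.inter_subset_right hne h)
  have hvR : v ∉ R ∩ X := fun h => hvX h.2
  by_cases hone : ∃ r, R ∩ X = {r}
  · obtain ⟨r, hr⟩ := hone
    have hrX : r ∈ R ∩ X := hr ▸ rfl
    obtain ⟨c, hc, hbal⟩ := exists_solution_single (g := g') (F := F) (v := v) (r := r) (π := π) hk
      (fun h => hvR (h ▸ hrX)) (fun Z hrZ hvZ => hlow Z hvZ ⟨r, hrX.1, hrZ, hrX.2⟩) hdeg <| by
        have h1 := hR r hrX.1
        simp only [hinc hrX.2]
        omega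
    rw [hr]
    exact ⟨c, hc, fun t ht => by rw [Set.mem_singleton_iff.1 ht]; exact hbal⟩
  · have htwo : ∃ s ∈ R ∩ X, ∃ t ∈ R ∩ X, s ≠ t := by
      by_contra! h
      obtain ⟨r, hr⟩ := hXR
      exact hone ⟨r, Set.eq_singleton_iff_unique_mem.2 ⟨hr, fun t ht => h t ht r hr⟩⟩
    have hkey : ∀ Z, v ∉ Z → req (R ∩ X) (insert v (R ∩ X)) (N - 4 * k) (cut g F X) Z ≤
        cut g' F Z := by
      intro Z hvZ
      rw [req]
      split_ifs with h1 h2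
      · obtain ⟨⟨a, ha, haZ⟩, b, hb, hbZ⟩ := h1
        rw [hcut Z hvZ]
        refine hmin _ Set.inter_subset_right ⟨a, ha.1, haZ, ha.2⟩ fun h => hbZ (h.ge hb.2).1
      · obtain ⟨⟨a, ha, haZ⟩, -⟩ := h2
        have ha' := ha.resolve_left fun h => hvZ (h ▸ haZ)
        exact hlow Z hvZ ⟨a, ha'.1, haZ, ha'.2⟩
      · exact Nat.zero_le _
    have hI : IsInstance g' (nonLoops g' F) Finset.univ v (R ∩ X)
        (insert v (R ∩ X)) (N - 4 * k) (cut g F X) π := by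
      refine ⟨fun e _ => ⟨Finset.mem_univ _, Finset.mem_univ _⟩, fun e he => (mem_nonLoops.1 he).2,
        Set.mem_insert _ _, Set.subset_insert _ _, fun _ _ => Finset.mem_univ _, hX.le, hk,
        fun Z => ?_, ?_, Or.inr ⟨hvR, hXR, rfl, by omega⟩⟩
      · rw [cut_nonLoops]
        by_cases hvZ : v ∈ Z
        · rw [← req_compl, ← cut_compl Z]
          exact hkey Zᶜ (not_not.2 hvZ)
        · exact hkey _ hvZ
      · rw [cut_nonLoops, hdeg, req, if_neg, if_pos]
        · obtain ⟨r, hr⟩ := hXR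
          exact ⟨⟨v, Set.mem_insert _ _, rfl⟩, r, Set.mem_insert_of_mem _ hr,
            fun h => hvR (h ▸ hr)⟩
        · rintro ⟨⟨a, ha, rfl⟩, -⟩
          exact hvR ha
    obtain ⟨c, hc⟩ := hI.exists_solution
    refine ⟨c, hc.forget, fun t ht i => ?_⟩
    obtain ⟨s, hs, s', hs', hss⟩ := htwo
    refine (hc.bal (Or.inl ⟨s, Or.inr hs, s', Or.inr hs', fun h => hvR (h ▸ hs),
      fun h => hvR (h ▸ hs'), hss⟩) t (Or.inr ht) (fun h => hvR (h ▸ ht)) i).trans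
      (Finset.card_le_card fun e he => ?_)
    rw [Finset.mem_filter] at he ⊢
    exact ⟨(mem_nonLoops.1 he.1).1, he.2⟩

theorem exists_solution_of_ncard [Fintype V] {N : ℕ} (hk : 0 < k) (hN : 36 * k ≤ N) (hvS : v ∈ S)
    (hS : ∃ a ∈ S, a ≠ v) (n : ℕ) :
    ∀ (g : E → V × V) (R : Set V), R.ncard = n → (∀ e ∈ F, Inc g e v → (g e).1 ≠ (g e).2) →
    (∀ Z, Splits S Z → N ≤ cut g F Z) → cut g F {v} = N →
    (∀ i, 2 ≤ (F.filter fun e => Inc g e v ∧ π e = i).card) →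
    (∀ r ∈ R, N - 2 * k ≤ (F.filter fun e => Inc g e r).card) →
    ∃ c, IsSolution g F v S ∅ π c ∧ ∀ t ∈ S ∪ R, t ≠ v → ∀ i,
      2 ≤ (F.filter fun e => Inc g e t ∧ c e = i).card := by
  induction n using Nat.strong_induction_on with
  | _ n ih =>
  intro g R hn hloop hcut hdeg hP hR
  by_cases hisl : ∃ X, v ∉ X ∧ Disjoint S X ∧ (R ∩ X).Nonempty ∧ cut g F X < N - 4 * k
  · obtain ⟨X, ⟨hvX, hSX, ⟨x, hxR, hxX⟩, hX⟩, hmin⟩ := exists_minimal_of_wellFoundedLT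
      (fun X : Set V => v ∉ X ∧ Disjoint S X ∧ (R ∩ X).Nonempty ∧ cut g F X < N - 4 * k) hisl
    have hSX' : ∀ s ∈ S, s ∉ X := fun s hs hsX => Set.disjoint_left.1 hSX hs hsX
    have hvX' : v ∈ Xᶜ := hvX
    have hxv : x ≠ v := fun h => hvX (h ▸ hxX)
    have hout : ∀ y, y ∉ X → shrink X x y = y := fun y hy => if_neg hy
    have hsv : ∀ y, shrink X x y = v ↔ y = v := by
      intro y
      unfold shrink
      split_ifs with h
      · exact ⟨fun h' => absurd h' hxv, fun h' => absurd (h' ▸ h) hvX⟩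
      · rfl
    have himg : shrink X x '' S = S := by
      ext y
      constructor
      · rintro ⟨s, hs, rfl⟩
        rwa [hout s (hSX' s hs)]
      · exact fun hy => ⟨y, hy, hout y (hSX' y hy)⟩
    have hinc₁ : ∀ {y e}, y ∉ X → (Inc (mapEnds (shrink X x) g) e y ↔ Inc g e y) := fun hy =>
      inc_iff_of_not_mem hxX hy
    have hcut₁ : ∀ Z, cut (mapEnds (shrink X x) g) F Z = cut g F (shrink X x ⁻¹' Z) := by
      intro Z
      rw [← cut_nonLoops, cut_mapEnds]
    obtain ⟨c₁, hc₁, hbal₁⟩ := ih (R \ X).ncard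
      (hn ▸ Set.ncard_lt_ncard ⟨Set.sdiff_subset, fun h => (h hxR).2 hxX⟩)
      (mapEnds (shrink X x) g) (R \ X) rfl
      (fun e he hev h => by
        have h1 := hloop e he ((hinc₁ hvX).1 hev)
        have h2 : Inc g e v := (hinc₁ hvX).1 hev
        simp only [mapEnds] at h
        rcases h2 with h2 | h2
        · rw [h2, hout v hvX, eq_comm, hsv] at h
          exact h1 (h2.trans h.symm)
        · rw [h2, hout v hvX, hsv] at h
          exact h1 (h.trans h2.symm))
      (fun Z hZ => by
        rw [hcut₁]
        refine hcut _ ((splits_image _ _).1 ?_)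
        rwa [himg])
      (by
        have : shrink X x ⁻¹' {v} = {v} := by ext y; simp [hsv]
        rw [hcut₁, this, hdeg])
      (fun i => by simpa only [hinc₁ hvX] using hP i)
      (fun r hr => by simpa only [hinc₁ hr.2] using hR r hr.1)
    obtain ⟨c₂, hc₂, hbal₂⟩ := exists_solution_inside (g := g) (F := F) (R := R) (X := X) (π := c₁)
      hk hN hR hvX ⟨x, hxR, hxX⟩ hX fun Y hYX hY hne => by
        by_contra h
        exact hne (hYX.antisymm (hmin (y := Y) ⟨fun h => hvX (hYX h), hSX.mono_right hYX, hY,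
          not_le.1 h⟩ hYX))
    have hglue := IsSolution.glue (A := S) (B := ∅) (A' := R ∩ X) (B' := ∅) (π := π) hloop hvX hxX
      (fun h => absurd h Set.not_nonempty_empty)
      (by rw [himg, Set.image_empty]; exact hc₁.to_nonLoops) hc₂
      (fun _ a ha haX => absurd haX (hSX' a ha)) (fun t ht => absurd ht (Set.notMem_empty t))
    have hcol : ∀ {e y}, y ∉ X → Inc g e y →
        (if (g e).1 ∈ X ∧ (g e).2 ∈ X then c₂ e else c₁ e) = c₁ e := by
      rintro e y hy (rfl | rfl)
      exacts [if_neg fun h => hy h.1, if_neg fun h => hy h.2]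
    refine ⟨_, hglue, fun t ht htv i => ?_⟩
    by_cases htX : t ∈ X
    · have htR := ht.resolve_left fun h => hSX' t h htX
      refine (hbal₂ t ⟨htR, htX⟩ i).trans (Finset.card_le_card fun e he => ?_)
      rw [Finset.mem_filter] at he ⊢
      have het : Inc g e t := (inc_iff_of_not_mem hvX' (not_not.2 htX)).1 he.2.1
      refine ⟨he.1, het, ?_⟩
      by_cases h : (g e).1 ∈ X ∧ (g e).2 ∈ X
      · rw [if_pos h]; exact he.2.2
      · have hy : ∃ y, y ∉ X ∧ Inc g e y := by
          by_contra! h'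
          exact h ⟨not_not.1 fun h1 => h' _ h1 (Or.inl rfl),
            not_not.1 fun h1 => h' _ h1 (Or.inr rfl)⟩
        obtain ⟨y, hy, hey⟩ := hy
        rw [if_neg h, ← he.2.2]
        refine (hc₂.agree e (mem_nonLoops_of_inc he.1 het hey ?_)
          ((inc_shrink_self hvX').2 ⟨y, hy, hey⟩)).symm
        rw [shrink, if_neg (show t ∉ Xᶜ from not_not.2 htX), shrink, if_pos (show y ∈ Xᶜ from hy)]
        exact htv
    · refine (hbal₁ t (ht.imp_right fun h => ⟨h, htX⟩) htv i).trans
        (Finset.card_le_card fun e he => ?_)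
      rw [Finset.mem_filter] at he ⊢
      have het := (hinc₁ htX).1 he.2.1
      exact ⟨he.1, het, (hcol htX het).trans he.2.2⟩
  · push Not at hisl
    have hkey : ∀ Z, v ∉ Z → req S (S ∪ R) N (N - 4 * k) Z ≤ cut g F Z := by
      intro Z hvZ
      rw [req]
      split_ifs with h1 h2
      · exact hcut Z h1
      · have hSZ : ∀ s ∈ S, s ∉ Z := fun s hs hsZ => h1 ⟨⟨s, hs, hsZ⟩, v, hvS, hvZ⟩
        obtain ⟨⟨a, ha, haZ⟩, -⟩ := h2
        exact hisl Z hvZ (Set.disjoint_left.2 hSZ)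
          ⟨a, ha.resolve_left fun h => hSZ a h haZ, haZ⟩
      · exact Nat.zero_le _
    have hI : IsInstance g (nonLoops g F) Finset.univ v S (S ∪ R) N (N - 4 * k)
        π := by
      refine ⟨fun e _ => ⟨Finset.mem_univ _, Finset.mem_univ _⟩, fun e he => (mem_nonLoops.1 he).2,
        Or.inl hvS, Set.subset_union_left, fun _ _ => Finset.mem_univ _, Nat.sub_le _ _, hk,
        fun Z => ?_, ?_, Or.inl ⟨hvS, hS, by omega, by omega, fun i => ?_⟩⟩
      · rw [cut_nonLoops]
        by_cases hvZ : v ∈ Z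
        · rw [← req_compl, ← cut_compl Z]
          exact hkey Zᶜ (not_not.2 hvZ)
        · exact hkey _ hvZ
      · obtain ⟨a, ha, hav⟩ := hS
        have hsp : Splits S {v} := ⟨⟨v, hvS, rfl⟩, a, ha, hav⟩
        rw [cut_nonLoops, hdeg, req_of_splits hsp]
      · refine (hP i).trans (Finset.card_le_card fun e he => ?_)
        rw [Finset.mem_filter] at he ⊢
        exact ⟨mem_nonLoops.2 ⟨he.1, hloop e he.1 he.2.1⟩, he.2⟩
    obtain ⟨c, hc⟩ := hI.exists_solution
    refine ⟨c, hc.of_nonLoops hloop, fun t ht htv i => ?_⟩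
    rcases hI.kind with h | h
    · refine (hc.bal (Or.inr h.2.2.2.2) t ht htv i).trans (Finset.card_le_card fun e he => ?_)
      rw [Finset.mem_filter] at he ⊢
      exact ⟨(mem_nonLoops.1 he.1).1, he.2⟩
    · exact absurd hvS h.1

end Islands

section Translation
open scoped Classical

variable {V E : Type} {k : ℕ} {ends : E → Sym2 V} {g : E → V × V} {H : Set E} {a b v : V}
  {Z : Set V}

theorem mem_ends_iff (hg : ∀ e, ends e = s((g e).1, (g e).2)) {e : E} {x : V} :
    x ∈ ends e ↔ Inc g e x := by
  rw [hg, Sym2.mem_iff, Inc, eq_comm, @eq_comm _ x]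

theorem crosses_of_ends (hg : ∀ e, ends e = s((g e).1, (g e).2)) {e : E} (he : ends e = s(a, b))
    (ha : a ∈ Z) (hb : b ∉ Z) : Crosses g Z e :=
  crosses_iff_exists.2 ⟨a, b, ha, hb, (mem_ends_iff hg).1 (he ▸ Sym2.mem_mk_left a b),
    (mem_ends_iff hg).1 (he ▸ Sym2.mem_mk_right a b)⟩

theorem IsWalk.exists_crosses (hg : ∀ e, ends e = s((g e).1, (g e).2)) {l : List E}
    (h : IsWalk ends a b l) (ha : a ∈ Z) (hb : b ∉ Z) : ∃ e ∈ l, Crosses g Z e := by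
  induction h with
  | nil => exact absurd ha hb
  | @cons u w _ e l he _ ih =>
    by_cases hw : w ∈ Z
    · obtain ⟨e', he', h'⟩ := ih hw hb
      exact ⟨e', List.mem_cons_of_mem _ he', h'⟩
    · exact ⟨e, List.mem_cons_self, crosses_of_ends hg he ha hw⟩

theorem Reaches.exists_crosses (hg : ∀ e, ends e = s((g e).1, (g e).2))
    (h : Reaches ends H a b) (ha : a ∈ Z) (hb : b ∉ Z) : ∃ e ∈ H, Crosses g Z e := by
  induction h with
  | refl => exact absurd ha hb
  | @tail c d _ hcd ih =>
    by_cases hc : c ∈ Z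
    · obtain ⟨e, he, h⟩ := hcd
      exact ⟨e, he, crosses_of_ends hg h hc hb⟩
    · exact ih hc

theorem step_of_inc (hg : ∀ e, ends e = s((g e).1, (g e).2)) {e : E} (he : e ∈ H) (hab : a ≠ b)
    (ha : Inc g e a) (hb : Inc g e b) : Step ends H a b :=
  ⟨e, he, (Sym2.mem_and_mem_iff hab).1 ⟨(mem_ends_iff hg).2 ha, (mem_ends_iff hg).2 hb⟩⟩

theorem reaches_of_exists_crosses (hg : ∀ e, ends e = s((g e).1, (g e).2))
    (h : ∀ Z, a ∈ Z → b ∉ Z → ∃ e ∈ H, Crosses g Z e) : Reaches ends H a b := by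
  by_contra hab
  obtain ⟨e, he, hZ⟩ := h {y | Reaches ends H a y} Relation.ReflTransGen.refl hab
  obtain ⟨x, y, hx, hy, hex, hey⟩ := crosses_iff_exists.1 hZ
  exact hy (Relation.ReflTransGen.tail hx (step_of_inc hg he (fun h => hy (h ▸ hx)) hex hey))

theorem le_cut_of_edgeDisjointPathsIn [Fintype E] (hg : ∀ e, ends e = s((g e).1, (g e).2)) {n : ℕ}
    (h : EdgeDisjointPathsIn ends Set.univ n a b) (ha : a ∈ Z) (hb : b ∉ Z) :
    n ≤ cut g Finset.univ Z := by
  obtain ⟨P, hP, hdisj⟩ := h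
  choose f hf hfZ using fun i => (hP i).1.exists_crosses hg ha hb
  have := Finset.card_le_card_of_injOn (s := (Finset.univ : Finset (Fin n)))
    (t := Finset.univ.filter (Crosses g Z)) f
    (fun i _ => Finset.mem_coe.2 (Finset.mem_filter.2 ⟨Finset.mem_univ _, hfZ i⟩))
    (fun i _ j _ hij => by
      by_contra hne
      exact hdisj i j hne (f i) (hf i) (hij ▸ hf j))
  rwa [Finset.card_univ, Fintype.card_fin] at this

theorem not_isCutVertexOf (hg : ∀ e, ends e = s((g e).1, (g e).2)) {T : Set V}
    (hT : ∀ x ≠ v, ∀ e ∈ H, Inc g e v → Inc g e x → x ∈ T)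
    (hconn : ∀ Z, Splits T Z → ∃ e ∈ H, ¬ Inc g e v ∧ Crosses g Z e) :
    ¬ IsCutVertexOf ends H v := by
  rintro ⟨a, b, hav, hbv, hab, hn⟩
  set H' : Set E := {e ∈ H | v ∉ ends e} with hH'
  have hmem : ∀ {e}, e ∈ H → ¬ Inc g e v → e ∈ H' := fun he h =>
    ⟨he, mt (mem_ends_iff hg).1 h⟩
  set Z : Set V := {y | y ≠ v ∧ Reaches ends H' a y} with hZ
  have hcl : ∀ x y e, e ∈ H → ¬ Inc g e v → x ∈ Z → y ∉ Z → Inc g e x → Inc g e y → False := by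
    intro x y e he hev hx hy hex hey
    exact hy ⟨fun h => hev (h ▸ hey),
      hx.2.tail (step_of_inc hg (hmem he hev) (fun h => hy (h ▸ hx)) hex hey)⟩
  have haZ : a ∈ Z := ⟨hav, Relation.ReflTransGen.refl⟩
  have hbZ : b ∉ Z := fun h => hn h.2
  by_cases hTZ : ∃ t ∈ T, t ∈ Z
  · have hsub : ∀ t ∈ T, t ∈ Z := by
      intro t ht
      by_contra htZ
      obtain ⟨e, he, hev, hZe⟩ := hconn Z ⟨hTZ, t, ht, htZ⟩
      obtain ⟨x, y, hx, hy, hex, hey⟩ := crosses_iff_exists.1 hZe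
      exact hcl x y e he hev hx hy hex hey
    obtain ⟨e, he, hZe⟩ := hab.exists_crosses hg (Z := insert v Z) (Or.inr haZ)
      fun h => h.elim hbv hbZ
    obtain ⟨x, y, hx, hy, hex, hey⟩ := crosses_iff_exists.1 hZe
    have hyv : y ≠ v := fun h => hy (Or.inl h)
    by_cases hev : Inc g e v
    · exact hy (Or.inr (hsub y (hT y hyv e he hev hey)))
    · exact hcl x y e he hev (hx.resolve_left fun h => hev (h ▸ hex)) (fun h => hy (Or.inr h))
        hex hey
  · obtain ⟨e, he, hZe⟩ := hab.exists_crosses hg haZ hbZ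
    obtain ⟨x, y, hx, hy, hex, hey⟩ := crosses_iff_exists.1 hZe
    by_cases hev : Inc g e v
    · exact hTZ ⟨x, hT x hx.1 e he hev hex, hx⟩
    · exact hcl x y e he hev hx hy hex hey

theorem connectsSet_of_cuts (hg : ∀ e, ends e = s((g e).1, (g e).2)) {T S : Set V} {x : V}
    (hST : ∀ s ∈ S, s ≠ v → s ∈ T) (hx : x ∈ T) {e₀ : E} (he₀ : e₀ ∈ H) (hev : Inc g e₀ v)
    (hex : Inc g e₀ x) (hconn : ∀ Z, Splits T Z → ∃ e ∈ H, ¬ Inc g e v ∧ Crosses g Z e) :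
    ConnectsSet ends H S := by
  intro a ha b hb
  refine reaches_of_exists_crosses hg fun Z haZ hbZ => ?_
  by_cases hZ : Crosses g Z e₀
  · exact ⟨e₀, he₀, hZ⟩
  have hvx : v ∈ Z ↔ x ∈ Z := by
    by_contra h
    refine hZ (crosses_iff_exists.2 ?_)
    by_cases hvZ : v ∈ Z
    · exact ⟨v, x, hvZ, fun h' => h (iff_of_true hvZ h'), hev, hex⟩
    · exact ⟨x, v, by tauto, hvZ, hex, hev⟩
  have hrep : ∀ s ∈ S, ∃ t ∈ T, t ∈ Z ↔ s ∈ Z := by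
    intro s hs
    by_cases hsv : s = v
    · exact ⟨x, by simp [hx, hsv, hvx]⟩
    · exact ⟨s, by simp [hST s hs hsv]⟩
  obtain ⟨t, ht, htZ⟩ := hrep a ha
  obtain ⟨t', ht', htZ'⟩ := hrep b hb
  obtain ⟨e, he, -, h⟩ := hconn Z ⟨⟨t, ht, htZ.2 haZ⟩, t', ht', mt htZ'.1 hbZ⟩
  exact ⟨e, he, h⟩

theorem ncard_incEdges_inter [Fintype E] (hg : ∀ e, ends e = s((g e).1, (g e).2)) (c : E → Fin k)
    (i : Fin k) (u : V) : (incEdges ends u ∩ {e | c e = i}).ncard =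
      (Finset.univ.filter fun e => Inc g e u ∧ c e = i).card := by
  rw [← Set.ncard_coe_finset]
  congr 1
  ext e
  simp [incEdges, mem_ends_iff hg]

theorem deg_eq_card_inc [Fintype E] (hg : ∀ e, ends e = s((g e).1, (g e).2)) (u : V) :
    deg ends u = (Finset.univ.filter fun e => Inc g e u).card := by
  rw [deg, ← Set.ncard_coe_finset]
  congr 1
  ext e
  simp [incEdges, mem_ends_iff hg]

end Translation

/-- (Extension Theorem) Let `Q ≥ 36` be an integer, `k ≥ 1`,
`G` a multigraph possibly with self-loops, `S, R ⊆ V(G)` disjoint with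
`|S| ≥ 2`, and let `v ∈ S` be incident to no self-loops with `d(v) = Qk`,
together with a balanced edge subpartition `P` of `E(v)` into `k` parts.
If `S` is `Qk`-edge-connected and every vertex of `R` is incident to at least
`(Q−2)k` edges, then there are `k` pairwise edge-disjoint `S`-subgraphs that
balance `S ∪ R` and extend `P`. -/
theorem extension_theorem {V E : Type} [Fintype V] [Fintype E]
    (ends : E → Sym2 V) (Q k : ℕ) (hQ : 36 ≤ Q) (hk : 0 < k)
    (S R : Set V) (hSR : Disjoint S R) (hS : 2 ≤ S.ncard)
    (v : V) (hvS : v ∈ S)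
    (hvloop : ∀ e : E, v ∈ ends e → ¬ (ends e).IsDiag)
    (hdeg : deg ends v = Q * k)
    (P : Fin k → Set E) (hP : IsBalancedSubpartitionAt ends v P)
    (hconn : EdgeConnectedIn ends Set.univ S (Q * k))
    (hR : ∀ r ∈ R, (Q - 2) * k ≤ deg ends r) :
    ∃ H : Fin k → Set E, PairwiseEdgeDisjoint H ∧
      (∀ i, ConnectsSet ends (H i) S) ∧
      BalanceSet ends H (S ∪ R) ∧ Extend ends v P H := by
  classical
  obtain ⟨g, hg⟩ : ∃ g : E → V × V, ∀ e, ends e = s((g e).1, (g e).2) :=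
    ⟨fun e => (ends e).out, fun e => (Quot.out_eq (ends e)).symm⟩
  obtain ⟨-, P', ⟨⟨hPv, hPd⟩, hPU, hP2⟩, hPP⟩ := hP
  have hmem : ∀ {e u}, e ∈ incEdges ends u ↔ Inc g e u := mem_ends_iff hg
  have hπ : ∀ e, ∃ j, Inc g e v → e ∈ P' j := by
    intro e
    by_cases he : Inc g e v
    · rw [← hmem, ← hPU, Set.mem_iUnion] at he
      exact he.imp fun j hj _ => hj
    · exact ⟨⟨0, hk⟩, fun h => absurd h he⟩
  choose π hπ using hπ
  have hπP : ∀ {e j}, e ∈ P' j → π e = j := by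
    intro e j he
    by_contra hne
    exact Set.disjoint_left.1 (hPd _ _ hne) (hπ e (hmem.1 (hPv j he))) he
  have hloop : ∀ e ∈ (Finset.univ : Finset E), Inc g e v → (g e).1 ≠ (g e).2 := by
    intro e _ he h
    refine hvloop e (hmem.2 he) ?_
    rw [hg, h]
    exact Sym2.mk_isDiag_iff.2 rfl
  have hP2' : ∀ i, 2 ≤ (Finset.univ.filter fun e => Inc g e v ∧ π e = i).card := by
    intro i
    rw [← ncard_incEdges_inter hg]
    exact (hP2 i).trans (Set.ncard_le_ncard fun e he => ⟨hPv i he, hπP he⟩)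
  have hcutv : cut g Finset.univ {v} = Q * k := by
    rw [← hdeg, deg_eq_card_inc hg, cut]
    congr 1
    ext e
    simp only [Finset.mem_filter, Finset.mem_univ, true_and]
    constructor
    · intro h
      obtain ⟨x, y, rfl, -, hx, -⟩ := crosses_iff_exists.1 h
      exact hx
    · exact fun h => (crosses_singleton (hloop e (Finset.mem_univ _) h)).2 h
  obtain ⟨c, hc, hbal⟩ := exists_solution_of_ncard (F := Finset.univ) (π := π) (N := Q * k) hk
    (Nat.mul_le_mul_right k hQ) hvS (Set.exists_ne_of_one_lt_ncard hS v) _ g R rfl hloop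
    (fun Z ⟨⟨a, ha, haZ⟩, b, hb, hbZ⟩ =>
      le_cut_of_edgeDisjointPathsIn hg (hconn a ha b hb fun h => hbZ (h ▸ haZ)) haZ hbZ)
    hcutv hP2'
    (fun r hr => by
      rw [← Nat.sub_mul, ← deg_eq_card_inc hg]
      exact hR r hr)
  have hT : ∀ i Z, Splits (Target g Finset.univ v S π i) Z →
      ∃ e ∈ {e | c e = i}, ¬ Inc g e v ∧ Crosses g Z e := fun i Z hZ => by
    obtain ⟨e, -, hei, h⟩ := hc.conn i Z hZ
    exact ⟨e, hei, h⟩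
  have hcπ : ∀ {e}, Inc g e v → c e = π e := fun h => hc.agree _ (Finset.mem_univ _) h
  refine ⟨fun i => {e | c e = i}, fun i j hij => Set.disjoint_left.2 fun e hi hj =>
    hij (Eq.trans (Eq.symm hi) hj), fun i => ?_, fun u hu => ?_, fun i => ⟨fun e he => ?_, ?_⟩⟩
  · obtain ⟨e₀, he₀⟩ : (P' i).Nonempty := by
      rw [Set.nonempty_iff_ne_empty]
      intro h
      have := hP2 i
      rw [h, Set.ncard_empty] at this
      omega
    have hev := hmem.1 (hPv i he₀)
    obtain ⟨x, hex, hxv⟩ : ∃ x, Inc g e₀ x ∧ x ≠ v := by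
      by_contra! h
      exact hloop e₀ (Finset.mem_univ _) hev
        ((h _ (Or.inl rfl)).trans (h _ (Or.inr rfl)).symm)
    exact connectsSet_of_cuts hg (T := Target g Finset.univ v S π i)
      (fun s hs hsv => ⟨hsv, Or.inl ⟨hvS, hs⟩⟩)
      ⟨hxv, Or.inr ⟨e₀, Finset.mem_univ _, hπP he₀, hev, hex⟩⟩
      ((hcπ hev).trans (hπP he₀)) hev hex (hT i)
  · have hsub : IsSubpartitionAt ends u fun i => incEdges ends u ∩ {e | c e = i} :=
      ⟨fun i => Set.inter_subset_left, fun i j hij => Set.disjoint_left.2 fun e hi hj =>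
        hij (Eq.trans (Eq.symm hi.2) hj.2)⟩
    refine ⟨hsub, _, ⟨hsub, ?_, fun i => ?_⟩, fun i => subset_rfl⟩
    · ext e
      simp
    · rw [ncard_incEdges_inter hg]
      by_cases huv : u = v
      · refine (hP2' i).trans (Finset.card_le_card fun e he => ?_)
        rw [Finset.mem_filter] at he ⊢
        rw [huv]
        exact ⟨he.1, he.2.1, (hcπ he.2.1).trans he.2.2⟩
      · exact hbal u hu huv i
  · have he' := hPP i he
    exact (hcπ (hmem.1 (hPv i he'))).trans (hπP he')
  · exact not_isCutVertexOf hg (T := Target g Finset.univ v S π i)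
      (fun x hxv e he hev hex =>
        ⟨hxv, Or.inr ⟨e, Finset.mem_univ _, (hcπ hev).symm.trans he, hev, hex⟩⟩) (hT i)

end SteinerPacking
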